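/- arXiv:1805.10204 — 11 statements merged into one kernel-verified Lean document; each statement's English description precedes it below -/
import Mathlib

section
/- There is an absolute constant C > 0 such that the following holds. Let ε > 0, δ ≥ 0, δ' ∈ (0,1). Let 𝒟 be a family of pairs of Borel probability measures on ℝ^d, and suppose every D' ∈ 𝒟 admits a Borel-measurable (ε,δ)-robust classifier f_{D'} (with the sets {x : ℓ_ε(f_{D'},x,i)=1} Borel). Let A ⊆ 𝒟 be a finite subset such that for every D = (D_0,D_1) ∈ 𝒟 there exists D' = (D'_0,D'_1) ∈ A with total variation distances TV(D_0,D'_0) ≤ δ' and TV(D_1,D'_1) ≤ δ'. Then for any D ∈ 𝒟, if n ≥ C·((δ+δ')/δ'²)·log|A|, with probability at least 2/3 over n i.i.d. samples from each of D_0 and D_1, every minimizer over the finite family {f_{D'} : D' ∈ A} of the empirical robust risk max_{i∈{0,1}} (1/n)·Σ_{j=1}^n ℓ_ε(f, X_i(j), i) is an (ε, δ+2δ')-robust classifier for D. -/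
open MeasureTheory

noncomputable section

/-- Points where the `ε`-robust zero-one loss of `f` at label `i` is 1. -/
def badSet {E : Type*} [NormedAddCommGroup E] (ε : ℝ) (f : E → Bool) (i : Bool) : Set E :=
  {x | ∃ z : E, ‖z‖ ≤ ε ∧ f (x + z) ≠ i}

/-- `f` is `(ε, δ)`-robust for the pair `(D false, D true)`. -/
def IsRobust {E : Type*} [NormedAddCommGroup E] [MeasurableSpace E]
    (ε δ : ℝ) (f : E → Bool) (D : Bool → Measure E) : Prop :=
  ∀ i : Bool, D i (badSet ε f i) ≤ ENNReal.ofReal δ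

/-- Empirical `ε`-robust risk. -/
def empRisk {E : Type*} [NormedAddCommGroup E] (ε : ℝ) {n : ℕ}
    (f : E → Bool) (X : Bool → Fin n → E) : ℝ :=
  max ((∑ j : Fin n, (badSet ε f false).indicator (fun _ => (1 : ℝ)) (X false j)) / n)
      ((∑ j : Fin n, (badSet ε f true).indicator (fun _ => (1 : ℝ)) (X true j)) / n)

/-- Total variation distance: `sup` over measurable sets of `|μ s − ν s|`. -/
def tvDist {α : Type*} [MeasurableSpace α] (μ ν : Measure α) : ℝ :=
  ⨆ s : {s : Set α // MeasurableSet s}, |(μ s).toReal - (ν s).toReal|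

/-- Chernoff bound for a sum of indicators. -/
lemma chernoff_aux {E : Type} [MeasurableSpace E] (μ : Measure E) [IsProbabilityMeasure μ]
    (B : Set E) (hB : MeasurableSet B) (n : ℕ) (a s : ℝ) :
    (Measure.pi fun _ : Fin n => μ).real
      {x | a * (n * s) ≤ a * ∑ j : Fin n, B.indicator (fun _ => (1 : ℝ)) (x j)} ≤
      Real.exp (n * (μ.real B * (Real.exp a - 1) - a * s)) := by
  set P := (Measure.pi fun _ : Fin n => μ) with hP
  set g : E → ℝ := fun x => Real.exp (a * B.indicator (fun _ => (1 : ℝ)) x) with hg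
  have hgm : Measurable g := by
    have : Measurable (B.indicator (fun _ => (1 : ℝ))) := measurable_const.indicator hB
    exact (this.const_mul a).exp
  have hgeq : g = fun x => 1 + B.indicator (fun _ => (Real.exp a - 1)) x := by
    funext x
    by_cases hx : x ∈ B <;> simp [hg, hx]
  have hint : ∫ x, g x ∂μ = 1 + μ.real B * (Real.exp a - 1) := by
    rw [hgeq, integral_add (integrable_const _) ((integrable_const _).indicator hB),
      integral_indicator_const _ hB]
    simp
  have hgint : Integrable g μ := by
    rw [hgeq]
    exact (integrable_const _).add ((integrable_const _).indicator hB)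
  have hprod : ∀ x : Fin n → E, Real.exp (1 * (a * ∑ j : Fin n, B.indicator (fun _ => (1 : ℝ)) (x j)))
      = ∏ j, g (x j) := by
    intro x
    rw [one_mul, Finset.mul_sum, Real.exp_sum]
  have hI : Integrable (fun x : Fin n → E => Real.exp (1 * (a * ∑ j : Fin n, B.indicator (fun _ => (1 : ℝ)) (x j)))) P := by
    simp_rw [hprod]
    exact Integrable.fintype_prod (fun _ => hgint)
  refine (ProbabilityTheory.measure_ge_le_exp_mul_mgf (a * (n * s)) zero_le_one hI).trans ?_
  have : ProbabilityTheory.mgf (fun x : Fin n → E => a * ∑ j : Fin n, B.indicator (fun _ => (1 : ℝ)) (x j)) P 1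
      = (1 + μ.real B * (Real.exp a - 1)) ^ n := by
    unfold ProbabilityTheory.mgf
    simp_rw [hprod]
    rw [hP, integral_fintype_prod_eq_pow, hint, Fintype.card_fin]
  rw [this]
  have h0 : 0 ≤ 1 + μ.real B * (Real.exp a - 1) := by
    rw [← hint]; exact integral_nonneg (fun x => (Real.exp_pos _).le)
  have h1 : (1 + μ.real B * (Real.exp a - 1)) ^ n ≤ Real.exp (n * (μ.real B * (Real.exp a - 1))) := by
    rw [Real.exp_nat_mul]
    refine pow_le_pow_left₀ h0 ?_ n
    linarith [Real.add_one_le_exp (μ.real B * (Real.exp a - 1))]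
  calc _ ≤ Real.exp (-1 * (a * (n * s))) * Real.exp (n * (μ.real B * (Real.exp a - 1))) := by gcongr
    _ = _ := by rw [← Real.exp_add]; congr 1; ring

lemma chernoff_upper {E : Type} [MeasurableSpace E] (μ : Measure E) [IsProbabilityMeasure μ]
    (B : Set E) (hB : MeasurableSet B) (n : ℕ) (δ δ' : ℝ) (hδ : 0 ≤ δ) (hδ' : 0 < δ')
    (h : μ.real B ≤ δ + δ') :
    (Measure.pi fun _ : Fin n => μ).real
      {x | n * (δ + 3 / 2 * δ') ≤ ∑ j : Fin n, B.indicator (fun _ => (1 : ℝ)) (x j)} ≤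
      Real.exp (-(n * (δ' ^ 2 / (32 * (δ + δ'))))) := by
  have hq : 0 < δ + δ' := by positivity
  obtain ⟨l, hl⟩ : ∃ l, l = δ' / (4 * (δ + δ')) := ⟨_, rfl⟩
  have hl0 : 0 < l := by rw [hl]; positivity
  have hl1 : l ≤ 1 := by rw [hl, div_le_one (by positivity)]; linarith
  have hll : l * (δ + δ') = δ' / 4 := by rw [hl]; field_simp
  have he : δ' ^ 2 / (32 * (δ + δ')) = l * δ' / 8 := by rw [hl]; field_simp; norm_num
  have hset : {x : Fin n → E | n * (δ + 3 / 2 * δ') ≤ ∑ j : Fin n, B.indicator (fun _ => (1 : ℝ)) (x j)}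
      = {x | l * (n * (δ + 3 / 2 * δ')) ≤ l * ∑ j : Fin n, B.indicator (fun _ => (1 : ℝ)) (x j)} := by
    ext x; simp only [Set.mem_setOf_eq, mul_le_mul_iff_right₀ hl0]
  rw [hset]
  refine (chernoff_aux μ B hB n l _).trans ?_
  rw [Real.exp_le_exp, ← mul_neg]
  refine mul_le_mul_of_nonneg_left ?_ (Nat.cast_nonneg n)
  have h1 := Real.abs_exp_sub_one_sub_id_le (x := l) (by rw [abs_of_pos hl0]; exact hl1)
  have h2 := (abs_le.1 h1).2
  have h3 : 0 ≤ Real.exp l - 1 := by linarith [Real.add_one_le_exp l]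
  have h4 : μ.real B * (Real.exp l - 1) ≤ (δ + δ') * (l + l ^ 2) :=
    mul_le_mul h (by linarith) h3 hq.le
  have h5 : (δ + δ') * l ^ 2 = l * δ' / 4 := by
    calc _ = l * (l * (δ + δ')) := by ring
      _ = _ := by rw [hll]; ring
  rw [he]
  have : 0 < l * δ' := by positivity
  nlinarith

lemma chernoff_lower {E : Type} [MeasurableSpace E] (μ : Measure E) [IsProbabilityMeasure μ]
    (B : Set E) (hB : MeasurableSet B) (n : ℕ) (δ δ' : ℝ) (hδ : 0 ≤ δ) (hδ' : 0 < δ')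
    (h : δ + 2 * δ' ≤ μ.real B) :
    (Measure.pi fun _ : Fin n => μ).real
      {x | ∑ j : Fin n, B.indicator (fun _ => (1 : ℝ)) (x j) ≤ n * (δ + 3 / 2 * δ')} ≤
      Real.exp (-(n * (δ' ^ 2 / (32 * (δ + δ'))))) := by
  have hq : 0 < δ + δ' := by positivity
  have hr : 0 < δ + 2 * δ' := by positivity
  obtain ⟨l, hl⟩ : ∃ l, l = δ' / (4 * (δ + 2 * δ')) := ⟨_, rfl⟩
  have hl0 : 0 < l := by rw [hl]; positivity
  have hl1 : l ≤ 1 := by rw [hl, div_le_one (by positivity)]; linarith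
  have hll : l * (δ + 2 * δ') = δ' / 4 := by rw [hl]; field_simp
  have he : δ' ^ 2 / (32 * (δ + δ')) ≤ l * δ' / 4 := by
    rw [show l * δ' / 4 = δ' ^ 2 / (16 * (δ + 2 * δ')) by rw [hl]; field_simp; norm_num]
    exact div_le_div_of_nonneg_left (by positivity) (by positivity) (by linarith)
  have hset : {x : Fin n → E | ∑ j : Fin n, B.indicator (fun _ => (1 : ℝ)) (x j) ≤ n * (δ + 3 / 2 * δ')}
      = {x | (-l) * (n * (δ + 3 / 2 * δ')) ≤ (-l) * ∑ j : Fin n, B.indicator (fun _ => (1 : ℝ)) (x j)} := by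
    ext x; simp only [Set.mem_setOf_eq, neg_mul, neg_le_neg_iff, mul_le_mul_iff_right₀ hl0]
  rw [hset]
  refine (chernoff_aux μ B hB n (-l) _).trans ?_
  rw [Real.exp_le_exp, ← mul_neg]
  refine mul_le_mul_of_nonneg_left ?_ (Nat.cast_nonneg n)
  have h1 := Real.abs_exp_sub_one_sub_id_le (x := -l) (by rw [abs_neg, abs_of_pos hl0]; exact hl1)
  have h2 := (abs_le.1 h1).2
  have h3 : Real.exp (-l) - 1 ≤ 0 := by
    have := Real.exp_le_one_iff.2 (neg_nonpos.2 hl0.le)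
    linarith
  have h4 : μ.real B * (Real.exp (-l) - 1) ≤ (δ + 2 * δ') * (Real.exp (-l) - 1) :=
    mul_le_mul_of_nonpos_right h h3
  have h6 : (δ + 2 * δ') * (Real.exp (-l) - 1) ≤ (δ + 2 * δ') * (-l + l ^ 2) :=
    mul_le_mul_of_nonneg_left (by linarith) hr.le
  have h5 : (δ + 2 * δ') * l ^ 2 = l * δ' / 4 := by
    calc _ = l * (l * (δ + 2 * δ')) := by ring
      _ = _ := by rw [hll]; ring
  nlinarith

lemma prod_marg {E F : Type} [MeasurableSpace E] [MeasurableSpace F] (μ : Measure E)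
    (ν : Measure F) [IsProbabilityMeasure μ] [IsProbabilityMeasure ν] (S : Set E) (T : Set F) :
    (μ.prod ν) {p | p.1 ∈ S} = μ S ∧ (μ.prod ν) {p | p.2 ∈ T} = ν T := by
  constructor
  · rw [show {p : E × F | p.1 ∈ S} = S ×ˢ Set.univ by ext; simp, Measure.prod_prod]; simp
  · rw [show {p : E × F | p.2 ∈ T} = Set.univ ×ˢ T by ext; simp, Measure.prod_prod]; simp

lemma tv_le {α : Type} [MeasurableSpace α] (μ ν : Measure α) [IsProbabilityMeasure μ]
    [IsProbabilityMeasure ν] (s : Set α) (hs : MeasurableSet s) :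
    μ.real s ≤ ν.real s + tvDist μ ν := by
  have hb : BddAbove (Set.range fun s : {s : Set α // MeasurableSet s} =>
      |(μ s).toReal - (ν s).toReal|) := by
    refine ⟨1, ?_⟩
    rintro _ ⟨t, rfl⟩
    have h1 : μ.real t ≤ 1 := measureReal_le_one
    have h2 : ν.real t ≤ 1 := measureReal_le_one
    have h3 : 0 ≤ μ.real t := measureReal_nonneg
    have h4 : 0 ≤ ν.real t := measureReal_nonneg
    simp only [Measure.real] at *
    rw [abs_le]; constructor <;> linarith
  have := le_ciSup hb ⟨s, hs⟩
  have h2 := le_abs_self ((μ s).toReal - (ν s).toReal)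
  simp only [tvDist, Measure.real] at *
  linarith

/-- Robust ERM over the classifiers of a finite TV-cover `A` of a robustly
feasible family `𝒟` yields `(ε, δ+2δ')`-robust classifiers from
`n ≳ ((δ+δ')/δ'²)·log |A|` samples. -/
theorem stmt1 :
    ∃ C : ℝ, 0 < C ∧
    ∀ (E : Type) [NormedAddCommGroup E] [NormedSpace ℝ E] [FiniteDimensional ℝ E]
      [MeasurableSpace E] [BorelSpace E],
    ∀ ε δ δ' : ℝ, 0 < ε → 0 ≤ δ → 0 < δ' → δ' < 1 →
    ∀ 𝒟 : Set (Bool → Measure E),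
    (∀ D ∈ 𝒟, ∀ i, IsProbabilityMeasure (D i)) →
    ∀ fc : (Bool → Measure E) → (E → Bool),
    (∀ D' ∈ 𝒟, Measurable (fc D')) →
    (∀ D' ∈ 𝒟, ∀ i : Bool, MeasurableSet (badSet ε (fc D') i)) →
    (∀ D' ∈ 𝒟, IsRobust ε δ (fc D') D') →
    ∀ A : Finset (Bool → Measure E), ↑A ⊆ 𝒟 →
    (∀ D ∈ 𝒟, ∃ D' ∈ A, ∀ i : Bool, tvDist (D i) (D' i) ≤ δ') →
    ∀ D ∈ 𝒟,
    ∀ n : ℕ, C * ((δ + δ') / δ' ^ 2) * Real.log A.card ≤ n →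
    (2 / 3 : ENNReal) ≤
      ((Measure.pi fun _ : Fin n => D false).prod (Measure.pi fun _ : Fin n => D true))
        {p : (Fin n → E) × (Fin n → E) |
          ∀ D' ∈ A,
            (∀ D'' ∈ A, empRisk ε (fc D') (fun i => cond i p.2 p.1) ≤
              empRisk ε (fc D'') (fun i => cond i p.2 p.1)) →
            IsRobust ε (δ + 2 * δ') (fc D') D} := by
  refine ⟨128, by norm_num, ?_⟩
  intro E _ _ _ _ _ ε δ δ' hε hδ hδ' hδ'1 𝒟 hprob fc hfm hbm hrob A hA hcov D hD n hn
  obtain ⟨Ds, hDsA, hDs⟩ := hcov D hD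
  have := hprob D hD
  have := hprob Ds (hA hDsA)
  have hgood : ∀ i, (D i).real (badSet ε (fc Ds) i) ≤ δ + δ' := by
    intro i
    have h1 := tv_le (D i) (Ds i) _ (hbm Ds (hA hDsA) i)
    have h2 : (Ds i).real (badSet ε (fc Ds) i) ≤ δ :=
      ENNReal.toReal_le_of_le_ofReal hδ (hrob Ds (hA hDsA) i)
    linarith [hDs i]
  set P := ((Measure.pi fun _ : Fin n => D false).prod (Measure.pi fun _ : Fin n => D true)) with hP
  by_cases hcard : A.card ≤ 1
  · have hall : ∀ D' ∈ A, D' = Ds := fun D' h => Finset.card_le_one.1 hcard D' h Ds hDsA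
    have huniv : {p : (Fin n → E) × (Fin n → E) |
          ∀ D' ∈ A,
            (∀ D'' ∈ A, empRisk ε (fc D') (fun i => cond i p.2 p.1) ≤
              empRisk ε (fc D'') (fun i => cond i p.2 p.1)) →
            IsRobust ε (δ + 2 * δ') (fc D') D} = Set.univ := by
      refine Set.eq_univ_of_forall fun p D' hD' _ i => ?_
      rw [hall D' hD']
      refine (ENNReal.le_ofReal_iff_toReal_le (measure_ne_top _ _) (by positivity)).2 ?_
      have := hgood i
      simp only [Measure.real] at this
      linarith
    rw [huniv, measure_univ]
    refine ENNReal.div_le_of_le_mul ?_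
    norm_num
  push Not at hcard
  have hN : (2 : ℝ) ≤ A.card := by exact_mod_cast hcard
  have hq : 0 < δ + δ' := by positivity
  have hlog : 0 < Real.log A.card := Real.log_pos (by linarith)
  have hn0 : (0 : ℝ) < n := lt_of_lt_of_le (by positivity) hn
  set η := Real.exp (-(n * (δ' ^ 2 / (32 * (δ + δ'))))) with hη
  have hηle : η ≤ 1 / (A.card : ℝ) ^ 4 := by
    have h1 : 4 * Real.log A.card ≤ n * (δ' ^ 2 / (32 * (δ + δ'))) := by
      calc 4 * Real.log A.card
          = 128 * ((δ + δ') / δ' ^ 2) * Real.log A.card * (δ' ^ 2 / (32 * (δ + δ'))) := by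
            field_simp; norm_num
        _ ≤ _ := by gcongr
    calc η ≤ Real.exp (-(4 * Real.log A.card)) := Real.exp_le_exp.2 (by linarith)
      _ = _ := by
        rw [Real.exp_neg, one_div, show (4 : ℝ) * Real.log A.card = ((4 : ℕ) : ℝ) * Real.log A.card by norm_num,
          Real.exp_nat_mul, Real.exp_log (by linarith)]
  have hmarg : ∀ (i : Bool) (S : Set (Fin n → E)),
      P {p | cond i p.2 p.1 ∈ S} = (Measure.pi fun _ : Fin n => D i) S := by
    intro i S
    have h := prod_marg (Measure.pi fun _ : Fin n => D false) (Measure.pi fun _ : Fin n => D true) S S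
    cases i
    · exact h.1
    · exact h.2
  let G : Bool → Set ((Fin n → E) × (Fin n → E)) := fun i => {p | cond i p.2 p.1 ∈
    {x : Fin n → E | n * (δ + 3 / 2 * δ') ≤
      ∑ j : Fin n, (badSet ε (fc Ds) i).indicator (fun _ => (1 : ℝ)) (x j)}}
  have hG : ∀ i, P (G i) ≤ ENNReal.ofReal η := by
    intro i
    rw [hmarg, ENNReal.le_ofReal_iff_toReal_le (measure_ne_top _ _) (Real.exp_pos _).le]
    exact chernoff_upper (D i) _ (hbm Ds (hA hDsA) i) n δ δ' hδ hδ' (hgood i)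
  have hW : ∀ D' : Bool → Measure E, ∃ W : Set ((Fin n → E) × (Fin n → E)), D' ∈ A →
      (P W ≤ ENNReal.ofReal η ∧ (¬ IsRobust ε (δ + 2 * δ') (fc D') D → ∃ i, W =
        {p | cond i p.2 p.1 ∈ {x : Fin n → E |
          ∑ j : Fin n, (badSet ε (fc D') i).indicator (fun _ => (1 : ℝ)) (x j)
            ≤ n * (δ + 3 / 2 * δ')}})) := by
    intro D'
    by_cases hr : IsRobust ε (δ + 2 * δ') (fc D') D
    · exact ⟨∅, fun _ => ⟨by simp, fun h => absurd hr h⟩⟩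
    · have hr' := hr
      unfold IsRobust at hr'
      push Not at hr'
      obtain ⟨i, hi⟩ := hr'
      refine ⟨_, fun hD' => ⟨?_, fun _ => ⟨i, rfl⟩⟩⟩
      rw [hmarg, ENNReal.le_ofReal_iff_toReal_le (measure_ne_top _ _) (Real.exp_pos _).le]
      refine chernoff_lower (D i) _ (hbm D' (hA hD') i) n δ δ' hδ hδ' ?_
      exact ((ENNReal.ofReal_lt_iff_lt_toReal (by positivity) (measure_ne_top _ _)).1 hi).le
  choose W hW using hW
  set S := {p : (Fin n → E) × (Fin n → E) |
          ∀ D' ∈ A,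
            (∀ D'' ∈ A, empRisk ε (fc D') (fun i => cond i p.2 p.1) ≤
              empRisk ε (fc D'') (fun i => cond i p.2 p.1)) →
            IsRobust ε (δ + 2 * δ') (fc D') D} with hS
  have hcover : (Set.univ : Set ((Fin n → E) × (Fin n → E))) ⊆
      S ∪ ((G false ∪ G true) ∪ ⋃ D' ∈ A, W D') := by
    intro p _
    by_contra hp
    simp only [Set.mem_union, not_or, Set.mem_iUnion, not_exists] at hp
    obtain ⟨hpS, ⟨hp0, hp1⟩, hpW⟩ := hp
    apply hpS
    intro D' hD' hmin
    by_contra hnr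
    obtain ⟨i, hi⟩ := (hW D' hD').2 hnr
    have h1 := hpW D' hD'
    rw [hi] at h1
    simp only [G, Set.mem_setOf_eq, not_le, cond_false, cond_true] at h1 hp0 hp1
    have h2 := hmin Ds hDsA
    have h3 : empRisk ε (fc Ds) (fun i => cond i p.2 p.1) < δ + 3 / 2 * δ' := by
      unfold empRisk
      refine max_lt ?_ ?_
      · rw [div_lt_iff₀ hn0, mul_comm]; exact hp0
      · rw [div_lt_iff₀ hn0, mul_comm]; exact hp1
    have h4 : δ + 3 / 2 * δ' < empRisk ε (fc D') (fun i => cond i p.2 p.1) := by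
      unfold empRisk
      cases i
      · refine lt_max_of_lt_left ?_
        rw [lt_div_iff₀ hn0, mul_comm]; exact h1
      · refine lt_max_of_lt_right ?_
        rw [lt_div_iff₀ hn0, mul_comm]; exact h1
    linarith
  have hU : P ((G false ∪ G true) ∪ ⋃ D' ∈ A, W D') ≤ ENNReal.ofReal (1 / 3) := by
    calc P ((G false ∪ G true) ∪ ⋃ D' ∈ A, W D')
        ≤ (P (G false) + P (G true)) + ∑ D' ∈ A, P (W D') :=
          (measure_union_le _ _).trans (add_le_add (measure_union_le _ _)
            (measure_biUnion_finset_le _ _))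
      _ ≤ (ENNReal.ofReal η + ENNReal.ofReal η) + ∑ D' ∈ A, ENNReal.ofReal η :=
          add_le_add (add_le_add (hG _) (hG _)) (Finset.sum_le_sum fun D' h => (hW D' h).1)
      _ = ENNReal.ofReal ((A.card + 2) * η) := by
          have hη0 : 0 ≤ η := (Real.exp_pos _).le
          rw [← ENNReal.ofReal_sum_of_nonneg (fun _ _ => hη0), ← ENNReal.ofReal_add hη0 hη0,
            ← ENNReal.ofReal_add (by positivity) (Finset.sum_nonneg fun _ _ => hη0)]
          congr 1
          simp
          ring
      _ ≤ _ := by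
          apply ENNReal.ofReal_le_ofReal
          calc ((A.card : ℝ) + 2) * η ≤ (A.card + 2) * (1 / (A.card : ℝ) ^ 4) := by gcongr
            _ ≤ 1 / 3 := by
              rw [mul_one_div, div_le_div_iff₀ (by positivity) (by norm_num)]
              have h8 : (2 : ℝ) ^ 3 ≤ (A.card : ℝ) ^ 3 := by gcongr
              nlinarith
  have h1 : (1 : ENNReal) ≤ P S + ENNReal.ofReal (1 / 3) := by
    calc (1 : ENNReal) = P Set.univ := measure_univ.symm
      _ ≤ _ := (measure_mono hcover).trans ((measure_union_le _ _).trans (by gcongr))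
  have h2 : (2 / 3 : ENNReal) = ENNReal.ofReal (2 / 3) := by
    rw [ENNReal.ofReal_div_of_pos (by norm_num)]; simp
  rw [h2]
  have h3 : (1 : ENNReal) = ENNReal.ofReal (2 / 3) + ENNReal.ofReal (1 / 3) := by
    rw [← ENNReal.ofReal_add (by norm_num) (by norm_num)]; norm_num
  rw [h3] at h1
  exact (ENNReal.add_le_add_iff_right ENNReal.ofReal_ne_top).1 h1


end
end

section
/- There is an absolute constant C > 0 such that the following holds. Let ε > ε' ≥ 0, δ ≥ 0, δ' ∈ (0,1). Let 𝒟 be a family of pairs of Borel probability measures on ℝ^d, and suppose every D' ∈ 𝒟 admits a Borel-measurable (ε,δ)-robust classifier f_{D'} (with the sets {x : ℓ_{ε''}(f_{D'},x,i)=1} Borel for all ε'' ≥ 0). Let A ⊆ 𝒟 be a finite subset such that for every D = (D_0,D_1) ∈ 𝒟 there exist D' = (D'_0,D'_1) ∈ A and Borel probability measures D''_0, D''_1 with TV(D'_i, D''_i) ≤ δ' and W∞(D''_i, D_i) ≤ ε' for i = 0,1. Then for any D ∈ 𝒟, if n ≥ C·((δ+δ')/δ'²)·log|A|, with probability at least 2/3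 over n i.i.d. samples from each of D_0 and D_1, every minimizer over {f_{D'} : D' ∈ A} of the empirical (ε−ε')-robust risk max_{i∈{0,1}} (1/n)·Σ_{j=1}^n ℓ_{ε−ε'}(f, X_i(j), i) is an (ε−ε', δ+2δ')-robust classifier for D. -/
open MeasureTheory

noncomputable section

/-- `W∞` distance: infimum over couplings `π` of `μ` and `ν` of the `π`-essential
supremum of `‖x − y‖`. -/
def Winfty {E : Type*} [NormedAddCommGroup E] [MeasurableSpace E] (μ ν : Measure E) : ENNReal :=
  ⨅ (π : Measure (E × E)) (_ : π.fst = μ ∧ π.snd = ν),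
    essSup (fun p : E × E => ENNReal.ofReal ‖p.1 - p.2‖) π

lemma exists_coupling_bound {E : Type*} [NormedAddCommGroup E] [NormedSpace ℝ E]
    [FiniteDimensional ℝ E] [MeasurableSpace E] [BorelSpace E]
    (μ ν : Measure E) [IsProbabilityMeasure μ] [IsProbabilityMeasure ν] (ε ε' : ℝ)
    (h0 : 0 ≤ ε') (f : E → Bool) (i : Bool)
    (hm : MeasurableSet (badSet (ε - ε') f i)) (hW : Winfty μ ν ≤ ENNReal.ofReal ε') :
    ν (badSet (ε - ε') f i) ≤ μ (badSet ε f i) := by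
  have : ProperSpace E := FiniteDimensional.proper ℝ E
  have : SecondCountableTopology E := inferInstance
  rw [hm.measure_eq_iSup_isCompact]
  refine iSup_le fun K => iSup_le fun hK => iSup_le fun hKc => ?_
  have h1 : ∀ η : ℝ, 0 < η → ν K ≤ μ (Metric.cthickening (ε' + η) K) := by
    intro η hη
    have h2 : Winfty μ ν < ENNReal.ofReal (ε' + η) :=
      lt_of_le_of_lt hW ((ENNReal.ofReal_lt_ofReal_iff (by linarith)).2 (by linarith))
    unfold Winfty at h2
    simp only [iInf_lt_iff] at h2
    obtain ⟨π, ⟨hπ1, hπ2⟩, hπ⟩ := h2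
    have hae := ae_lt_of_essSup_lt hπ
    rw [← hπ1, ← hπ2, Measure.snd_apply hKc.measurableSet,
      Measure.fst_apply Metric.isClosed_cthickening.measurableSet]
    apply measure_mono_ae
    filter_upwards [hae] with p hp hpK
    have hp' : ‖p.1 - p.2‖ < ε' + η := (ENNReal.ofReal_lt_ofReal_iff (by linarith)).1 hp
    exact Metric.mem_cthickening_of_dist_le p.1 p.2 _ K hpK (by rw [dist_eq_norm]; exact hp'.le)
  have h3 : Filter.Tendsto (fun r => μ (Metric.cthickening r (Metric.cthickening ε' K)))
      (nhds 0) (nhds (μ (Metric.cthickening ε' K))) :=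
    tendsto_measure_cthickening_of_isClosed ⟨1, one_pos, measure_ne_top _ _⟩
      Metric.isClosed_cthickening
  have h4 : ν K ≤ μ (Metric.cthickening ε' K) := by
    refine ge_of_tendsto (h3.mono_left (nhdsWithin_le_nhds (s := Set.Ioi 0))) ?_
    filter_upwards [self_mem_nhdsWithin] with η hη
    have hη' : 0 < η := hη
    rw [cthickening_cthickening hη'.le h0, add_comm η ε']
    exact h1 η hη'
  refine h4.trans (measure_mono ?_)
  rw [hKc.cthickening_eq_biUnion_closedBall h0]
  intro x hx
  simp only [Set.mem_iUnion, Metric.mem_closedBall] at hx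
  obtain ⟨y, hy, hxy⟩ := hx
  obtain ⟨z, hz, hfz⟩ := hK hy
  refine ⟨(y - x) + z, ?_, ?_⟩
  · have := norm_add_le (y - x) z
    rw [dist_comm, dist_eq_norm] at hxy
    linarith
  · rwa [← add_assoc, add_sub_cancel]

lemma tv_bound {α : Type*} [MeasurableSpace α] (μ ν : Measure α) [IsProbabilityMeasure μ]
    [IsProbabilityMeasure ν] (s : Set α) (hs : MeasurableSet s) :
    ν.real s ≤ μ.real s + tvDist μ ν := by
  have h : |(μ s).toReal - (ν s).toReal| ≤ tvDist μ ν := by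
    unfold tvDist
    refine le_ciSup (f := fun s : {s : Set α // MeasurableSet s} =>
      |(μ s).toReal - (ν s).toReal|) ⟨1, ?_⟩ ⟨s, hs⟩
    rintro _ ⟨t, rfl⟩
    have h1 : (μ (t : Set α)).toReal ≤ 1 := measureReal_le_one
    have h2 : (ν (t : Set α)).toReal ≤ 1 := measureReal_le_one
    have h3 : 0 ≤ (μ (t : Set α)).toReal := ENNReal.toReal_nonneg
    have h4 : 0 ≤ (ν (t : Set α)).toReal := ENNReal.toReal_nonneg
    exact abs_le.2 ⟨by linarith, by linarith⟩
  have := (abs_le.1 h).1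
  simp only [Measure.real]
  linarith

lemma chernoff {α : Type*} [MeasurableSpace α] (μ : Measure α) [IsProbabilityMeasure μ]
    (B : Set α) (hB : MeasurableSet B) (n : ℕ) (l c : ℝ) :
    (Measure.pi fun _ : Fin n => μ)
      {x | c ≤ l * ∑ j : Fin n, B.indicator (fun _ => (1 : ℝ)) (x j)} ≤
      ENNReal.ofReal (Real.exp (n * (μ.real B * (Real.exp l - 1)) - c)) := by
  set g : α → ℝ := fun y => Real.exp (l * B.indicator (fun _ => (1 : ℝ)) y) with hg
  have hgeq : g = fun y => 1 + B.indicator (fun _ => Real.exp l - 1) y := by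
    funext y
    by_cases hy : y ∈ B <;> simp [hg, hy]
  have hint : Integrable g μ := by
    rw [hgeq]
    exact (integrable_const _).add ((integrable_const _).indicator hB)
  have hgint : ∫ y, g y ∂μ = 1 + μ.real B * (Real.exp l - 1) := by
    rw [hgeq, integral_add (integrable_const _) ((integrable_const _).indicator hB),
      integral_indicator_const _ hB]
    simp
  have hprod : ∀ x : Fin n → α, Real.exp (l * ∑ j : Fin n, B.indicator (fun _ => (1 : ℝ)) (x j))
      = ∏ j, g (x j) := by
    intro x
    rw [Finset.mul_sum, Real.exp_sum]
  have hI : ∫ x, ∏ j, g (x j) ∂(Measure.pi fun _ : Fin n => μ) =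
      (1 + μ.real B * (Real.exp l - 1)) ^ n := by
    rw [integral_fintype_prod_eq_pow (ι := Fin n) g, hgint]
    simp
  have hInt : Integrable (fun x : Fin n → α => ∏ j, g (x j)) (Measure.pi fun _ : Fin n => μ) :=
    Integrable.fintype_prod (fun _ => hint)
  have hnn : 0 ≤ 1 + μ.real B * (Real.exp l - 1) := by
    rw [← hgint]
    exact integral_nonneg fun y => (Real.exp_pos _).le
  have hmk := mul_meas_ge_le_integral_of_nonneg (μ := Measure.pi fun _ : Fin n => μ)
    (f := fun x : Fin n → α => ∏ j, g (x j))
    (Filter.Eventually.of_forall fun x => Finset.prod_nonneg fun j _ => (Real.exp_pos _).le)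
    hInt (Real.exp c)
  rw [hI] at hmk
  have hset : {x : Fin n → α | c ≤ l * ∑ j : Fin n, B.indicator (fun _ => (1 : ℝ)) (x j)} =
      {x | Real.exp c ≤ ∏ j, g (x j)} := by
    ext x
    simp only [Set.mem_ofPred_eq]
    rw [← hprod, Real.exp_le_exp]
  rw [hset, ← ofReal_measureReal]
  apply ENNReal.ofReal_le_ofReal
  have h5 : (1 + μ.real B * (Real.exp l - 1)) ^ n ≤
      Real.exp (n * (μ.real B * (Real.exp l - 1))) := by
    rw [Real.exp_nat_mul]
    apply pow_le_pow_left₀ hnn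
    have := Real.add_one_le_exp (μ.real B * (Real.exp l - 1))
    linarith
  rw [Real.exp_sub, le_div_iff₀ (Real.exp_pos c), mul_comm]
  exact hmk.trans h5

lemma upper_tail {α : Type*} [MeasurableSpace α] (μ : Measure α) [IsProbabilityMeasure μ]
    (B : Set α) (hB : MeasurableSet B) (n : ℕ) (δ δ' : ℝ) (h0 : 0 ≤ δ) (h1 : 0 < δ')
    (hq : μ.real B ≤ δ + δ') :
    (Measure.pi fun _ : Fin n => μ)
      {x | n * (δ + 3 / 2 * δ') ≤ ∑ j : Fin n, B.indicator (fun _ => (1 : ℝ)) (x j)} ≤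
      ENNReal.ofReal (Real.exp (-(n * δ' ^ 2 / (32 * (δ + δ'))))) := by
  have hr : 0 < δ + δ' := by linarith
  set r := δ + δ' with hrdef
  set l := δ' / (4 * r) with hl
  have hl0 : 0 < l := by positivity
  have hl1 : l ≤ 1 := by
    rw [hl, div_le_one (by positivity)]
    linarith
  have hexp : Real.exp l - 1 ≤ l + l ^ 2 := by
    have := Real.abs_exp_sub_one_sub_id_le (x := l) (by rw [abs_of_pos hl0]; exact hl1)
    have := (abs_le.1 this).2
    linarith
  have hexp0 : 0 ≤ Real.exp l - 1 := by
    have := Real.add_one_le_exp l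
    linarith
  refine le_trans (measure_mono ?_) ((chernoff μ B hB n l (l * (n * (δ + 3 / 2 * δ')))).trans ?_)
  · intro x hx
    exact mul_le_mul_of_nonneg_left hx hl0.le
  apply ENNReal.ofReal_le_ofReal
  rw [Real.exp_le_exp]
  have ha : μ.real B * (Real.exp l - 1) ≤ r * (l + l ^ 2) :=
    mul_le_mul hq hexp hexp0 hr.le
  have hb : (n : ℝ) * (μ.real B * (Real.exp l - 1)) ≤ n * (r * (l + l ^ 2)) :=
    mul_le_mul_of_nonneg_left ha (Nat.cast_nonneg n)
  have hc : n * (r * (l + l ^ 2)) - l * (n * (δ + 3 / 2 * δ')) =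
      -(n * δ' ^ 2 / (16 * r)) := by
    have : δ = r - δ' := by rw [hrdef]; ring
    rw [this, hl]
    field_simp
    ring
  have hd : n * δ' ^ 2 / (32 * r) ≤ n * δ' ^ 2 / (16 * r) :=
    div_le_div_of_nonneg_left (by positivity) (by positivity) (by linarith)
  linarith

lemma lower_tail {α : Type*} [MeasurableSpace α] (μ : Measure α) [IsProbabilityMeasure μ]
    (B : Set α) (hB : MeasurableSet B) (n : ℕ) (δ δ' : ℝ) (h0 : 0 ≤ δ) (h1 : 0 < δ')
    (hq : δ + 2 * δ' ≤ μ.real B) :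
    (Measure.pi fun _ : Fin n => μ)
      {x | ∑ j : Fin n, B.indicator (fun _ => (1 : ℝ)) (x j) ≤ n * (δ + 3 / 2 * δ')} ≤
      ENNReal.ofReal (Real.exp (-(n * δ' ^ 2 / (32 * (δ + δ'))))) := by
  have hs : 0 < δ + 2 * δ' := by linarith
  have hr : 0 < δ + δ' := by linarith
  set s := δ + 2 * δ' with hsdef
  set l := δ' / (4 * s) with hl
  have hl0 : 0 < l := by positivity
  have hl1 : l ≤ 1 := by
    rw [hl, div_le_one (by positivity)]
    linarith
  have hexp : Real.exp (-l) - 1 ≤ -l + l ^ 2 := by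
    have := Real.abs_exp_sub_one_sub_id_le (x := -l) (by rw [abs_neg, abs_of_pos hl0]; exact hl1)
    have := (abs_le.1 this).2
    nlinarith
  have hexp0 : -l + l ^ 2 ≤ 0 := by nlinarith
  refine le_trans (measure_mono ?_)
    ((chernoff μ B hB n (-l) (-l * (n * (δ + 3 / 2 * δ')))).trans ?_)
  · intro x hx
    have hx' : ∑ j : Fin n, B.indicator (fun _ => (1 : ℝ)) (x j) ≤ n * (δ + 3 / 2 * δ') := hx
    have hl2 : -l ≤ 0 := by linarith
    exact mul_le_mul_of_nonpos_left hx' hl2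
  apply ENNReal.ofReal_le_ofReal
  rw [Real.exp_le_exp]
  have ha : μ.real B * (Real.exp (-l) - 1) ≤ s * (-l + l ^ 2) := by
    nlinarith [measureReal_nonneg (μ := μ) (s := B)]
  have hb : (n : ℝ) * (μ.real B * (Real.exp (-l) - 1)) ≤ n * (s * (-l + l ^ 2)) :=
    mul_le_mul_of_nonneg_left ha (Nat.cast_nonneg n)
  have hc : n * (s * (-l + l ^ 2)) - -l * (n * (δ + 3 / 2 * δ')) =
      -(n * δ' ^ 2 / (16 * s)) := by
    have : δ = s - 2 * δ' := by rw [hsdef]; ring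
    rw [this, hl]
    field_simp
    ring
  have hd : n * δ' ^ 2 / (32 * (δ + δ')) ≤ n * δ' ^ 2 / (16 * s) :=
    div_le_div_of_nonneg_left (by positivity) (by positivity) (by linarith)
  linarith

lemma prod_cond_le {α : Type*} [MeasurableSpace α] (P : Bool → Measure α)
    [∀ i, IsProbabilityMeasure (P i)] (i : Bool) (S : Set α) :
    ((P false).prod (P true)) {p | cond i p.2 p.1 ∈ S} ≤ P i S := by
  cases i
  · have : {p : α × α | cond false p.2 p.1 ∈ S} = S ×ˢ Set.univ := by ext p; simp
    rw [this, Measure.prod_prod]; simp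
  · have : {p : α × α | cond true p.2 p.1 ∈ S} = Set.univ ×ˢ S := by ext p; simp
    rw [this, Measure.prod_prod]; simp

/-- Robust ERM over the classifiers of a finite `(W∞, TV)`-cover `A` of a
robustly feasible family `𝒟` yields `(ε−ε', δ+2δ')`-robust classifiers from
`n ≳ ((δ+δ')/δ'²)·log |A|` samples. -/
theorem stmt2 :
    ∃ C : ℝ, 0 < C ∧
    ∀ (E : Type) [NormedAddCommGroup E] [NormedSpace ℝ E] [FiniteDimensional ℝ E]
      [MeasurableSpace E] [BorelSpace E],
    ∀ ε ε' δ δ' : ℝ, 0 ≤ ε' → ε' < ε → 0 ≤ δ → 0 < δ' → δ' < 1 →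
    ∀ 𝒟 : Set (Bool → Measure E),
    (∀ D ∈ 𝒟, ∀ i, IsProbabilityMeasure (D i)) →
    ∀ fc : (Bool → Measure E) → (E → Bool),
    (∀ D' ∈ 𝒟, Measurable (fc D')) →
    (∀ D' ∈ 𝒟, ∀ ε'' : ℝ, 0 ≤ ε'' → ∀ i : Bool, MeasurableSet (badSet ε'' (fc D') i)) →
    (∀ D' ∈ 𝒟, IsRobust ε δ (fc D') D') →
    ∀ A : Finset (Bool → Measure E), ↑A ⊆ 𝒟 →
    (∀ D ∈ 𝒟, ∃ D' ∈ A, ∀ i : Bool, ∃ D'' : Measure E, IsProbabilityMeasure D'' ∧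
      tvDist (D' i) D'' ≤ δ' ∧ Winfty D'' (D i) ≤ ENNReal.ofReal ε') →
    ∀ D ∈ 𝒟,
    ∀ n : ℕ, C * ((δ + δ') / δ' ^ 2) * Real.log A.card ≤ n →
    (2 / 3 : ENNReal) ≤
      ((Measure.pi fun _ : Fin n => D false).prod (Measure.pi fun _ : Fin n => D true))
        {p : (Fin n → E) × (Fin n → E) |
          ∀ D' ∈ A,
            (∀ D'' ∈ A, empRisk (ε - ε') (fc D') (fun i => cond i p.2 p.1) ≤
              empRisk (ε - ε') (fc D'') (fun i => cond i p.2 p.1)) →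
            IsRobust (ε - ε') (δ + 2 * δ') (fc D') D} := by
  refine ⟨192, by norm_num, ?_⟩
  intro E _ _ _ _ _ ε ε' δ δ' hε' hεε hδ hδ' hδ1 𝒟 hprob fc hfm hbm hrob A hA hcov D hD n hn
  have hPD : ∀ i, IsProbabilityMeasure (D i) := hprob D hD
  obtain ⟨Ds, hDsA, hDs⟩ := hcov D hD
  have hDs𝒟 : Ds ∈ 𝒟 := hA hDsA
  have hee : 0 ≤ ε - ε' := by linarith
  -- the classifier of the covering element is good
  have hgood : ∀ i, (D i).real (badSet (ε - ε') (fc Ds) i) ≤ δ + δ' := by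
    intro i
    obtain ⟨D2, hD2, htv, hW⟩ := hDs i
    have := hprob Ds hDs𝒟 i
    have h1 := exists_coupling_bound D2 (D i) ε ε' hε' (fc Ds) i (hbm Ds hDs𝒟 _ hee i) hW
    have h2 := tv_bound (Ds i) D2 _ (hbm Ds hDs𝒟 ε (by linarith) i)
    have h3 : (Ds i).real (badSet ε (fc Ds) i) ≤ δ :=
      ENNReal.toReal_le_of_le_ofReal hδ (hrob Ds hDs𝒟 i)
    have h4 : (D i).real (badSet (ε - ε') (fc Ds) i) ≤ D2.real (badSet ε (fc Ds) i) :=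
      ENNReal.toReal_mono (measure_ne_top _ _) h1
    linarith
  set P : Bool → Measure (Fin n → E) := fun i => Measure.pi fun _ : Fin n => D i with hP
  have hPP : ∀ i, IsProbabilityMeasure (P i) := fun i => by
    rw [hP]; infer_instance
  change _ ≤ ((P false).prod (P true)) _
  set G : Set ((Fin n → E) × (Fin n → E)) := {p : (Fin n → E) × (Fin n → E) |
          ∀ D' ∈ A,
            (∀ D'' ∈ A, empRisk (ε - ε') (fc D') (fun i => cond i p.2 p.1) ≤
              empRisk (ε - ε') (fc D'') (fun i => cond i p.2 p.1)) →
            IsRobust (ε - ε') (δ + 2 * δ') (fc D') D} with hG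
  have hGmem : ∀ p, p ∈ G ↔ ∀ D' ∈ A,
            (∀ D'' ∈ A, empRisk (ε - ε') (fc D') (fun i => cond i p.2 p.1) ≤
              empRisk (ε - ε') (fc D'') (fun i => cond i p.2 p.1)) →
            IsRobust (ε - ε') (δ + 2 * δ') (fc D') D := fun p => Iff.rfl
  clear_value G
  rcases Nat.lt_or_ge A.card 2 with hcard | hcard
  · -- a single classifier
    have hGu : G = Set.univ := by
      rw [Set.eq_univ_iff_forall]
      intro p
      rw [hGmem]
      intro D' hD' _ i
      have : D' = Ds := Finset.card_le_one.1 (by omega) D' hD' Ds hDsA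
      subst this
      rw [← ofReal_measureReal]
      apply ENNReal.ofReal_le_ofReal
      linarith [hgood i]
    rw [hGu, measure_univ]
    exact ENNReal.div_le_of_le_mul (by norm_num)
  have hm2 : (2 : ℝ) ≤ A.card := by exact_mod_cast hcard
  have hlog : 0 < Real.log A.card := Real.log_pos (by linarith)
  have hr : 0 < δ + δ' := by linarith
  have hn0 : (0 : ℝ) < n := lt_of_lt_of_le (by positivity) hn
  set t := δ + 3 / 2 * δ' with ht
  set e := Real.exp (-(n * δ' ^ 2 / (32 * (δ + δ')))) with he
  have hebound : e ≤ ((A.card : ℝ) ^ 6)⁻¹ := by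
    have h6 : 6 * Real.log A.card ≤ n * δ' ^ 2 / (32 * (δ + δ')) := by
      rw [le_div_iff₀ (by positivity)]
      have := mul_le_mul_of_nonneg_right hn (sq_nonneg δ')
      have h7 : 192 * ((δ + δ') / δ' ^ 2) * Real.log A.card * δ' ^ 2 =
          192 * (δ + δ') * Real.log A.card := by
        field_simp
      linarith
    have hpow : Real.exp (6 * Real.log A.card) = (A.card : ℝ) ^ 6 := by
      have := Real.exp_nat_mul (Real.log A.card) 6
      rw [Real.exp_log (by linarith)] at this
      exact_mod_cast this
    rw [he, Real.exp_neg, ← hpow]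
    exact inv_anti₀ (Real.exp_pos _) (Real.exp_le_exp.2 h6)
  let S : (Bool → Measure E) → Bool → (Fin n → E) → ℝ := fun D' i x =>
    ∑ j : Fin n, (badSet (ε - ε') (fc D') i).indicator (fun _ => (1 : ℝ)) (x j)
  let U : Bool → Set ((Fin n → E) × (Fin n → E)) := fun i =>
    {p | cond i p.2 p.1 ∈ {x | n * t ≤ S Ds i x}}
  let L : (Bool → Measure E) → Bool → Set ((Fin n → E) × (Fin n → E)) := fun D' i =>
    {p | cond i p.2 p.1 ∈ {x | δ + 2 * δ' ≤ (D i).real (badSet (ε - ε') (fc D') i) ∧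
      S D' i x ≤ n * t}}
  have hU : ∀ i, ((P false).prod (P true)) (U i) ≤ ENNReal.ofReal e := fun i =>
    (prod_cond_le P i _).trans
      (upper_tail (D i) _ (hbm Ds hDs𝒟 _ hee i) n δ δ' hδ hδ' (hgood i))
  have hL : ∀ D' ∈ A, ∀ i, ((P false).prod (P true)) (L D' i) ≤ ENNReal.ofReal e := by
    intro D' hD' i
    refine (prod_cond_le P i _).trans ?_
    by_cases hq : δ + 2 * δ' ≤ (D i).real (badSet (ε - ε') (fc D') i)
    · exact le_trans (measure_mono fun x hx => hx.2)
        (lower_tail (D i) _ (hbm D' (hA hD') _ hee i) n δ δ' hδ hδ' hq)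
    · have : {x | δ + 2 * δ' ≤ (D i).real (badSet (ε - ε') (fc D') i) ∧
          S D' i x ≤ n * t} = ∅ := by
        ext x
        simp [hq]
      rw [this, measure_empty]
      exact zero_le
  have hcover : (Set.univ : Set ((Fin n → E) × (Fin n → E))) ⊆
      G ∪ ((U false ∪ U true) ∪ ⋃ D' ∈ A, (L D' false ∪ L D' true)) := by
    intro p _
    by_contra hp
    simp only [Set.mem_union, Set.mem_iUnion, not_or, not_exists] at hp
    obtain ⟨hpG, ⟨hU0, hU1⟩, hpL⟩ := hp
    apply hpG
    rw [hGmem]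
    intro D' hD' hmin i
    by_contra hbad
    have hUx0 : S Ds false p.1 < n * t := not_le.1 hU0
    have hUx1 : S Ds true p.2 < n * t := not_le.1 hU1
    have hstar : empRisk (ε - ε') (fc Ds) (fun i => cond i p.2 p.1) < t :=
      max_lt ((div_lt_iff₀' hn0).2 hUx0) ((div_lt_iff₀' hn0).2 hUx1)
    have hq : δ + 2 * δ' ≤ (D i).real (badSet (ε - ε') (fc D') i) := by
      by_contra hlt
      apply hbad
      rw [← ofReal_measureReal]
      exact ENNReal.ofReal_le_ofReal (not_le.1 hlt).le
    have hgt : t < empRisk (ε - ε') (fc D') (fun i => cond i p.2 p.1) := by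
      cases i
      · have h8 : n * t < S D' false p.1 :=
          not_le.1 fun h => (hpL D' hD').1 ⟨hq, h⟩
        exact lt_of_lt_of_le ((lt_div_iff₀' hn0).2 h8) (le_max_left _ _)
      · have h8 : n * t < S D' true p.2 :=
          not_le.1 fun h => (hpL D' hD').2 ⟨hq, h⟩
        exact lt_of_lt_of_le ((lt_div_iff₀' hn0).2 h8) (le_max_right _ _)
    exact absurd (hmin Ds hDsA) (not_le.2 (hstar.trans hgt))
  have he0 : 0 ≤ e := (Real.exp_pos _).le
  have hB : ((P false).prod (P true))
      ((U false ∪ U true) ∪ ⋃ D' ∈ A, (L D' false ∪ L D' true)) ≤ ENNReal.ofReal (1 / 3) := by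
    calc _ ≤ (ENNReal.ofReal e + ENNReal.ofReal e) +
          ∑ D' ∈ A, (ENNReal.ofReal e + ENNReal.ofReal e) := by
          refine (measure_union_le _ _).trans (add_le_add ?_ ?_)
          · exact (measure_union_le _ _).trans (add_le_add (hU _) (hU _))
          · refine (measure_biUnion_finset_le _ _).trans (Finset.sum_le_sum fun D' hD' => ?_)
            exact (measure_union_le _ _).trans (add_le_add (hL D' hD' _) (hL D' hD' _))
      _ = ENNReal.ofReal ((2 * A.card + 2) * e) := by
          rw [Finset.sum_const, nsmul_eq_mul, ← ENNReal.ofReal_add he0 he0,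
            ← ENNReal.ofReal_natCast, ← ENNReal.ofReal_mul (by positivity),
            ← ENNReal.ofReal_add (by positivity) (by positivity)]
          congr 1
          ring
      _ ≤ _ := by
          apply ENNReal.ofReal_le_ofReal
          calc (2 * (A.card : ℝ) + 2) * e ≤ (2 * A.card + 2) * ((A.card : ℝ) ^ 6)⁻¹ := by gcongr
            _ ≤ 1 / 3 := by
              rw [← div_eq_mul_inv, div_le_iff₀ (by positivity)]
              have h5 : (2 : ℝ) ^ 5 ≤ (A.card : ℝ) ^ 5 := by gcongr
              have h6 : (A.card : ℝ) ^ 6 = (A.card : ℝ) ^ 5 * A.card := by ring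
              nlinarith
  have htot : 1 ≤ ((P false).prod (P true)) G + ENNReal.ofReal (1 / 3) := by
    rw [← measure_univ (μ := (P false).prod (P true))]
    exact (measure_mono hcover).trans ((measure_union_le _ _).trans (add_le_add le_rfl hB))
  rw [← ofReal_measureReal, ← ENNReal.ofReal_add measureReal_nonneg (by norm_num),
    ENNReal.one_le_ofReal] at htot
  have h23 : (2 / 3 : ENNReal) = ENNReal.ofReal (2 / 3) := by
    rw [ENNReal.ofReal_div_of_pos (by norm_num)]
    simp
  rw [h23, ← ofReal_measureReal]
  apply ENNReal.ofReal_le_ofReal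
  linarith

end
end

section
/- Let 0 ≤ ε' ≤ ε and let f : ℝ^d → {0,1} be a Borel-measurable classifier that is (ε,δ)-robust for a pair of Borel probability measures (D_0,D_1) on ℝ^d (with the sets {x : ℓ_{ε''}(f,x,i)=1} Borel for all ε'' ≥ 0). Suppose that for i = 0,1 there exists a coupling π_i of D_i and a Borel probability measure D'_i such that ‖x − x'‖ ≤ ε' for π_i-almost every pair (x,x'). Then f is (ε−ε', δ)-robust for (D'_0, D'_1). -/
open MeasureTheory

noncomputable section

/-- An `(ε,δ)`-robust classifier for `(D_0, D_1)` is `(ε−ε', δ)`-robust for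
any pair `(D'_0, D'_1)` that can be coupled to `(D_0, D_1)` moving each point by at most `ε'`. -/
theorem stmt4 {E : Type*} [NormedAddCommGroup E] [NormedSpace ℝ E] [FiniteDimensional ℝ E]
    [MeasurableSpace E] [BorelSpace E]
    (ε ε' δ : ℝ) (hε'0 : 0 ≤ ε') (hε' : ε' ≤ ε)
    (f : E → Bool) (hf : Measurable f)
    (hmeas : ∀ ε'' : ℝ, 0 ≤ ε'' → ∀ i : Bool, MeasurableSet (badSet ε'' f i))
    (D D' : Bool → Measure E)
    (hD : ∀ i, IsProbabilityMeasure (D i)) (hD' : ∀ i, IsProbabilityMeasure (D' i))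
    (hrob : IsRobust ε δ f D)
    (hcpl : ∀ i : Bool, ∃ π : Measure (E × E), IsProbabilityMeasure π ∧
      π.fst = D i ∧ π.snd = D' i ∧ ∀ᵐ p ∂π, ‖p.1 - p.2‖ ≤ ε') :
    IsRobust (ε - ε') δ f D' := by
  intro i
  obtain ⟨π, _, h1, h2, hae⟩ := hcpl i
  refine le_trans ?_ (hrob i)
  rw [← h1, ← h2, Measure.snd_apply (hmeas _ (sub_nonneg.mpr hε') i),
    Measure.fst_apply (hmeas _ (hε'0.trans hε') i)]
  apply measure_mono_ae
  filter_upwards [hae] with p hp hb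
  obtain ⟨z, hz, hfz⟩ := hb
  refine ⟨p.2 - p.1 + z, ?_, ?_⟩
  · have h3 := norm_add_le (p.2 - p.1) z
    rw [norm_sub_rev p.2 p.1] at h3
    linarith
  · have h4 : p.1 + (p.2 - p.1 + z) = p.2 + z := by abel
    rw [h4]
    exact hfz

end
end

section
/- There exist absolute constants c > 0 and C > 0 such that for every integer m ≥ 1 there exist two probability measures D_A and D_B on ℝ with everywhere-positive C^∞ probability density functions A(t) and B(t) such that: (i) ∫ t^l A(t) dt = ∫ t^l G(t) dt and ∫ t^l B(t) dt = ∫ t^l G(t) dt for every integer 1 ≤ l ≤ m, where G(t) = (2π)^{-1/2} e^{-t²/2}; (ii) there exist Borel sets S_A, S_B ⊆ ℝ with |a − b| ≥ c/√m for all a ∈ S_A, b ∈ S_B, and D_A(S_A) ≥ 1 − e^{−c·m} and D_B(S_B) ≥ 1 − e^{−c·m}; (iii) for every integer 0 ≤ l ≤ m+1 and every t ∈ ℝ, |(d^l/dt^l)(A(t)/G(t))| ≤ m^{C(l+1)} and |(d^l/dt^l)(B(t)/G(t))| ≤ m^{C(l+1)}. -/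
open MeasureTheory

noncomputable section

/-- The standard Gaussian density on `ℝ`. -/
def gaussPDF (t : ℝ) : ℝ := (Real.sqrt (2 * Real.pi))⁻¹ * Real.exp (-t ^ 2 / 2)

open MeasureTheory ProbabilityTheory

/-- Probabilist Hermite polynomials, as functions. -/
def HeF : ℕ → ℝ → ℝ
  | 0, _ => 1
  | 1, x => x
  | (k+2), x => x * HeF (k+1) x - (k+1) * HeF k x

lemma HeF_zero (x : ℝ) : HeF 0 x = 1 := by simp [HeF]
lemma HeF_one (x : ℝ) : HeF 1 x = x := by simp [HeF]
lemma HeF_succ_succ (k : ℕ) (x : ℝ) :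
    HeF (k+2) x = x * HeF (k+1) x - (k+1) * HeF k x := by simp [HeF]

/-- uniform recurrence, the `k = 0` term vanishing -/
lemma HeF_rec (k : ℕ) (x : ℝ) : HeF (k+1) x = x * HeF k x - k * HeF (k-1) x := by
  cases k with
  | zero => simp [HeF]
  | succ k => rw [HeF_succ_succ]; simp

lemma HeF_hasDerivAt (k : ℕ) (x : ℝ) : HasDerivAt (HeF k) (k * HeF (k-1) x) x := by
  induction k using Nat.strong_induction_on with
  | _ k ih =>
    match k with
    | 0 =>
      have : HeF 0 = fun _ => (1:ℝ) := by ext; simp [HeF]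
      rw [this]; simpa using hasDerivAt_const x (1:ℝ)
    | 1 =>
      have : HeF 1 = fun x => x := by ext; simp [HeF]
      rw [this]; simpa [HeF_zero] using hasDerivAt_id' x
    | k+2 =>
      have : HeF (k+2) = fun x => x * HeF (k+1) x - (k+1) * HeF k x := by ext; simp [HeF]
      rw [this]
      have h1 := ((hasDerivAt_id' x).mul (ih (k+1) (by omega))).sub
        ((ih k (by omega)).const_mul ((k:ℝ)+1))
      refine h1.congr_deriv ?_
      have h2 := HeF_rec k x
      simp only [Nat.add_sub_cancel, show k + 2 - 1 = k + 1 by omega]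
      push_cast
      rw [h2]; ring

lemma HeF_continuous (k : ℕ) : Continuous (HeF k) :=
  continuous_iff_continuousAt.2 fun x => (HeF_hasDerivAt k x).continuousAt

lemma HeF_neg (k : ℕ) (x : ℝ) : HeF k (-x) = (-1)^k * HeF k x := by
  induction k using Nat.strong_induction_on with
  | _ k ih =>
    match k with
    | 0 => simp [HeF]
    | 1 => simp [HeF]
    | k+2 =>
      rw [HeF_succ_succ, HeF_succ_succ, ih (k+1) (by omega), ih k (by omega)]
      ring

lemma HeF_sq_neg (k : ℕ) (x : ℝ) : HeF k (-x) ^ 2 = HeF k x ^ 2 := by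
  rw [HeF_neg, mul_pow, ← pow_mul, mul_comm k 2, pow_mul]; simp

lemma HeF_sq_abs (k : ℕ) (x : ℝ) : HeF k |x| ^ 2 = HeF k x ^ 2 := by
  rcases abs_choice x with h | h <;> rw [h]
  exact HeF_sq_neg k x

lemma HeF_no_common (k : ℕ) (x : ℝ) (h1 : HeF (k+1) x = 0) (h0 : HeF k x = 0) : False := by
  induction k with
  | zero => simp [HeF] at h0
  | succ k ih =>
    rw [HeF_succ_succ, h0] at h1
    have : ((k:ℝ)+1) ≠ 0 := by positivity
    apply ih h0
    simpa [this] using h1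

/-- crude upper bound -/
lemma HeF_abs_le (k : ℕ) (x : ℝ) : |HeF k x| ≤ (|x| + k)^k := by
  induction k using Nat.strong_induction_on with
  | _ k ih =>
    match k with
    | 0 => simp [HeF]
    | 1 => simp [HeF]
    | k+2 =>
      rw [HeF_succ_succ]
      have h1 := ih (k+1) (by omega)
      have h0 := ih k (by omega)
      have hx := abs_nonneg x
      set a := |x| + ((k+2 : ℕ):ℝ) with ha
      have e1 : |HeF (k+1) x| ≤ a^(k+1) := h1.trans (by gcongr; rw [ha]; push_cast; linarith)
      have e0 : |HeF k x| ≤ a^k := h0.trans (by gcongr; rw [ha]; push_cast; linarith)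
      have hk : (0:ℝ) ≤ k := by positivity
      have ha1 : 1 ≤ a := by rw [ha]; push_cast; linarith
      calc |x * HeF (k+1) x - (k+1) * HeF k x| ≤ |x * HeF (k+1) x| + |(k+1) * HeF k x| := abs_sub _ _
        _ = |x| * |HeF (k+1) x| + (k+1) * |HeF k x| := by
            rw [abs_mul, abs_mul, abs_of_nonneg (by positivity : (0:ℝ) ≤ (k:ℝ)+1)]
        _ ≤ |x| * a^(k+1) + (k+1) * a^(k+1) := by
            gcongr
            exact e0.trans (pow_le_pow_right₀ ha1 (by omega))
        _ ≤ a * a^(k+1) := by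
            rw [← add_mul]; gcongr; rw [ha]; push_cast; linarith
        _ = a^(k+2) := by ring

lemma HeF_gauss_le (k : ℕ) (x : ℝ) : |HeF k x| * Real.exp (-x^2/2) ≤ 2 * (k:ℝ)^k := by
  have h := HeF_abs_le k x
  have hsq : Real.exp (|x| - x^2/2) ≤ 2 := by
    have : |x| - x^2/2 ≤ 1/2 := by
      have := sq_abs x
      nlinarith [sq_nonneg (|x|-1)]
    refine (Real.exp_le_exp.2 this).trans ?_
    have h1 := Real.exp_one_lt_d9
    have h2 : Real.exp (1/2) ^ 2 = Real.exp 1 := by rw [← Real.exp_nat_mul]; norm_num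
    nlinarith [Real.exp_pos (1/2)]
  have h3 : (|x| + k)^k ≤ (k:ℝ)^k * Real.exp |x| := by
    rcases Nat.eq_zero_or_pos k with rfl | hk
    · simp
    · have hk' : (0:ℝ) < k := by exact_mod_cast hk
      have : |x| + k ≤ k * Real.exp (|x|/k) := by
        have := Real.add_one_le_exp (|x|/k)
        calc |x| + k = k * (|x|/k + 1) := by field_simp
          _ ≤ _ := by gcongr
      calc (|x| + k)^k ≤ (k * Real.exp (|x|/k))^k := by gcongr
        _ = _ := by
          rw [mul_pow, ← Real.exp_nat_mul]; congr 2; field_simp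
  calc |HeF k x| * Real.exp (-x^2/2) ≤ ((k:ℝ)^k * Real.exp |x|) * Real.exp (-x^2/2) := by
        gcongr; exact h.trans h3
    _ = (k:ℝ)^k * Real.exp (|x| - x^2/2) := by
        rw [mul_assoc, ← Real.exp_add]; congr 2; ring
    _ ≤ (k:ℝ)^k * 2 := by gcongr
    _ = _ := by ring

lemma HeF_ratio {k : ℕ} (hk : 1 ≤ k) {x : ℝ} (hx : 2 * √k ≤ x) (j : ℕ) (hj : j ≤ k) :
    0 < HeF j x ∧ (√k + √((k:ℝ) - j)) * HeF j x ≤ HeF (j+1) x := by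
  have hkpos : (0:ℝ) < k := by exact_mod_cast hk
  have hs : 0 < √(k:ℝ) := Real.sqrt_pos.2 hkpos
  induction j with
  | zero => simp [HeF]; linarith
  | succ j ih =>
    obtain ⟨h0, h1⟩ := ih (by omega)
    have hjk : ((j:ℝ)+1) ≤ k := by exact_mod_cast hj
    have hpos : 0 < HeF (j+1) x := lt_of_lt_of_le (by positivity) h1
    refine ⟨hpos, ?_⟩
    rw [HeF_succ_succ]
    set s := √(k:ℝ) with hsdef
    set r := √((k:ℝ) - (j+1:ℕ)) with hr
    set r0 := √((k:ℝ) - j) with hr0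
    have hrr : r ≤ r0 := Real.sqrt_le_sqrt (by push_cast; linarith)
    have hr' : 0 ≤ r := Real.sqrt_nonneg _
    have e1 : s^2 = k := Real.sq_sqrt hkpos.le
    have e2 : r^2 = (k:ℝ) - (j+1) := by
      rw [hr, Real.sq_sqrt] <;> push_cast <;> linarith
    -- (j+1) = (s+r)(s-r)
    have e3 : ((j:ℝ)+1) = (s+r)*(s-r) := by nlinarith
    have hsr : 0 ≤ s - r := by
      have : r^2 ≤ s^2 := by rw [e1,e2]; linarith [(Nat.cast_nonneg j : (0:ℝ) ≤ j)]
      nlinarith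
    have h2 : (s + r) * HeF j x ≤ HeF (j+1) x := le_trans (by gcongr) h1
    have h3 : ((j:ℝ)+1) * HeF j x ≤ (s-r) * HeF (j+1) x := by
      rw [e3]; nlinarith
    nlinarith

lemma HeF_pos_of_ge {k : ℕ} {x : ℝ} (hx : 2 * √k ≤ x) : 0 < HeF k x := by
  rcases Nat.eq_zero_or_pos k with rfl | hk
  · simp [HeF]
  · exact (HeF_ratio hk hx k le_rfl).1

lemma HeF_root_lt {k : ℕ} {x : ℝ} (hx : HeF k x = 0) : |x| < 2 * √k := by
  by_contra! h
  have h1 := HeF_pos_of_ge h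
  have h2 := HeF_sq_abs k x
  rw [hx] at h2
  nlinarith

/-- integral comparison, in closed form -/
lemma logsum_step {u v : ℝ} (hu : 0 ≤ u) (huv : u ≤ v) :
    ((v^2-1) * Real.log (1+v) - v^2/2 + v) - ((u^2-1) * Real.log (1+u) - u^2/2 + u)
      ≤ (v^2 - u^2) * Real.log (1+v) := by
  have key : AntitoneOn (fun t : ℝ => ((t^2-1) * Real.log (1+t) - t^2/2 + t) - t^2 * Real.log (1+v))
      (Set.Icc u v) := by
    have hd : ∀ t ∈ Set.Icc u v, HasDerivAt (fun t : ℝ => ((t^2-1) * Real.log (1+t) - t^2/2 + t) - t^2 * Real.log (1+v))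
        (2*t*(Real.log (1+t) - Real.log (1+v))) t := by
      intro t ht
      have ht0 : 0 < 1 + t := by linarith [ht.1]
      have h1 : HasDerivAt (fun t : ℝ => t^2) (2*t) t := by simpa using hasDerivAt_pow 2 t
      have h2 : HasDerivAt (fun t : ℝ => Real.log (1+t)) (1/(1+t)) t :=
        ((hasDerivAt_id' t).const_add 1).log ht0.ne'
      have h3 := ((((h1.sub_const 1).mul h2).sub (h1.div_const 2)).add (hasDerivAt_id' t)).sub
        (h1.mul_const (Real.log (1+v)))
      refine h3.congr_deriv ?_
      field_simp
      ring
    apply antitoneOn_of_hasDerivWithinAt_nonpos (convex_Icc u v)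
      (fun t ht => (hd t ht).continuousAt.continuousWithinAt)
      (fun t ht => (hd t (interior_subset ht)).hasDerivWithinAt)
    intro t ht
    have ht := interior_subset ht
    have : Real.log (1+t) ≤ Real.log (1+v) := Real.log_le_log (by linarith [ht.1]) (by linarith [ht.2])
    nlinarith [ht.1]
  have := key (Set.left_mem_Icc.2 huv) (Set.right_mem_Icc.2 huv) huv
  simp only at this
  linarith

lemma logsum {k : ℕ} (hk : 1 ≤ k) :
    (k:ℝ)/2 ≤ ∑ i ∈ Finset.range k, Real.log (1 + √(((i:ℝ)+1)/k)) := by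
  have hkpos : (0:ℝ) < k := by exact_mod_cast hk
  let G : ℕ → ℝ := fun i => ((√((i:ℝ)/k))^2-1) * Real.log (1+√((i:ℝ)/k)) - (√((i:ℝ)/k))^2/2 + √((i:ℝ)/k)
  have h : ∀ i ∈ Finset.range k, G (i+1) - G i ≤ (1/k) * Real.log (1 + √(((i:ℝ)+1)/k)) := by
    intro i _
    have := logsum_step (Real.sqrt_nonneg ((i:ℝ)/k)) (v := √(((i:ℝ)+1)/k))
      (Real.sqrt_le_sqrt (by gcongr; linarith))
    have e : (√(((i:ℝ)+1)/k))^2 - (√((i:ℝ)/k))^2 = 1/k := by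
      rw [Real.sq_sqrt (by positivity), Real.sq_sqrt (by positivity)]; ring
    rw [e] at this
    simpa [G] using this
  have h2 := Finset.sum_le_sum h
  rw [Finset.sum_range_sub, ← Finset.mul_sum] at h2
  have e1 : G k = 1/2 := by simp [G, hkpos.ne']; norm_num
  have e0 : G 0 = 0 := by simp [G]
  rw [e1, e0] at h2
  calc (k:ℝ)/2 = k * (1/2 - 0) := by ring
    _ ≤ k * (1/k * ∑ i ∈ Finset.range k, Real.log (1 + √(((i:ℝ)+1)/k))) := by gcongr
    _ = _ := by field_simp

lemma HeF_prod_le {k : ℕ} (hk : 1 ≤ k) {x : ℝ} (hx : 2 * √k ≤ x) (j : ℕ) (hj : j ≤ k) :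
    ∏ i ∈ Finset.range j, (√k + √((k:ℝ) - i)) ≤ HeF j x := by
  induction j with
  | zero => simp [HeF]
  | succ j ih =>
    rw [Finset.prod_range_succ, mul_comm]
    refine le_trans ?_ (HeF_ratio hk hx j (by omega)).2
    gcongr
    exact ih (by omega)

lemma HeF_lower {k : ℕ} (hk : 1 ≤ k) {x : ℝ} (hx : 2 * √k ≤ x) :
    (k:ℝ)^k * Real.exp k ≤ HeF k x ^ 2 := by
  have hkpos : (0:ℝ) < k := by exact_mod_cast hk
  have hs : 0 < √(k:ℝ) := Real.sqrt_pos.2 hkpos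
  have h1 := HeF_prod_le hk hx k le_rfl
  rw [← Finset.prod_range_reflect] at h1
  have h2 : ∏ i ∈ Finset.range k, (√k + √((k:ℝ) - (k - 1 - i : ℕ)))
      = √k ^ k * Real.exp (∑ i ∈ Finset.range k, Real.log (1 + √(((i:ℝ)+1)/k))) := by
    rw [Real.exp_sum]
    rw [show √(k:ℝ)^k = ∏ i ∈ Finset.range k, √(k:ℝ) by simp, ← Finset.prod_mul_distrib]
    apply Finset.prod_congr rfl
    intro i hi
    have hi := Finset.mem_range.1 hi
    have : ((k - 1 - i : ℕ):ℝ) = k - 1 - i := by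
      rw [Nat.cast_sub (by omega), Nat.cast_sub (by omega)]; simp
    rw [this, Real.exp_log (by positivity), mul_add, mul_one, Real.sqrt_div' _ hkpos.le]
    congr 1
    field_simp
    congr 1; ring
  rw [h2] at h1
  have h3 : √(k:ℝ)^k * Real.exp (k/2) ≤ HeF k x := le_trans (by gcongr; exact logsum hk) h1
  calc (k:ℝ)^k * Real.exp k = (√(k:ℝ)^k * Real.exp (k/2))^2 := by
        rw [mul_pow, ← pow_mul, mul_comm k 2, pow_mul, Real.sq_sqrt hkpos.le, ← Real.exp_nat_mul]
        congr 2; push_cast; ring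
    _ ≤ _ := by gcongr

lemma fact_upper {k : ℕ} (hk : 1 ≤ k) :
    (k.factorial : ℝ) * Real.exp k ≤ Real.exp 1 * (k:ℝ)^(k+1) := by
  induction k, hk using Nat.le_induction with
  | base => simp
  | succ k hk ih =>
    have hkpos : (0:ℝ) < k := by exact_mod_cast hk
    have h : Real.exp 1 * (k:ℝ)^(k+1) ≤ ((k:ℝ)+1)^(k+1) := by
      have h1 : (k:ℝ)/(k+1) ≤ Real.exp (-(1/((k:ℝ)+1))) := by
        have := Real.add_one_le_exp (-(1/((k:ℝ)+1)))
        refine le_trans (le_of_eq ?_) this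
        field_simp; ring
      have h2 : ((k:ℝ)/(k+1))^(k+1) ≤ Real.exp (-1) := by
        calc ((k:ℝ)/(k+1))^(k+1) ≤ (Real.exp (-(1/((k:ℝ)+1))))^(k+1) := by gcongr
          _ = _ := by rw [← Real.exp_nat_mul]; congr 1; push_cast; field_simp
      rw [div_pow, div_le_iff₀ (by positivity), Real.exp_neg] at h2
      have := mul_le_mul_of_nonneg_left h2 (Real.exp_pos 1).le
      rwa [← mul_assoc, mul_inv_cancel₀ (Real.exp_pos 1).ne', one_mul] at this
    rw [Nat.factorial_succ]
    push_cast
    rw [Real.exp_add]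
    calc ((k:ℝ)+1) * k.factorial * (Real.exp k * Real.exp 1)
        = ((k:ℝ)+1) * Real.exp 1 * (k.factorial * Real.exp k) := by ring
      _ ≤ ((k:ℝ)+1) * Real.exp 1 * (Real.exp 1 * (k:ℝ)^(k+1)) := by gcongr
      _ ≤ ((k:ℝ)+1) * Real.exp 1 * ((k:ℝ)+1)^(k+1) := by gcongr
      _ = _ := by ring

/-- lower bound on normalized Hermite past the turning point -/
lemma HeF_norm_lower {k : ℕ} (hk : 1 ≤ k) {x : ℝ} (hx : 2 * √k ≤ x) :
    Real.exp (2*k) ≤ Real.exp 1 * k * (HeF k x ^ 2 / k.factorial) := by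
  have hkpos : (0:ℝ) < k := by exact_mod_cast hk
  have hf : (0:ℝ) < k.factorial := by exact_mod_cast k.factorial_pos
  have h1 := HeF_lower hk hx
  have h2 := fact_upper hk
  rw [mul_div_assoc', le_div_iff₀ hf]
  calc Real.exp (2*k) * k.factorial = Real.exp k * (k.factorial * Real.exp k) := by
        rw [show (2*k:ℝ) = k + k by ring, Real.exp_add]; ring
    _ ≤ Real.exp k * (Real.exp 1 * (k:ℝ)^(k+1)) := by gcongr
    _ = Real.exp 1 * k * ((k:ℝ)^k * Real.exp k) := by ring
    _ ≤ _ := by gcongr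

/-- roots of consecutive Hermite polynomials are separated -/
lemma HeF_root_sep {n : ℕ} {x y : ℝ} (hx : HeF (n+1) x = 0) (hy : HeF n y = 0) :
    1 / (2 * √((n:ℝ)+1)) ≤ |x - y| := by
  set s := √((n:ℝ)+1) with hs
  have hs0 : 0 < s := Real.sqrt_pos.2 (by positivity)
  have hs2 : s^2 = n+1 := Real.sq_sqrt (by positivity)
  have hpos : ∀ t, 0 < HeF (n+1) t ^2 + (s * HeF n t)^2 := by
    intro t
    have h1 := sq_nonneg (HeF (n+1) t)
    have h2 := sq_nonneg (s * HeF n t)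
    refine lt_of_le_of_ne (by positivity) fun h => ?_
    have e1 : HeF (n+1) t ^2 = 0 := by linarith
    have e2 : (s * HeF n t)^2 = 0 := by linarith
    refine HeF_no_common n t (by simpa using e1) ?_
    have := pow_eq_zero_iff (two_ne_zero) |>.1 e2
    simpa [hs0.ne'] using this
  let W : ℝ → ℝ := fun t => HeF (n+1) t ^2 / (HeF (n+1) t ^2 + (s * HeF n t)^2)
  let W' : ℝ → ℝ := fun t => 2 * HeF (n+1) t * (s * HeF n t) *
     (s * (s * HeF n t)^2 - t * HeF (n+1) t * (s * HeF n t) + s * HeF (n+1) t ^2)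
      / (HeF (n+1) t ^2 + (s * HeF n t)^2)^2
  have hd : ∀ t, HasDerivAt W (W' t) t := by
    intro t
    have hp : HasDerivAt (HeF (n+1)) (s * (s * HeF n t)) t := by
      refine (HeF_hasDerivAt (n+1) t).congr_deriv ?_
      simp only [Nat.add_sub_cancel]; push_cast; rw [← hs2]; ring
    have hq : HasDerivAt (fun t => s * HeF n t) (t * (s * HeF n t) - s * HeF (n+1) t) t := by
      refine ((HeF_hasDerivAt n t).const_mul s).congr_deriv ?_
      rw [HeF_rec n t]; ring
    have := (hp.pow 2).div ((hp.pow 2).add (hq.pow 2)) (hpos t).ne'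
    refine this.congr_deriv ?_
    simp only [W']
    congr 1
    simp
    ring
  have hb : ∀ t ∈ Set.Icc (-(2*s)) (2*s), ‖W' t‖ ≤ 2 * s := by
    intro t ht
    have ht' : |t| ≤ 2*s := abs_le.2 ⟨ht.1, ht.2⟩
    simp only [W', Real.norm_eq_abs]
    set p := HeF (n+1) t
    set q := s * HeF n t
    have hP := hpos t
    rw [abs_div, abs_of_pos (pow_pos hP 2), div_le_iff₀ (pow_pos hP 2), abs_mul]
    have e1 : |2 * p * q| ≤ p^2+q^2 := by
      rw [abs_le]; constructor <;> nlinarith [sq_nonneg (p-q), sq_nonneg (p+q)]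
    have e2 : |s * q^2 - t * p * q + s * p^2| ≤ 2 * s * (p^2+q^2) := by
      have e3 : |t * p * q| ≤ s * (p^2+q^2) := by
        calc |t * p * q| = |t| * |2*p*q| / 2 := by simp only [abs_mul]; simp; ring
          _ ≤ (2*s) * (p^2+q^2) / 2 := by gcongr
          _ = _ := by ring
      have := abs_le.1 e3
      rw [abs_le]
      have : 0 ≤ s * q^2 := by positivity
      have : 0 ≤ s * p^2 := by positivity
      constructor <;> nlinarith
    calc _ ≤ (p^2+q^2) * (2 * s * (p^2+q^2)) := by gcongr
      _ = _ := by ring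
  have hxI : x ∈ Set.Icc (-(2*s)) (2*s) := by
    have := HeF_root_lt hx
    push_cast at this
    exact Set.mem_Icc.2 (abs_le.1 this.le)
  have hyI : y ∈ Set.Icc (-(2*s)) (2*s) := by
    have := HeF_root_lt hy
    have h2 : √(n:ℝ) ≤ s := Real.sqrt_le_sqrt (by linarith)
    exact Set.mem_Icc.2 (abs_le.1 (by linarith))
  have := Convex.norm_image_sub_le_of_norm_hasDerivWithin_le
    (fun t _ => (hd t).hasDerivWithinAt) hb (convex_Icc _ _) hyI hxI
  have wx : W x = 0 := by simp [W, hx]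
  have wy : W y = 1 := by
    have h1 : HeF (n+1) y ≠ 0 := fun h => HeF_no_common n y h hy
    simp [W, hy, h1]
  rw [wx, wy, Real.norm_eq_abs, Real.norm_eq_abs] at this
  norm_num at this
  rw [div_le_iff₀ (by positivity)]
  linarith

/-- normalized Hermite -/
def hN (k : ℕ) (x : ℝ) : ℝ := HeF k x / √(k.factorial : ℝ)

lemma hN_zero (x : ℝ) : hN 0 x = 1 := by simp [hN, HeF]

lemma hN_rec (k : ℕ) (x : ℝ) :
    √((k:ℝ)+1) * hN (k+1) x = x * hN k x - √(k:ℝ) * hN (k-1) x := by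
  unfold hN
  have hf : 0 < √(k.factorial : ℝ) := Real.sqrt_pos.2 (by exact_mod_cast k.factorial_pos)
  have h1 : √((k+1).factorial : ℝ) = √((k:ℝ)+1) * √(k.factorial : ℝ) := by
    rw [Nat.factorial_succ]; push_cast; rw [Real.sqrt_mul (by positivity)]
  have hk1 : 0 < √((k:ℝ)+1) := Real.sqrt_pos.2 (by positivity)
  rw [h1, HeF_rec]
  cases k with
  | zero => simp [HeF]
  | succ k =>
    have h2 : √((k+1).factorial : ℝ) = √((k:ℝ)+1) * √(k.factorial : ℝ) := by
      rw [Nat.factorial_succ]; push_cast; rw [Real.sqrt_mul (by positivity)]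
    have hf' : 0 < √(k.factorial : ℝ) := Real.sqrt_pos.2 (by exact_mod_cast k.factorial_pos)
    have hk2 : 0 < √((k:ℝ)+1) := Real.sqrt_pos.2 (by positivity)
    simp only [Nat.add_sub_cancel]
    push_cast at *
    rw [h2]
    have e : √((k:ℝ)+1)^2 = k+1 := Real.sq_sqrt (by positivity)
    field_simp
    rw [e]; ring

/-- Jacobi matrix -/
def Jac (n : ℕ) : Matrix (Fin n) (Fin n) ℝ := fun i j =>
  if (i:ℕ) + 1 = j then √((i:ℝ)+1) else if (j:ℕ) + 1 = i then √((j:ℝ)+1) else 0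

lemma Jac_herm (n : ℕ) : (Jac n).IsHermitian := by
  ext i j
  simp only [Matrix.conjTranspose_apply, Jac, star_trivial]
  by_cases h1 : (i:ℕ)+1 = j
  · rw [if_neg (by omega), if_pos h1, if_pos h1]
  · by_cases h2 : (j:ℕ)+1 = i
    · rw [if_pos h2, if_neg h1, if_pos h2]
    · rw [if_neg h2, if_neg h1, if_neg h1, if_neg h2]

lemma Jac_eigvec {n : ℕ} (v : Fin n → ℝ) (lam : ℝ) (hv : Matrix.mulVec (Jac n) v = lam • v) (h0 : 0 < n) :
    (∀ k : Fin n, v k = v ⟨0, h0⟩ * hN k lam) ∧ v ⟨0, h0⟩ * hN n lam = 0 := by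
  let V : ℕ → ℝ := fun k => if h : k < n then v ⟨k, h⟩ else 0
  have hrow : ∀ k < n, √((k:ℝ)+1) * V (k+1) = lam * V k - √(k:ℝ) * V (k-1) := by
    intro k hk
    have h := congrFun hv ⟨k, hk⟩
    simp only [Matrix.mulVec, dotProduct, Jac, Pi.smul_apply, smul_eq_mul] at h
    have hs : ∀ j : Fin n, (if k + 1 = (j:ℕ) then √((k:ℝ)+1) else if (j:ℕ) + 1 = k then √((j:ℝ)+1) else 0) * v j
        = (fun j : ℕ => (if k + 1 = j then √((k:ℝ)+1) * V (k+1) else 0) + (if j + 1 = k then √(k:ℝ) * V (k-1) else 0)) j := by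
      intro j
      have hVj : V j = v j := by simp [V]
      by_cases h1 : k + 1 = (j:ℕ)
      · have : ¬ ((j:ℕ) + 1 = k) := by omega
        simp [h1, this, hVj]
      · by_cases h2 : (j:ℕ) + 1 = k
        · rw [if_neg h1, if_pos h2]
          have h3 : k - 1 = (j:ℕ) := by omega
          have h4 : (k:ℝ) = (j:ℝ) + 1 := by rw [← h2]; push_cast; rfl
          simp only [if_neg h1, if_pos h2, h3, hVj, h4, zero_add]
        · simp [h1, h2]
    rw [Finset.sum_congr rfl (fun j _ => hs j), Fin.sum_univ_eq_sum_range (fun j : ℕ => (if k + 1 = j then √((k:ℝ)+1) * V (k+1) else 0) + (if j + 1 = k then √(k:ℝ) * V (k-1) else 0)),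
      Finset.sum_add_distrib] at h
    have e1 : ∑ j ∈ Finset.range n, (if k + 1 = j then √((k:ℝ)+1) * V (k+1) else 0) = √((k:ℝ)+1) * V (k+1) := by
      rw [Finset.sum_ite_eq]
      by_cases hk1 : k + 1 < n
      · simp [hk1]
      · simp [V, hk1]
    have e2 : ∑ j ∈ Finset.range n, (if j + 1 = k then √(k:ℝ) * V (k-1) else 0) = √(k:ℝ) * V (k-1) := by
      cases k with
      | zero => simp
      | succ k =>
        simp only [Nat.add_right_cancel_iff, Finset.sum_ite_eq']
        simp [show k < n by omega]
    rw [e1, e2] at h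
    have hVk : V k = v ⟨k, hk⟩ := by simp [V, hk]
    rw [hVk]; linarith
  have key : ∀ k, k ≤ n → V k = V 0 * hN k lam := by
    intro k
    induction k using Nat.strong_induction_on with
    | _ k ih =>
      intro hk
      cases k with
      | zero => simp [hN_zero]
      | succ k =>
        have h1 := hrow k (by omega)
        rw [ih k (by omega) (by omega), ih (k-1) (by omega) (by omega)] at h1
        have h2 := hN_rec k lam
        have hpos : 0 < √((k:ℝ)+1) := Real.sqrt_pos.2 (by positivity)
        apply mul_left_cancel₀ hpos.ne'
        rw [h1]; linear_combination (-(V 0)) * h2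
  have hV0 : V 0 = v ⟨0, h0⟩ := by simp [V, h0]
  constructor
  · intro k
    have := key k k.2.le
    rw [hV0] at this
    simpa [V] using this
  · rw [← hV0, ← key n le_rfl]; simp [V]

lemma quadrature (n : ℕ) (hn : 1 ≤ n) : ∃ w y : Fin n → ℝ, (∀ i, 0 ≤ w i) ∧
    (∀ k < n, ∑ i, w i * HeF k (y i) = if k = 0 then 1 else 0) ∧
    (∀ i, HeF n (y i) = 0) ∧ (∀ i, w i * Real.exp (y i ^ 2 / 2) ≤ Real.exp 3 * n) := by
  have h0 : 0 < n := hn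
  let hJ := Jac_herm n
  let b := hJ.eigenvectorBasis
  let y := hJ.eigenvalues
  let a : Fin n → ℝ := fun i => b i ⟨0, h0⟩
  have hv : ∀ i, (∀ k : Fin n, b i k = a i * hN k (y i)) ∧ a i * hN n (y i) = 0 := fun i =>
    Jac_eigvec (⇑(b i)) (y i) (hJ.mulVec_eigenvectorBasis i) h0
  have hnorm : ∀ i, ∑ k : Fin n, (b i k)^2 = 1 := by
    intro i
    have := b.orthonormal.1 i
    rw [EuclideanSpace.norm_eq] at this
    have h2 : (√(∑ k, ‖b i k‖^2))^2 = 1 := by rw [this]; norm_num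
    rw [Real.sq_sqrt (by positivity)] at h2
    simpa using h2
  have hane : ∀ i, a i ≠ 0 := by
    intro i h
    have h1 := hnorm i
    simp [(hv i).1, h] at h1
  have hroot : ∀ i, HeF n (y i) = 0 := by
    intro i
    have := (hv i).2
    have hf : √(n.factorial : ℝ) ≠ 0 := (Real.sqrt_pos.2 (by exact_mod_cast n.factorial_pos)).ne'
    simpa [hane i, hN, hf] using this
  have horth : ∀ k l : Fin n, ∑ i, b i k * b i l = if k = l then 1 else 0 := by
    intro k l
    have h := Unitary.coe_mul_star_self hJ.eigenvectorUnitary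
    have h2 := congrFun (congrFun h k) l
    rw [Matrix.mul_apply, Matrix.one_apply] at h2
    simpa [Matrix.star_apply] using h2
  refine ⟨fun i => a i ^ 2, y, fun i => sq_nonneg _, ?_, hroot, ?_⟩
  · intro k hk
    have h := horth ⟨0, h0⟩ ⟨k, hk⟩
    have hf : √(k.factorial : ℝ) ≠ 0 := (Real.sqrt_pos.2 (by exact_mod_cast k.factorial_pos)).ne'
    have e : ∑ i, a i ^ 2 * HeF k (y i) = √(k.factorial : ℝ) * ∑ i, b i ⟨0, h0⟩ * b i ⟨k, hk⟩ := by
      rw [Finset.mul_sum]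
      apply Finset.sum_congr rfl
      intro i _
      rw [(hv i).1 ⟨k, hk⟩]
      simp only [hN, a]
      field_simp
    rw [e, h]
    by_cases hk0 : k = 0
    · subst hk0; simp
    · have : ¬ ((⟨0, h0⟩ : Fin n) = ⟨k, hk⟩) := by
        intro h; apply hk0; simpa using (congrArg Fin.val h).symm
      simp [hk0, this]
  · intro i
    have hlt := HeF_root_lt (hroot i)
    have hnpos : (0:ℝ) < n := by exact_mod_cast hn
    have hn1 : (1:ℝ) ≤ n := by exact_mod_cast hn
    have hwk : ∀ k < n, a i ^ 2 * (HeF k (y i) ^ 2 / k.factorial) ≤ 1 := by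
      intro k hk
      have h1 : (b i ⟨k, hk⟩)^2 ≤ 1 := by
        rw [← hnorm i]
        exact Finset.single_le_sum (f := fun k => (b i k)^2) (fun _ _ => sq_nonneg _) (Finset.mem_univ _)
      rw [(hv i).1] at h1
      simp only [hN, mul_pow, div_pow] at h1
      rwa [Real.sq_sqrt (by positivity)] at h1
    set k := ⌊(y i)^2/4⌋₊ with hk
    have hkl : (k:ℝ) ≤ (y i)^2/4 := Nat.floor_le (by positivity)
    have hku : (y i)^2/4 < k + 1 := Nat.lt_floor_add_one _
    have hy2 : (y i)^2 < 4 * n := by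
      rw [← sq_abs]
      have := Real.sq_sqrt hnpos.le
      have := abs_nonneg (y i)
      nlinarith
    have hkn : k < n := by
      have : (k:ℝ) < n := by linarith
      exact_mod_cast this
    have hE : Real.exp (y i ^ 2 / 2) ≤ Real.exp 2 * Real.exp (2*k) := by
      rw [← Real.exp_add]; apply Real.exp_le_exp.2; linarith
    have hw0 : 0 ≤ a i ^ 2 := sq_nonneg _
    have h3 : Real.exp 3 = Real.exp 2 * Real.exp 1 := by rw [← Real.exp_add]; norm_num
    have he1 : 1 ≤ Real.exp 1 := Real.one_le_exp (by norm_num)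
    have he2 := Real.exp_pos 2
    rcases Nat.eq_zero_or_pos k with hk0 | hk0
    · have := hwk 0 h0
      simp [HeF] at this
      rw [hk0] at hE
      simp at hE
      have hw1 : a i ^2 ≤ 1 := by nlinarith [abs_le.1 this]
      calc a i ^ 2 * Real.exp (y i ^ 2 / 2) ≤ 1 * Real.exp 2 := by gcongr
        _ ≤ Real.exp 2 * (Real.exp 1 * n) := by rw [mul_comm]; gcongr; nlinarith
        _ = _ := by rw [h3]; ring
    · have hx : 2 * √(k:ℝ) ≤ |y i| := by
        apply abs_le_of_sq_le_sq' _ (abs_nonneg _) |>.2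
        rw [mul_pow, Real.sq_sqrt (by positivity), sq_abs]; linarith
      have h4 := HeF_norm_lower hk0 hx
      rw [HeF_sq_abs] at h4
      have h5 := hwk k hkn
      have hkn' : (k:ℝ) ≤ n := by exact_mod_cast hkn.le
      calc a i ^ 2 * Real.exp (y i ^ 2 / 2)
          ≤ a i ^ 2 * (Real.exp 2 * (Real.exp 1 * k * (HeF k (y i) ^ 2 / k.factorial))) := by
            gcongr; exact hE.trans (by gcongr)
        _ = Real.exp 3 * k * (a i ^ 2 * (HeF k (y i) ^ 2 / k.factorial)) := by rw [h3]; ring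
        _ ≤ Real.exp 3 * k * 1 := by gcongr
        _ ≤ _ := by rw [mul_one]; gcongr

lemma gaussPDF_eq (t : ℝ) : gaussPDF t = gaussianPDFReal 0 1 t := by
  simp [gaussPDF, gaussianPDFReal]

lemma pow_integrable (μ : ℝ) (v : NNReal) (a : ℕ) :
    Integrable (fun x : ℝ => x^a) (gaussianReal μ v) := by
  have h := (memLp_id_gaussianReal (μ := μ) (v := v) a)
  have h2 := MemLp.integrable_norm_pow' (p := a) (by simpa using h)
  refine (integrable_norm_iff (by fun_prop)).1 ?_
  simpa using h2

lemma pow_HeF_integrable (b a : ℕ) : Integrable (fun x : ℝ => x^a * HeF b x) (gaussianReal 0 1) := by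
  have hp : ∀ a : ℕ, Integrable (fun x : ℝ => x^a) (gaussianReal 0 1) := by
    intro a; exact pow_integrable 0 1 a
  induction b using Nat.strong_induction_on generalizing a with
  | _ b ih =>
    match b with
    | 0 => simpa [HeF] using hp a
    | 1 => simpa [HeF, pow_succ] using hp (a+1)
    | b+2 =>
      have := (ih (b+1) (by omega) (a+1)).sub ((ih b (by omega) a).const_mul ((b:ℝ)+1))
      refine this.congr (Filter.Eventually.of_forall fun x => ?_)
      simp only [Pi.sub_apply, HeF_succ_succ]
      ring

lemma integrable_gaussianReal_iff {μ : ℝ} {v : NNReal} (hv : v ≠ 0) (f : ℝ → ℝ) :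
    Integrable f (gaussianReal μ v) ↔ Integrable (fun x => f x * gaussianPDFReal μ v x) := by
  rw [gaussianReal_of_var_ne_zero _ hv, gaussianPDF_def,
    integrable_withDensity_iff_integrable_smul₀' (by fun_prop) (by simp)]
  refine integrable_congr (Filter.Eventually.of_forall fun x => ?_)
  simp [ENNReal.toReal_ofReal (gaussianPDFReal_nonneg μ v x), mul_comm]

lemma integral_gaussianReal' {μ : ℝ} {v : NNReal} (hv : v ≠ 0) (f : ℝ → ℝ) :
    ∫ x, f x ∂(gaussianReal μ v) = ∫ x, f x * gaussianPDFReal μ v x := by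
  rw [integral_gaussianReal_eq_integral_smul hv]
  simp [mul_comm]

lemma integral_HeF (k : ℕ) : ∫ x, HeF k x ∂(gaussianReal 0 1) = if k = 0 then 1 else 0 := by
  cases k with
  | zero => simp [HeF]
  | succ k =>
    rw [integral_gaussianReal' one_ne_zero]
    have hintg : ∀ k, Integrable (fun x => HeF k x * gaussianPDFReal 0 1 x) := by
      intro k
      rw [← integrable_gaussianReal_iff one_ne_zero]
      simpa using pow_HeF_integrable k 0
    have hd : ∀ x, HasDerivAt (fun x => HeF k x * gaussianPDFReal 0 1 x)
        (-(HeF (k+1) x * gaussianPDFReal 0 1 x)) x := by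
      intro x
      have h1 : HasDerivAt (gaussianPDFReal 0 1) (-x * gaussianPDFReal 0 1 x) x := by
        have e : gaussianPDFReal 0 1 = gaussPDF := by ext t; rw [gaussPDF_eq]
        rw [e]
        unfold gaussPDF
        have h2 : HasDerivAt (fun t : ℝ => -t^2/2) (-x) x := by
          refine (((hasDerivAt_pow 2 x).neg).div_const 2).congr_deriv ?_
          simp; ring
        refine (h2.exp.const_mul _).congr_deriv ?_
        ring
      refine ((HeF_hasDerivAt k x).mul h1).congr_deriv ?_
      rw [HeF_rec]; ring
    have := integral_eq_zero_of_hasDerivAt_of_integrable hd (hintg (k+1)).neg (hintg k)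
    rw [integral_neg] at this
    simpa using this

lemma moments_match {ι : Type*} [Fintype ι] (n : ℕ) (w y : ι → ℝ)
    (h : ∀ k < n, ∑ i, w i * HeF k (y i) = if k = 0 then 1 else 0) (a : ℕ) :
    ∀ b, a + b < n → ∑ i, w i * (y i ^ a * HeF b (y i)) = ∫ x, x^a * HeF b x ∂(gaussianReal 0 1) := by
  induction a with
  | zero =>
    intro b hb
    simp only [pow_zero, one_mul]
    rw [integral_HeF, h b (by omega)]
  | succ a ih =>
    intro b hb
    have e : ∀ x : ℝ, x^(a+1) * HeF b x = x^a * HeF (b+1) x + b * (x^a * HeF (b-1) x) := by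
      intro x; rw [HeF_rec]; ring
    simp only [e]
    rw [integral_add (pow_HeF_integrable _ _) ((pow_HeF_integrable _ _).const_mul _), integral_const_mul,
      ← ih (b+1) (by omega), ← ih (b-1) (by omega), Finset.mul_sum, ← Finset.sum_add_distrib]
    apply Finset.sum_congr rfl
    intro i _; ring

lemma gauss_shift_pow (l : ℕ) (v : NNReal) (x : ℝ) :
    ∫ z, (x + z)^l ∂(gaussianReal 0 v)
      = ∑ j ∈ Finset.range (l+1), x^j * ((∫ z, z^(l-j) ∂(gaussianReal 0 v)) * (l.choose j : ℝ)) := by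
  simp only [add_pow]
  rw [integral_finsetSum]
  · apply Finset.sum_congr rfl
    intro j _
    rw [integral_mul_const, integral_const_mul]; ring
  · intro j _
    exact ((pow_integrable 0 v (l-j)).const_mul _).mul_const _

lemma gauss_pow_mean (l : ℕ) (v : NNReal) (x : ℝ) :
    ∫ z, z^l ∂(gaussianReal x v) = ∫ z, (x + z)^l ∂(gaussianReal 0 v) := by
  have h := gaussianReal_map_const_add (μ := 0) (v := v) x
  rw [zero_add] at h
  rw [← h, integral_map (by fun_prop) (by fun_prop)]

lemma gauss_decomp (l : ℕ) (ρ : ℝ) (v : NNReal) (hρ : ρ^2 + v = 1) :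
    ∫ x, x^l ∂(gaussianReal 0 1)
      = ∫ x, (∫ z, (ρ * x + z)^l ∂(gaussianReal 0 v)) ∂(gaussianReal 0 1) := by
  have h1 := gaussianReal_map_const_mul (μ := 0) (v := 1) ρ
  rw [mul_zero, mul_one] at h1
  have h2 := gaussianReal_conv_gaussianReal (m₁ := 0) (m₂ := 0) (v₁ := .mk (ρ^2) (sq_nonneg _)) (v₂ := v)
  have h3 : (NNReal.mk (ρ^2) (sq_nonneg _) + v : NNReal) = 1 := by
    ext; push_cast; exact hρ
  rw [add_zero, h3] at h2
  rw [← h2, integral_conv (by rw [h2]; exact pow_integrable 0 1 l), h2, ← h1,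
    integral_map (by fun_prop)]
  have : (fun x : ℝ => ∫ z, (x + z)^l ∂(gaussianReal 0 v)) = fun x => _ :=
    funext fun x => gauss_shift_pow l v x
  rw [this]
  fun_prop

lemma mix_moments {ι : Type*} [Fintype ι] (n : ℕ) (w y : ι → ℝ)
    (h : ∀ k < n, ∑ i, w i * HeF k (y i) = if k = 0 then 1 else 0)
    (ρ : ℝ) (v : NNReal) (hρ : ρ^2 + v = 1) (l : ℕ) (hl : l < n) :
    ∑ i, w i * ∫ z, z^l ∂(gaussianReal (ρ * y i) v) = ∫ x, x^l ∂(gaussianReal 0 1) := by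
  rw [gauss_decomp l ρ v hρ]
  have e1 : ∀ i, ∫ z, z^l ∂(gaussianReal (ρ * y i) v) = _ := fun i =>
    (gauss_pow_mean l v (ρ * y i)).trans (gauss_shift_pow l v (ρ * y i))
  simp only [e1, gauss_shift_pow, mul_pow, Finset.mul_sum]
  rw [Finset.sum_comm, integral_finsetSum]
  · apply Finset.sum_congr rfl
    intro j hj
    have hj := Finset.mem_range.1 hj
    have hm := moments_match n w y h j 0 (by omega)
    simp only [HeF_zero, mul_one] at hm
    rw [integral_mul_const, integral_const_mul, ← hm, Finset.mul_sum, Finset.sum_mul]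
    apply Finset.sum_congr rfl
    intro i _; ring
  · intro j _
    exact ((pow_integrable 0 1 j).const_mul _).mul_const _

lemma gauss_tail (μ : ℝ) (v : NNReal) (ε : ℝ) (hε : 0 ≤ ε) :
    ENNReal.ofReal (1 - 2 * Real.exp (-ε^2/(2*v))) ≤ gaussianReal μ v {t | |t - μ| ≤ ε} := by
  have h := gaussianReal_map_const_add (μ := 0) (v := v) μ
  rw [zero_add] at h
  have hS : MeasurableSet {t : ℝ | |t - μ| ≤ ε} := measurableSet_le (by fun_prop) (by fun_prop)
  rw [← h, Measure.map_apply (by fun_prop) hS]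
  have hs : HasSubgaussianMGF id v (gaussianReal 0 v) := by
    refine ⟨fun t => integrable_exp_mul_gaussianReal t, fun t => ?_⟩
    rw [mgf_id_gaussianReal]; simp
  have h1 := hs.measure_ge_le hε
  have h2 := hs.neg.measure_ge_le hε
  have hpre : MeasurableSet ((fun x => μ + x) ⁻¹' {t : ℝ | |t - μ| ≤ ε}) := hS.preimage (by fun_prop)
  rw [← ofReal_measureReal]
  apply ENNReal.ofReal_le_ofReal
  have hc := probReal_compl_eq_one_sub (μ := gaussianReal 0 v) hpre
  have hle : (gaussianReal 0 v).real ((fun x => μ + x) ⁻¹' {t : ℝ | |t - μ| ≤ ε})ᶜ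
      ≤ (gaussianReal 0 v).real {x | ε ≤ id x} + (gaussianReal 0 v).real {x | ε ≤ (-id) x} := by
    refine le_trans (measureReal_mono ?_) (measureReal_union_le _ _)
    intro x hx
    simp only [Set.mem_compl_iff, Set.mem_preimage, Set.mem_ofPred_eq, add_sub_cancel_left, not_le] at hx
    rcases lt_abs.1 hx with h | h
    · left; exact h.le
    · right; exact h.le
  linarith

/-- The mixture density. -/
def mixD {ι : Type*} [Fintype ι] (w y : ι → ℝ) (ρ : ℝ) (v : NNReal) (t : ℝ) : ℝ :=
  ∑ i, w i * gaussianPDFReal (ρ * y i) v t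

lemma mixD_pos {ι : Type*} [Fintype ι] (w y : ι → ℝ) (ρ : ℝ) (v : NNReal) (hv : v ≠ 0)
    (hw : ∀ i, 0 ≤ w i) (hs : ∑ i, w i = 1) (t : ℝ) : 0 < mixD w y ρ v t := by
  have : ∃ i ∈ Finset.univ, w i ≠ 0 := by
    by_contra! h
    rw [Finset.sum_eq_zero h] at hs
    norm_num at hs
  obtain ⟨i, _, hi⟩ := this
  refine Finset.sum_pos' (fun j _ => mul_nonneg (hw j) (gaussianPDFReal_nonneg _ _ _)) ⟨i, Finset.mem_univ _, ?_⟩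
  exact mul_pos (lt_of_le_of_ne (hw i) hi.symm) (gaussianPDFReal_pos _ _ _ hv)

lemma mixD_contDiff {ι : Type*} [Fintype ι] (w y : ι → ℝ) (ρ : ℝ) (v : NNReal) :
    ContDiff ℝ (⊤ : ℕ∞) (mixD w y ρ v) := by
  unfold mixD
  simp only [gaussianPDFReal_def]
  fun_prop

lemma mixD_moment {ι : Type*} [Fintype ι] (w y : ι → ℝ) (ρ : ℝ) (v : NNReal) (hv : v ≠ 0) (l : ℕ) :
    Integrable (fun t => t^l * mixD w y ρ v t) ∧
    ∫ t, t^l * mixD w y ρ v t = ∑ i, w i * ∫ z, z^l ∂(gaussianReal (ρ * y i) v) := by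
  have e : (fun t => t^l * mixD w y ρ v t)
      = fun t => ∑ i, w i * (t^l * gaussianPDFReal (ρ * y i) v t) := by
    ext t; rw [mixD, Finset.mul_sum]; apply Finset.sum_congr rfl; intro i _; ring
  have hi : ∀ i ∈ Finset.univ, Integrable (fun t => w i * (t^l * gaussianPDFReal (ρ * y i) v t)) := by
    intro i _
    exact ((integrable_gaussianReal_iff hv _).1 (pow_integrable _ v l)).const_mul _
  rw [e]
  refine ⟨integrable_finsetSum _ hi, ?_⟩
  rw [integral_finsetSum _ hi]
  apply Finset.sum_congr rfl
  intro i _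
  rw [integral_const_mul, integral_gaussianReal' hv]

lemma mixD_mass {ι : Type*} [Fintype ι] (w y : ι → ℝ) (ρ : ℝ) (v : NNReal) (hv : v ≠ 0)
    (hw : ∀ i, 0 ≤ w i) (hs : ∑ i, w i = 1) (ε : ℝ) (hε : 0 ≤ ε) :
    MeasurableSet {t : ℝ | ∃ i, |t - ρ * y i| ≤ ε} ∧
    ENNReal.ofReal (1 - 2 * Real.exp (-ε^2/(2*v))) ≤
      (volume.withDensity fun t => ENNReal.ofReal (mixD w y ρ v t)) {t : ℝ | ∃ i, |t - ρ * y i| ≤ ε} := by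
  have hS : MeasurableSet {t : ℝ | ∃ i, |t - ρ * y i| ≤ ε} := by
    rw [show {t : ℝ | ∃ i, |t - ρ * y i| ≤ ε} = ⋃ i, {t : ℝ | |t - ρ * y i| ≤ ε} by ext; simp]
    exact MeasurableSet.iUnion fun i => measurableSet_le (by fun_prop) (by fun_prop)
  refine ⟨hS, ?_⟩
  rw [withDensity_apply _ hS]
  have e : ∀ t, ENNReal.ofReal (mixD w y ρ v t) = ∑ i, ENNReal.ofReal (w i) * gaussianPDF (ρ * y i) v t := by
    intro t
    rw [mixD, ENNReal.ofReal_sum_of_nonneg (fun i _ => mul_nonneg (hw i) (gaussianPDFReal_nonneg _ _ _))]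
    apply Finset.sum_congr rfl
    intro i _
    rw [ENNReal.ofReal_mul (hw i), gaussianPDF]
  simp only [e]
  rw [lintegral_finsetSum _ (fun i _ => (measurable_gaussianPDF _ _).const_mul _)]
  have e2 : ∀ i, ∫⁻ t in {t : ℝ | ∃ i, |t - ρ * y i| ≤ ε}, ENNReal.ofReal (w i) * gaussianPDF (ρ * y i) v t
      = ENNReal.ofReal (w i) * gaussianReal (ρ * y i) v {t : ℝ | ∃ i, |t - ρ * y i| ≤ ε} := by
    intro i
    rw [lintegral_const_mul _ (measurable_gaussianPDF _ _), gaussianReal_apply _ hv]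
  simp only [e2]
  calc ENNReal.ofReal (1 - 2 * Real.exp (-ε^2/(2*v)))
      = ∑ i, ENNReal.ofReal (w i) * ENNReal.ofReal (1 - 2 * Real.exp (-ε^2/(2*v))) := by
        rw [← Finset.sum_mul, ← ENNReal.ofReal_sum_of_nonneg (fun i _ => hw i), hs]; simp
    _ ≤ _ := by
        apply Finset.sum_le_sum
        intro i _
        gcongr
        refine (gauss_tail (ρ * y i) v ε hε).trans (measure_mono ?_)
        intro t ht
        exact ⟨i, ht⟩

lemma iter_gauss {ι : Type*} [Fintype ι] (c a : ι → ℝ) (b : ℝ) (l : ℕ) :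
    iteratedDeriv l (fun s => ∑ i, c i * Real.exp (-(b * s - a i)^2/2))
      = fun s => ∑ i, c i * ((-b)^l * HeF l (b * s - a i) * Real.exp (-(b * s - a i)^2/2)) := by
  induction l with
  | zero => simp [HeF]
  | succ l ih =>
    rw [iteratedDeriv_succ, ih]
    ext s
    apply HasDerivAt.deriv
    apply HasDerivAt.fun_sum
    intro i _
    have h1 : HasDerivAt (fun s => b * s - a i) b s := by
      simpa using ((hasDerivAt_id' s).const_mul b).sub_const (a i)
    have h2 : HasDerivAt (fun s => HeF l (b * s - a i)) (l * HeF (l-1) (b * s - a i) * b) s :=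
      (HeF_hasDerivAt l (b * s - a i)).comp s h1
    have h3 : HasDerivAt (fun s => -(b * s - a i)^2/2) (-(b * s - a i) * b) s := by
      refine (((h1.pow 2).neg).div_const 2).congr_deriv ?_
      simp; ring
    refine (((h2.const_mul ((-b)^l)).mul h3.exp).const_mul (c i)).congr_deriv ?_
    rw [HeF_rec]
    ring

lemma mixD_div {ι : Type*} [Fintype ι] (w y : ι → ℝ) (ρ δ : ℝ) (v : NNReal) (hδ : 0 < δ)
    (hv : (v:ℝ) = δ^2) (hρ : ρ^2 + v = 1) :
    (fun s => mixD w y ρ v s / gaussPDF s)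
      = fun s => ∑ i, (w i * Real.exp (y i ^2/2) / δ) * Real.exp (-((ρ/δ) * s - y i/δ)^2/2) := by
  ext s
  rw [mixD, Finset.sum_div]
  apply Finset.sum_congr rfl
  intro i _
  simp only [gaussianPDFReal, gaussPDF]
  rw [hv]
  rw [hv] at hρ
  have h1 : √(2 * Real.pi * δ^2) = √(2*Real.pi) * δ := by
    rw [Real.sqrt_mul (by positivity), Real.sqrt_sq hδ.le]
  have h0 : 0 < √(2*Real.pi) := by positivity
  have hE : Real.exp (-(s - ρ * y i)^2/(2*δ^2))
      = Real.exp (y i ^2/2) * Real.exp (-((ρ/δ) * s - y i/δ)^2/2) * Real.exp (-s^2/2) := by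
    rw [← Real.exp_add, ← Real.exp_add]
    congr 1
    field_simp
    linear_combination (s^2 - (y i)^2) * hρ
  rw [h1, hE]
  have := Real.exp_pos (-s^2/2)
  field_simp

lemma mixD_deriv {n : ℕ} (w y : Fin n → ℝ) (hw : ∀ i, 0 ≤ w i) (ρ δ : ℝ) (v : NNReal) (hδ : 0 < δ)
    (hv : (v:ℝ) = δ^2) (hρ : ρ^2 + v = 1) (K : ℝ) (hK : ∀ i, w i * Real.exp (y i ^ 2 / 2) ≤ K)
    (l : ℕ) (t : ℝ) :
    |iteratedDeriv l (fun s => mixD w y ρ v s / gaussPDF s) t| ≤ n * (K * (1/δ)^(l+1) * (2 * (l:ℝ)^l)) := by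
  rw [mixD_div w y ρ δ v hδ hv hρ, iter_gauss]
  refine (Finset.abs_sum_le_sum_abs _ _).trans ?_
  have hρ1 : |ρ| ≤ 1 := by
    rw [← sq_le_one_iff_abs_le_one]; nlinarith [v.2]
  have hb : |-(ρ/δ)| ≤ 1/δ := by
    rw [abs_neg, abs_div, abs_of_pos hδ]; gcongr
  have : ∀ i ∈ Finset.univ, |(w i * Real.exp (y i ^2/2) / δ) * ((-(ρ/δ))^l * HeF l ((ρ/δ) * t - y i/δ) * Real.exp (-((ρ/δ) * t - y i/δ)^2/2))| ≤ K * (1/δ)^(l+1) * (2 * (l:ℝ)^l) := by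
    intro i _
    have h1 := HeF_gauss_le l ((ρ/δ) * t - y i/δ)
    have h0 : 0 ≤ w i * Real.exp (y i ^2/2) := mul_nonneg (hw i) (Real.exp_pos _).le
    have hK0 : 0 ≤ K := h0.trans (hK i)
    rw [abs_mul, abs_mul, abs_mul, abs_pow, abs_of_nonneg (by positivity : 0 ≤ w i * Real.exp (y i ^2/2) / δ),
      abs_of_pos (Real.exp_pos _), mul_assoc (|-(ρ/δ)|^l)]
    calc _ ≤ K / δ * ((1/δ)^l * (2 * (l:ℝ)^l)) := by
          gcongr
          exact hK i
      _ = _ := by ring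
  refine (Finset.sum_le_sum this).trans ?_
  simp

lemma const_bound {m n l : ℕ} (hm : 2 ≤ m) (hn2 : n ≤ m + 2) (hl : l ≤ m + 1) :
    (n:ℝ) * ((Real.exp 3 * n) * (1/(1/(64*(m:ℝ))))^(l+1) * (2 * (l:ℝ)^l)) ≤ (m:ℝ)^((19:ℝ)*((l:ℝ)+1)) := by
  have hm' : (2:ℝ) ≤ m := by exact_mod_cast hm
  have hm1 : (1:ℝ) ≤ m := by linarith
  have hn : (n:ℝ) ≤ m^2 := by
    have : (n:ℝ) ≤ m + 2 := by exact_mod_cast hn2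
    nlinarith
  have hl' : (l:ℝ) ≤ m^2 := by
    have : (l:ℝ) ≤ m + 1 := by exact_mod_cast hl
    nlinarith
  have h64 : (64:ℝ) ≤ m^6 := by
    calc (64:ℝ) = 2^6 := by norm_num
      _ ≤ _ := by gcongr
  have he : Real.exp 3 ≤ 32 := by
    have h1 := Real.exp_one_lt_d9
    have h2 : Real.exp 1 ^ 3 = Real.exp 3 := by rw [← Real.exp_nat_mul]; norm_num
    rw [← h2]
    calc Real.exp 1 ^ 3 ≤ (2.72:ℝ)^3 := by gcongr; linarith
      _ ≤ 32 := by norm_num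
  have e : (m:ℝ)^((19:ℝ)*((l:ℝ)+1)) = (m:ℝ)^(19*(l+1)) := by
    rw [← Real.rpow_natCast]; push_cast; rfl
  rw [e, one_div_one_div]
  calc (n:ℝ) * ((Real.exp 3 * n) * (64*(m:ℝ))^(l+1) * (2 * (l:ℝ)^l))
      ≤ (m:ℝ)^2 * ((32 * (m:ℝ)^2) * ((m:ℝ)^6*m)^(l+1) * (2 * ((m:ℝ)^2)^l)) := by gcongr
    _ = 64 * (m:ℝ)^(2 + 2 + 7*(l+1) + 2*l) := by ring
    _ ≤ (m:ℝ)^6 * (m:ℝ)^(2 + 2 + 7*(l+1) + 2*l) := by gcongr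
    _ = (m:ℝ)^(6 + (2 + 2 + 7*(l+1) + 2*l)) := by rw [← pow_add]
    _ ≤ _ := pow_le_pow_right₀ hm1 (by omega)

lemma build (m n : ℕ) (hm : 2 ≤ m) (hn : m + 1 ≤ n) (hn2 : n ≤ m + 2) (ρ : ℝ)
    (hρ : ρ^2 + (1/(64*(m:ℝ)))^2 = 1) :
    ∃ (A : ℝ → ℝ) (y : Fin n → ℝ), (∀ i, HeF n (y i) = 0) ∧ (∀ t, 0 < A t) ∧
      ContDiff ℝ (⊤ : ℕ∞) A ∧ (∫ t, A t) = 1 ∧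
      (∀ l : ℕ, l ≤ m → Integrable (fun t => t ^ l * A t) ∧
        (∫ t, t ^ l * A t) = (∫ t, t ^ l * gaussPDF t)) ∧
      MeasurableSet {t : ℝ | ∃ i, |t - ρ * y i| ≤ 1/(16*√(m:ℝ))} ∧
      ENNReal.ofReal (1 - Real.exp (-((1/100) * m))) ≤
          (volume.withDensity fun t => ENNReal.ofReal (A t)) {t : ℝ | ∃ i, |t - ρ * y i| ≤ 1/(16*√(m:ℝ))} ∧
      (∀ l : ℕ, l ≤ m + 1 → ∀ t : ℝ,
        |iteratedDeriv l (fun s => A s / gaussPDF s) t| ≤ (m : ℝ) ^ ((19:ℝ) * ((l : ℝ) + 1))) := by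
  obtain ⟨w, y, hw, hex, hroot, hbd⟩ := quadrature n (by omega)
  have hmpos : (0:ℝ) < m := by exact_mod_cast (by omega : 0 < m)
  have hδ : (0:ℝ) < 1/(64*(m:ℝ)) := by positivity
  set δ : ℝ := 1/(64*(m:ℝ)) with hδdef
  let v : NNReal := .mk (δ^2) (sq_nonneg _)
  have hv : (v:ℝ) = δ^2 := rfl
  have hv0 : v ≠ 0 := by
    intro h
    have : (v:ℝ) = 0 := by rw [h]; rfl
    rw [hv] at this
    exact (pow_pos hδ 2).ne' this
  have hρ' : ρ^2 + (v:ℝ) = 1 := hρ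
  have hs : ∑ i, w i = 1 := by simpa [HeF] using hex 0 (by omega)
  have hmom : ∀ l : ℕ, l ≤ m → Integrable (fun t => t ^ l * mixD w y ρ v t) ∧
        (∫ t, t ^ l * mixD w y ρ v t) = (∫ t, t ^ l * gaussPDF t) := by
    intro l hl
    obtain ⟨h1, h2⟩ := mixD_moment w y ρ v hv0 l
    refine ⟨h1, ?_⟩
    rw [h2, mix_moments n w y hex ρ v hρ' l (by omega), integral_gaussianReal' one_ne_zero]
    simp only [gaussPDF_eq]
  obtain ⟨hS, hmass⟩ := mixD_mass w y ρ v hv0 hw hs (1/(16*√(m:ℝ))) (by positivity)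
  refine ⟨mixD w y ρ v, y, hroot, mixD_pos w y ρ v hv0 hw hs, mixD_contDiff w y ρ v, ?_, hmom, hS, ?_, ?_⟩
  · have := (hmom 0 (by omega)).2
    simp only [pow_zero, one_mul] at this
    rw [this]
    simp only [gaussPDF_eq]
    exact integral_gaussianPDFReal_eq_one 0 one_ne_zero
  · refine le_trans (ENNReal.ofReal_le_ofReal ?_) hmass
    have e : -(1/(16*√(m:ℝ)))^2/(2*v) = -(8*m) := by
      rw [hv, hδdef, div_pow, mul_pow, Real.sq_sqrt hmpos.le]
      field_simp
      norm_num
    rw [e]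
    have h1 : (2:ℝ) ≤ Real.exp (7*m) := by
      have := Real.add_one_le_exp (7*(m:ℝ))
      have hm' : (2:ℝ) ≤ m := by exact_mod_cast hm
      linarith
    have h2 : 2 * Real.exp (-(8*(m:ℝ))) ≤ Real.exp (-((1/100) * m)) := by
      calc 2 * Real.exp (-(8*(m:ℝ))) ≤ Real.exp (7*m) * Real.exp (-(8*(m:ℝ))) := by gcongr
        _ = Real.exp (-m) := by rw [← Real.exp_add]; congr 1; ring
        _ ≤ _ := Real.exp_le_exp.2 (by linarith)
    linarith
  · intro l hl t
    refine (mixD_deriv w y hw ρ δ v hδ hv hρ' (Real.exp 3 * n) hbd l t).trans ?_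
    exact const_bound hm hn2 hl

lemma gauss_unit_mass (S : Set ℝ) (a : ℝ) (hS : S = Set.Icc a (a+1)) (ha : ∀ t ∈ S, t^2 ≤ 4) :
    ENNReal.ofReal (1 - Real.exp (-((1/100) * (1:ℕ)))) ≤
          (volume.withDensity fun t => ENNReal.ofReal (gaussPDF t)) S := by
  have hm : MeasurableSet S := by rw [hS]; exact measurableSet_Icc
  rw [withDensity_apply _ hm]
  have hlow : ∀ t ∈ S, ENNReal.ofReal (1/100) ≤ ENNReal.ofReal (gaussPDF t) := by
    intro t ht
    apply ENNReal.ofReal_le_ofReal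
    have h1 := ha t ht
    unfold gaussPDF
    have h2 : √(2*Real.pi) ≤ 3 := by
      rw [Real.sqrt_le_left (by norm_num)]
      linarith [Real.pi_lt_four]
    have h3 : (1/9 : ℝ) ≤ Real.exp (-t^2/2) := by
      have h4 : Real.exp 2 ≤ 9 := by
        have h1 := Real.exp_one_lt_d9
        have h2 : Real.exp 1 ^ 2 = Real.exp 2 := by rw [← Real.exp_nat_mul]; norm_num
        rw [← h2]; nlinarith [Real.exp_pos 1]
      calc (1/9:ℝ) ≤ (Real.exp 2)⁻¹ := by rw [one_div]; gcongr
        _ = Real.exp (-2) := (Real.exp_neg 2).symm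
        _ ≤ _ := Real.exp_le_exp.2 (by linarith)
    have h5 : (1/3:ℝ) ≤ (√(2*Real.pi))⁻¹ := by rw [one_div]; gcongr
    calc (1/100:ℝ) ≤ 1/3 * (1/9) := by norm_num
      _ ≤ _ := by gcongr
  calc _ ≤ ENNReal.ofReal (1/100) := by
        apply ENNReal.ofReal_le_ofReal
        have := Real.add_one_le_exp (-((1/100:ℝ) * (1:ℕ)))
        push_cast at *
        linarith
    _ = ∫⁻ t in S, ENNReal.ofReal (1/100) := by
        rw [setLIntegral_const, hS, Real.volume_Icc]; simp
    _ ≤ _ := setLIntegral_mono' hm hlow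


/-- For every `m ≥ 1` there exist two smooth everywhere-positive probability
densities `A, B` on `ℝ` matching the first `m` Gaussian moments, whose corresponding
distributions are essentially supported on sets `S_A, S_B` at distance `≥ c/√m` from each
other (up to mass `e^{−c m}`), and with `|d^l/dt^l (A/G)|, |d^l/dt^l (B/G)| ≤ m^{C(l+1)}`
for all `0 ≤ l ≤ m+1`. -/
theorem stmt5 :
    ∃ c C : ℝ, 0 < c ∧ 0 < C ∧
    ∀ m : ℕ, 1 ≤ m →
    ∃ A B : ℝ → ℝ,
      (∀ t, 0 < A t) ∧ (∀ t, 0 < B t) ∧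
      ContDiff ℝ (⊤ : ℕ∞) A ∧ ContDiff ℝ (⊤ : ℕ∞) B ∧
      (∫ t, A t) = 1 ∧ (∫ t, B t) = 1 ∧
      (∀ l : ℕ, 1 ≤ l → l ≤ m →
        Integrable (fun t => t ^ l * A t) ∧ Integrable (fun t => t ^ l * B t) ∧
        (∫ t, t ^ l * A t) = (∫ t, t ^ l * gaussPDF t) ∧
        (∫ t, t ^ l * B t) = (∫ t, t ^ l * gaussPDF t)) ∧
      (∃ SA SB : Set ℝ, MeasurableSet SA ∧ MeasurableSet SB ∧
        (∀ a ∈ SA, ∀ b ∈ SB, c / Real.sqrt m ≤ |a - b|) ∧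
        ENNReal.ofReal (1 - Real.exp (-(c * m))) ≤
          (volume.withDensity fun t => ENNReal.ofReal (A t)) SA ∧
        ENNReal.ofReal (1 - Real.exp (-(c * m))) ≤
          (volume.withDensity fun t => ENNReal.ofReal (B t)) SB) ∧
      (∀ l : ℕ, l ≤ m + 1 → ∀ t : ℝ,
        |iteratedDeriv l (fun s => A s / gaussPDF s) t| ≤ (m : ℝ) ^ (C * ((l : ℝ) + 1)) ∧
        |iteratedDeriv l (fun s => B s / gaussPDF s) t| ≤ (m : ℝ) ^ (C * ((l : ℝ) + 1))) := by
  refine ⟨1/100, 19, by norm_num, by norm_num, ?_⟩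
  intro m hm
  rcases Nat.lt_or_ge m 2 with h2 | h2
  · obtain rfl : m = 1 := by omega
    have hpos : ∀ t, 0 < gaussPDF t := fun t => by rw [gaussPDF_eq]; exact gaussianPDFReal_pos _ _ _ one_ne_zero
    have hcd : ContDiff ℝ (⊤ : ℕ∞) gaussPDF := by unfold gaussPDF; fun_prop
    have hintg : ∫ t, gaussPDF t = 1 := by
      simp only [gaussPDF_eq]
      exact integral_gaussianPDFReal_eq_one 0 one_ne_zero
    have hmo : ∀ l : ℕ, Integrable (fun t => t ^ l * gaussPDF t) := by
      intro l
      simp only [gaussPDF_eq]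
      exact (integrable_gaussianReal_iff one_ne_zero _).1 (pow_integrable 0 1 l)
    have hder : ∀ (l : ℕ) (t : ℝ), |iteratedDeriv l (fun s => gaussPDF s / gaussPDF s) t|
        ≤ ((1:ℕ):ℝ)^((19:ℝ) * ((l:ℝ)+1)) := by
      intro l t
      have : (fun s => gaussPDF s / gaussPDF s) = fun _ => (1:ℝ) := by
        ext s; exact div_self (hpos s).ne'
      rw [this, iteratedDeriv_const]
      split_ifs <;> simp
    refine ⟨gaussPDF, gaussPDF, hpos, hpos, hcd, hcd, hintg, hintg,
      fun l _ _ => ⟨hmo l, hmo l, rfl, rfl⟩,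
      ⟨Set.Icc (-2) (-2+1), Set.Icc 1 (1+1), measurableSet_Icc, measurableSet_Icc, ?_, ?_, ?_⟩,
      fun l _ t => ⟨hder l t, hder l t⟩⟩
    · intro a ha b hb
      rw [abs_sub_comm]
      refine le_trans ?_ (le_abs_self _)
      simp only [Nat.cast_one, Real.sqrt_one]
      linarith [ha.2, hb.1]
    · exact gauss_unit_mass _ (-2) rfl (fun t ht => by nlinarith [ht.1, ht.2])
    · exact gauss_unit_mass _ 1 rfl (fun t ht => by nlinarith [ht.1, ht.2])
  · have hm' : (2:ℝ) ≤ m := by exact_mod_cast h2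
    have hδ : (1/(64*(m:ℝ)))^2 ≤ 1/4 := by
      have : 1/(64*(m:ℝ)) ≤ 1/2 := by
        apply one_div_le_one_div_of_le <;> linarith
      have h0 : 0 ≤ 1/(64*(m:ℝ)) := by positivity
      nlinarith
    set ρ := √(1 - (1/(64*(m:ℝ)))^2) with hρdef
    have hρ2 : ρ^2 = 1 - (1/(64*(m:ℝ)))^2 := Real.sq_sqrt (by linarith)
    have hρ0 : 0 ≤ ρ := Real.sqrt_nonneg _
    have hρh : 1/2 ≤ ρ := by nlinarith
    have hρ : ρ^2 + (1/(64*(m:ℝ)))^2 = 1 := by linarith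
    obtain ⟨A, x, hxr, hA1, hA2, hA3, hA4, hA5, hA6, hA7⟩ := build m (m+1) h2 le_rfl (by omega) ρ hρ
    obtain ⟨B, y, hyr, hB1, hB2, hB3, hB4, hB5, hB6, hB7⟩ := build m (m+2) h2 (by omega) le_rfl ρ hρ
    refine ⟨A, B, hA1, hB1, hA2, hB2, hA3, hB3,
      fun l _ hl => ⟨(hA4 l hl).1, (hB4 l hl).1, (hA4 l hl).2, (hB4 l hl).2⟩,
      ⟨_, _, hA5, hB5, ?_, hA6, hB6⟩, fun l hl t => ⟨hA7 l hl t, hB7 l hl t⟩⟩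
    rintro a ⟨i, hi⟩ b ⟨j, hj⟩
    have hsep := HeF_root_sep (n := m+1) (hyr j) (hxr i)
    have hs0 : 0 < √(m:ℝ) := Real.sqrt_pos.2 (by linarith)
    have hss : √(((m+1:ℕ):ℝ)+1) ≤ 3/2 * √(m:ℝ) := by
      rw [Real.sqrt_le_left (by positivity), mul_pow, Real.sq_sqrt (by linarith)]
      push_cast; linarith
    have h3 : 1/(3*√(m:ℝ)) ≤ |y j - x i| := by
      refine le_trans ?_ hsep
      apply one_div_le_one_div_of_le
      · have : 0 < √(((m+1:ℕ):ℝ)+1) := Real.sqrt_pos.2 (by positivity)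
        positivity
      · linarith
    set r := 1/√(m:ℝ) with hr
    have hr0 : 0 < r := by positivity
    have e1 : 1/(3*√(m:ℝ)) = r/3 := by rw [hr]; field_simp
    have e2 : 1/(16*√(m:ℝ)) = r/16 := by rw [hr]; field_simp
    have e3 : (1/100)/√(m:ℝ) = r/100 := by rw [hr]; field_simp
    rw [e1] at h3
    rw [e2] at hi hj
    rw [e3]
    have h4 : r/6 ≤ |ρ * y j - ρ * x i| := by
      rw [← mul_sub, abs_mul, abs_of_nonneg hρ0]
      nlinarith
    have h5 : |ρ * y j - ρ * x i| ≤ |a - ρ * x i| + |a - b| + |b - ρ * y j| := by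
      have : ρ * y j - ρ * x i = (a - ρ * x i) - (a - b) - (b - ρ * y j) := by ring
      rw [this]
      refine (abs_sub _ _).trans ?_
      gcongr
      exact abs_sub _ _
    linarith

end
end

section
/- There exists a constant c > 0 such that for every integer k > 1, if x is a real root of the (k−1)-st probabilists' Hermite polynomial He_{k−1} and y is a real root of the k-th probabilists' Hermite polynomial He_k, then |x − y| ≥ c/√k. -/
open Polynomial in
theorem hermite_derivative_aux (n : ℕ) :
    derivative (hermite (n + 1)) = ((n : ℤ[X]) + 1) * hermite n := by
  induction n with
  | zero => simp
  | succ n ih =>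
    rw [hermite_succ (n + 1), derivative_sub, derivative_mul, ih, derivative_mul]
    have h := hermite_succ n
    simp only [derivative_X, derivative_add, derivative_natCast, derivative_one]
    push_cast
    linear_combination (-(n : ℤ[X]) - 1) * h

/-- Real Hermite function. -/
noncomputable def hermR (n : ℕ) (x : ℝ) : ℝ := Polynomial.aeval x (Polynomial.hermite n)

theorem hermR_succ (n : ℕ) (x : ℝ) :
    hermR (n + 2) x = x * hermR (n + 1) x - (n + 1) * hermR n x := by
  unfold hermR
  rw [Polynomial.hermite_succ (n + 1), hermite_derivative_aux]
  simp

theorem hermR_deriv (n : ℕ) (x : ℝ) :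
    HasDerivAt (hermR (n + 1)) ((n + 1) * hermR n x) x := by
  have h := Polynomial.hasDerivAt_aeval (Polynomial.hermite (n + 1)) x
  rw [hermite_derivative_aux] at h
  rw [map_mul, map_add, map_natCast, map_one] at h
  exact h

theorem hermR_deriv' (n : ℕ) (x : ℝ) :
    HasDerivAt (hermR n) (x * hermR n x - hermR (n + 1) x) x := by
  have h := Polynomial.hasDerivAt_aeval (Polynomial.hermite n) x
  have e : x * hermR n x - hermR (n + 1) x
      = Polynomial.aeval x (Polynomial.derivative (Polynomial.hermite n)) := by
    unfold hermR
    rw [Polynomial.hermite_succ n]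
    simp
  rw [e]
  exact h

theorem hermR_no_common (n : ℕ) (x : ℝ) (h : hermR n x = 0) : hermR (n + 1) x ≠ 0 := by
  induction n with
  | zero => simp [hermR] at h
  | succ n ih =>
    intro h2
    rw [hermR_succ, h] at h2
    have : hermR n x = 0 := by
      have : ((n : ℝ) + 1) ≠ 0 := by positivity
      have h3 : ((n : ℝ) + 1) * hermR n x = 0 := by linarith
      exact (mul_eq_zero.mp h3).resolve_left this
    exact ih this h

theorem hermR_bound (n : ℕ) (s x : ℝ) (hs : 0 < s) (hn : (n : ℝ) ≤ s ^ 2) (hx : 2 * s < |x|)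
    (j : ℕ) (hj : j ≤ n) : 0 < |hermR j x| ∧ s * |hermR j x| ≤ |hermR (j + 1) x| := by
  induction j with
  | zero => simp [hermR]; linarith
  | succ j ih =>
    obtain ⟨h1, h2⟩ := ih (by omega)
    have hp : 0 < |hermR (j + 1) x| := lt_of_lt_of_le (by positivity) h2
    refine ⟨hp, ?_⟩
    rw [hermR_succ]
    have h3 := abs_sub_abs_le_abs_sub (x * hermR (j + 1) x) ((j + 1) * hermR j x)
    have hj' : ((j : ℝ) + 1) ≤ s ^ 2 := le_trans (by exact_mod_cast hj) hn
    rw [abs_mul, abs_mul, abs_of_pos (by positivity : (0 : ℝ) < (j : ℝ) + 1)] at h3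
    have h4 : ((j : ℝ) + 1) * |hermR j x| ≤ s ^ 2 * |hermR j x| := by gcongr
    have h5 : s * (s * |hermR j x|) ≤ s * |hermR (j + 1) x| := by gcongr
    have h6 : 2 * s * |hermR (j + 1) x| ≤ |x| * |hermR (j + 1) x| := by gcongr
    nlinarith

theorem root_bound (n j : ℕ) (s x : ℝ) (hs : 0 < s) (hn : (n : ℝ) ≤ s ^ 2) (hj : j ≤ n)
    (h0 : hermR j x = 0) : |x| ≤ 2 * s := by
  by_contra! h
  have := (hermR_bound n s x hs hn h j hj).1
  simp [h0] at this

theorem main_aux (m : ℕ) (x y : ℝ) (hx : hermR m x = 0) (hy : hermR (m + 1) y = 0) :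
    (1 / 3) / Real.sqrt ((m + 1 : ℕ) : ℝ) ≤ |x - y| := by
  set s := Real.sqrt ((m + 1 : ℕ) : ℝ) with hsdef
  have hs : 0 < s := Real.sqrt_pos.mpr (by positivity)
  have hs2 : s ^ 2 = ((m + 1 : ℕ) : ℝ) := Real.sq_sqrt (by positivity)
  have hs3 : s * s = (m : ℝ) + 1 := by rw [← pow_two, hs2]; push_cast; ring
  have bx := root_bound (m + 1) m s x hs hs2.ge (by omega) hx
  have bY := root_bound (m + 1) (m + 1) s y hs hs2.ge le_rfl hy
  have du : ∀ t, HasDerivAt (fun t => s * hermR m t)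
      (s * (t * hermR m t - hermR (m + 1) t)) t := fun t => (hermR_deriv' m t).const_mul s
  have dv := hermR_deriv m
  have cu : Continuous (fun t => s * hermR m t) :=
    continuous_iff_continuousAt.mpr fun t => (du t).continuousAt
  have cv : Continuous (hermR (m + 1)) :=
    continuous_iff_continuousAt.mpr fun t => (dv t).continuousAt
  obtain ⟨t0, ht0, hmax⟩ := (isCompact_uIcc (a := x) (b := y)).exists_isMaxOn
    ⟨x, Set.left_mem_uIcc⟩
    (cu.abs.max cv.abs).continuousOn
  set M := max |s * hermR m t0| |hermR (m + 1) t0| with hM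
  have hle : ∀ t ∈ Set.uIcc x y, |s * hermR m t| ≤ M ∧ |hermR (m + 1) t| ≤ M := fun t ht =>
    max_le_iff.mp (hmax ht)
  have hMpos : 0 < M := lt_of_lt_of_le (abs_pos.mpr (hermR_no_common m x hx))
    (hle x Set.left_mem_uIcc).2
  have hcx : Convex ℝ (Set.uIcc x y) := convex_uIcc x y
  have hbt : ∀ t ∈ Set.uIcc x y, |t| ≤ 2 * s := by
    intro t ht
    rw [abs_le] at *
    rcases Set.mem_uIcc.mp ht with h | h <;> constructor <;> linarith [h.1, h.2]
  have e1 := hcx.norm_image_sub_le_of_norm_hasDerivWithin_le (C := 3 * s * M)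
    (fun t ht => (du t).hasDerivWithinAt) (by
      intro t ht
      obtain ⟨h1, h2⟩ := hle t ht
      have h3 := hbt t ht
      rw [Real.norm_eq_abs]
      have e : s * (t * hermR m t - hermR (m + 1) t)
        = t * (s * hermR m t) - s * hermR (m + 1) t := by ring
      rw [e]
      refine (abs_sub _ _).trans ?_
      rw [abs_mul t, abs_mul s (hermR (m + 1) t), abs_of_pos hs]
      have := mul_le_mul h3 h1 (abs_nonneg _) (by positivity)
      have : s * |hermR (m + 1) t| ≤ s * M := by gcongr
      linarith) (Set.left_mem_uIcc (a := x) (b := y)) ht0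
  have e2 := hcx.norm_image_sub_le_of_norm_hasDerivWithin_le (C := 3 * s * M)
    (fun t ht => (dv t).hasDerivWithinAt) (by
      intro t ht
      obtain ⟨h1, h2⟩ := hle t ht
      rw [Real.norm_eq_abs, ← hs3, mul_assoc, abs_mul, abs_of_pos hs]
      have : s * |s * hermR m t| ≤ s * M := by gcongr
      have : 0 < s * M := by positivity
      linarith) (Set.right_mem_uIcc (a := x) (b := y)) ht0
  simp only [hx, hy, mul_zero, sub_zero, Real.norm_eq_abs] at e1 e2
  have d1 : |t0 - x| ≤ |x - y| := by
    rw [abs_sub_comm x y]; exact Set.abs_sub_left_of_mem_uIcc ht0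
  have d2 : |t0 - y| ≤ |x - y| := by
    rw [abs_sub_comm t0 y, abs_sub_comm x y]; exact Set.abs_sub_right_of_mem_uIcc ht0
  have hfin : M ≤ 3 * s * M * |x - y| := by
    refine max_le (e1.trans ?_) (e2.trans ?_) <;> gcongr
  rw [div_le_iff₀ hs]
  by_contra! hlt
  nlinarith

/-- There is a constant `c > 0` such that for every `k > 1`, any real root of
the `(k−1)`-st probabilists' Hermite polynomial and any real root of the `k`-th one are at
distance at least `c/√k`. -/
theorem stmt6 :
    ∃ c : ℝ, 0 < c ∧
    ∀ k : ℕ, 1 < k →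
    ∀ x y : ℝ,
      Polynomial.aeval x (Polynomial.hermite (k - 1)) = 0 →
      Polynomial.aeval y (Polynomial.hermite k) = 0 →
      c / Real.sqrt k ≤ |x - y| := by
  refine ⟨1 / 3, by norm_num, ?_⟩
  intro k hk x y hx hy
  obtain ⟨m, rfl⟩ : ∃ m, k = m + 1 := ⟨k - 1, by omega⟩
  exact main_aux m x y hx hy
end

section
/- For every integer k ≥ 1 there exists a probability measure μ on ℝ whose support is contained in the (finite) set of real roots of the k-th probabilists' Hermite polynomial He_k, such that for every integer j with 0 ≤ j ≤ 2k−1 one has ∫ t^j dμ(t) = ∫ t^j dγ(t), where γ is the standard Gaussian measure N(0,1) on ℝ. -/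
open MeasureTheory
open Polynomial ProbabilityTheory

/-- Gaussian expectation of a polynomial. -/
noncomputable def gL (p : ℝ[X]) : ℝ := ∫ t, p.eval t ∂(gaussianReal 0 1)

lemma g_integrable (p : ℝ[X]) : Integrable (fun t => p.eval t) (gaussianReal 0 1) := by
  induction p using Polynomial.induction_on' with
  | add p q hp hq =>
    simp only [eval_add]
    exact hp.add hq
  | monomial n a =>
    simp only [eval_monomial]
    exact (integrable_pow_of_mem_interior_integrableExpSet (X := id) (by simp) n).const_mul a

lemma gL_add (p q : ℝ[X]) : gL (p + q) = gL p + gL q := by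
  simp only [gL, eval_add]
  exact integral_add (g_integrable p) (g_integrable q)

lemma gL_sub (p q : ℝ[X]) : gL (p - q) = gL p - gL q := by
  simp only [gL, eval_sub]
  exact integral_sub (g_integrable p) (g_integrable q)

lemma gL_smul (c : ℝ) (p : ℝ[X]) : gL (C c * p) = c * gL p := by
  simp only [gL, eval_mul, eval_C]
  exact integral_const_mul _ _

lemma gL_pos (p : ℝ[X]) (h : ∀ t, 0 ≤ p.eval t) (hp : p ≠ 0) : 0 < gL p := by
  refine lt_of_le_of_ne (integral_nonneg h) fun h0 => hp ?_
  have h1 := (integral_eq_zero_iff_of_nonneg h (g_integrable p)).1 h0.symm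
  have h2 : (fun t => p.eval t) =ᵐ[volume] 0 :=
    (gaussianReal_absolutelyContinuous' 0 one_ne_zero).ae_le h1
  have h3 := (Continuous.ae_eq_iff_eq volume p.continuous continuous_const).1 h2
  exact Polynomial.funext fun t => by rw [eval_zero]; exact congrFun h3 t

lemma g_integrable' (p : ℝ[X]) : Integrable (fun t => gaussianPDFReal 0 1 t * p.eval t) := by
  have h := g_integrable p
  rw [gaussianReal_of_var_ne_zero _ one_ne_zero, integrable_withDensity_iff_integrable_smul'
    (measurable_gaussianPDF _ _) (by simp [gaussianPDF_lt_top])] at h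
  simpa using h

lemma gL_stein (p : ℝ[X]) : gL (X * p) = gL (derivative p) := by
  have hd : ∀ t, HasDerivAt (fun t => gaussianPDFReal 0 1 t * p.eval t)
      (gaussianPDFReal 0 1 t * (derivative p - X * p).eval t) t := by
    intro t
    have h1 : HasDerivAt (gaussianPDFReal 0 1) (gaussianPDFReal 0 1 t * (-t)) t := by
      rw [gaussianPDFReal_def]
      have : HasDerivAt (fun x : ℝ => -(x - 0) ^ 2 / (2 * ((1 : NNReal) : ℝ))) (-t) t := by
        have := (((hasDerivAt_id t).sub_const 0).pow 2).neg.div_const (2 * ((1 : NNReal) : ℝ))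
        convert! this using 1
        simp
        ring
      convert! this.exp.const_mul _ using 1
      ring
    convert! h1.mul (p.hasDerivAt t) using 1
    simp; ring
  have := integral_eq_zero_of_hasDerivAt_of_integrable hd (g_integrable' _) (g_integrable' _)
  have h2 : gL (derivative p - X * p) = 0 := by
    rw [gL, integral_gaussianReal_eq_integral_smul one_ne_zero]
    simpa using this
  rw [gL_sub] at h2; linarith

/-- Real Hermite polynomial. -/
noncomputable def gH (n : ℕ) : ℝ[X] := (hermite n).map (Int.castRingHom ℝ)

lemma gH_monic (n : ℕ) : (gH n).Monic := (hermite_monic n).map _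
lemma gH_natDegree (n : ℕ) : (gH n).natDegree = n := by
  rw [gH, (hermite_monic n).natDegree_map, natDegree_hermite]
lemma gH_eval (n : ℕ) (t : ℝ) : (gH n).eval t = aeval t (hermite n) := by
  rw [gH, eval_map, aeval_def]; rfl

lemma gL_gH (n : ℕ) (q : ℝ[X]) : gL (gH n * q) = gL (derivative^[n] q) := by
  induction n generalizing q with
  | zero => simp [gH]
  | succ n ih =>
    have : gH (n+1) = X * gH n - derivative (gH n) := by
      simp [gH, hermite_succ, derivative_map]
    rw [Function.iterate_succ_apply, ← ih, this]
    have e : (X * gH n - derivative (gH n)) * q = X * (gH n * q) - derivative (gH n) * q := by ring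
    rw [e, gL_sub, gL_stein, derivative_mul, gL_add]; ring

lemma gL_orth (n : ℕ) (q : ℝ[X]) (h : q.natDegree < n) : gL (gH n * q) = 0 := by
  rw [gL_gH, iterate_derivative_eq_zero h]; simp [gL]

lemma gH_no_factor (n : ℕ) (a q : ℝ[X]) (h : gH n = a * q) (ha : ∀ t, 0 ≤ a.eval t)
    (hd : 0 < a.natDegree) : False := by
  have hne : a * q ≠ 0 := h ▸ (gH_monic n).ne_zero
  have ha0 := left_ne_zero_of_mul hne
  have hq0 := right_ne_zero_of_mul hne
  have h1 : q.natDegree < n := by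
    rw [← gH_natDegree n, h, natDegree_mul ha0 hq0]; omega
  have h2 := gL_orth n q h1
  have h3 : 0 < gL (gH n * q) := by
    apply gL_pos
    · intro t; rw [h]; simp only [eval_mul]; rw [mul_assoc]
      exact mul_nonneg (ha t) (mul_self_nonneg _)
    · rw [h]; exact mul_ne_zero hne hq0
  linarith

/-- Root set. -/
noncomputable def gS (n : ℕ) : Finset ℝ := (gH n).roots.toFinset

lemma gH_eq_prod (n : ℕ) : gH n = ∏ r ∈ gS n, (X - C r) := by
  classical
  have hdvd : ∏ r ∈ gS n, (X - C r) ∣ gH n := by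
    refine (Multiset.toFinset_val (gH n).roots ▸ ?_ :
      ((gH n).roots.toFinset.val.map fun r => X - C r).prod ∣ gH n)
    exact (Multiset.prod_dvd_prod_of_le
      (Multiset.map_le_map (Multiset.dedup_le _))).trans (prod_multiset_X_sub_C_dvd _)
  obtain ⟨Q, hQ⟩ := hdvd
  have hPm : (∏ r ∈ gS n, (X - C r)).Monic := monic_prod_of_monic _ _ fun r _ => monic_X_sub_C r
  have hQm : Q.Monic := hPm.of_mul_monic_left (hQ ▸ gH_monic n)
  suffices Q.natDegree = 0 by
    rw [hQ, hQm.natDegree_eq_zero.1 this, mul_one]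
  by_contra hdeg
  obtain ⟨z, hz⟩ := IsAlgClosed.exists_aeval_eq_zero ℂ Q
    (by rw [Polynomial.degree_eq_natDegree hQm.ne_zero]; exact_mod_cast hdeg)
  by_cases him : z.im = 0
  · have hzr : Q.eval z.re = 0 := by
      have : z = (algebraMap ℝ ℂ) z.re := by apply Complex.ext <;> simp [him]
      rw [this, aeval_algebraMap_apply] at hz
      simpa using hz
    have hmem : z.re ∈ gS n := by
      simp [gS, (gH_monic n).ne_zero]
      rw [hQ]; simp [hzr]
    obtain ⟨Q', hQ'⟩ := dvd_iff_isRoot.2 hzr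
    rw [← Finset.mul_prod_erase _ _ hmem] at hQ
    refine gH_no_factor n ((X - C z.re) ^ 2) ((∏ r ∈ (gS n).erase z.re, (X - C r)) * Q') ?_ ?_ ?_
    · rw [hQ, hQ']; ring
    · intro t; simp; positivity
    · simp
  · obtain ⟨Q', hQ'⟩ := quadratic_dvd_of_aeval_eq_zero_im_ne_zero Q hz him
    refine gH_no_factor n (X ^ 2 - C (2 * z.re) * X + C (‖z‖ ^ 2))
      ((∏ r ∈ gS n, (X - C r)) * Q') ?_ ?_ ?_
    · rw [hQ]; nth_rw 1 [hQ']; ring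
    · intro t
      simp [Complex.sq_norm, Complex.normSq_apply]
      nlinarith [sq_nonneg (t - z.re), sq_nonneg z.im]
    · have : (X ^ 2 - C (2 * z.re) * X + C (‖z‖ ^ 2)).natDegree = 2 := by compute_degree!
      omega

lemma gS_card (n : ℕ) : (gS n).card = n := by
  have := congrArg natDegree (gH_eq_prod n)
  rw [gH_natDegree, natDegree_prod_of_monic _ _ fun r _ => monic_X_sub_C r] at this
  simpa using this.symm

lemma gS_root (n : ℕ) (r : ℝ) (hr : r ∈ gS n) : (gH n).eval r = 0 := by
  have := (Multiset.mem_toFinset.1 hr)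
  exact isRoot_of_mem_roots this

lemma gL_sum {ι : Type*} (s : Finset ι) (f : ι → ℝ[X]) : gL (∑ i ∈ s, f i) = ∑ i ∈ s, gL (f i) := by
  simp only [gL, eval_finsetSum]
  exact integral_finsetSum _ fun i _ => g_integrable _

lemma gauss_quad (n : ℕ) (hn : 1 ≤ n) (p : ℝ[X]) (hp : p.natDegree ≤ 2 * n - 1) :
    gL p = ∑ r ∈ gS n, p.eval r * gL (Lagrange.basis (gS n) id r) := by
  have hm := gH_monic n
  have h0 := modByMonic_add_div p (gH n)
  have hR : (p %ₘ gH n).degree < (gS n).card := by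
    have := degree_modByMonic_lt p hm
    rw [degree_eq_natDegree hm.ne_zero, gH_natDegree] at this
    rwa [gS_card]
  have hq : (p /ₘ gH n).natDegree < n := by
    rw [natDegree_divByMonic p hm, gH_natDegree]; omega
  have hev : ∀ r ∈ gS n, (p %ₘ gH n).eval r = p.eval r := by
    intro r hr
    conv_rhs => rw [← h0]
    simp [gS_root n r hr]
  have hL : gL p = gL (p %ₘ gH n) := by
    conv_lhs => rw [← h0]
    rw [gL_add, gL_orth n _ hq, add_zero]
  rw [hL, Lagrange.eq_interpolate (s := gS n) (v := id) (Set.injOn_id _) hR,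
    Lagrange.interpolate_apply, gL_sum]
  refine Finset.sum_congr rfl fun r hr => ?_
  rw [gL_smul]; simp [hev r hr]

lemma weight_nonneg (n : ℕ) (hn : 1 ≤ n) (r : ℝ) (hr : r ∈ gS n) :
    0 ≤ gL (Lagrange.basis (gS n) id r) := by
  have hd : (Lagrange.basis (gS n) id r).natDegree = n - 1 := by
    apply natDegree_eq_of_degree_eq_some
    rw [Lagrange.degree_basis (Set.injOn_id _) hr, gS_card]
  have h := gauss_quad n hn (Lagrange.basis (gS n) id r ^ 2) (by
    rw [natDegree_pow, hd]; omega)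
  rw [Finset.sum_eq_single r] at h
  · have h1 : (Lagrange.basis (gS n) id r).eval r = 1 :=
      Lagrange.eval_basis_self (v := id) (Set.injOn_id _) hr
    rw [eval_pow, h1] at h
    have h2 : 0 ≤ gL (Lagrange.basis (gS n) id r ^ 2) :=
      integral_nonneg fun t => by simp only [eval_pow]; exact sq_nonneg _
    linarith
  · intro s hs hsr
    have h1 : (Lagrange.basis (gS n) id r).eval s = 0 :=
      Lagrange.eval_basis_of_ne (v := id) hsr.symm hs
    simp [h1]
  · exact fun h => absurd hr h

/-- **Gauss–Hermite quadrature.** For every `k ≥ 1` there is a probability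
measure supported on the real roots of the `k`-th probabilists' Hermite polynomial whose
first `2k−1` moments match those of the standard Gaussian. -/
theorem stmt7 (k : ℕ) (hk : 1 ≤ k) :
    ∃ μ : Measure ℝ, IsProbabilityMeasure μ ∧
      μ {t : ℝ | Polynomial.aeval t (Polynomial.hermite k) ≠ 0} = 0 ∧
      ∀ j : ℕ, j ≤ 2 * k - 1 →
        (∫ t, t ^ j ∂μ) = ∫ t, t ^ j ∂(ProbabilityTheory.gaussianReal 0 1) := by
  classical
  refine ⟨∑ r ∈ gS k, ENNReal.ofReal (gL (Lagrange.basis (gS k) id r)) • Measure.dirac r,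
    ⟨?_⟩, ?_, ?_⟩
  · have h := gauss_quad k hk 1 (by simp)
    have h1 : gL 1 = 1 := by simp [gL]
    simp only [Measure.coe_finsetSum, Finset.sum_apply, Measure.smul_apply, measure_univ,
      smul_eq_mul, mul_one]
    rw [← ENNReal.ofReal_sum_of_nonneg (fun r hr => weight_nonneg k hk r hr)]
    simp only [eval_one, one_mul] at h
    rw [← h, h1, ENNReal.ofReal_one]
  · simp only [Measure.coe_finsetSum, Finset.sum_apply, Measure.smul_apply, smul_eq_mul]
    refine Finset.sum_eq_zero fun r hr => ?_
    have := gS_root k r hr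
    rw [gH_eval] at this
    simp [this]
  · intro j hj
    have h := gauss_quad k hk (X ^ j) (by simpa using hj)
    have h1 : gL (X ^ j) = ∫ t, t ^ j ∂(gaussianReal 0 1) := by simp [gL]
    rw [← h1, h, integral_finsetSum_measure]
    · refine Finset.sum_congr rfl fun r hr => ?_
      rw [integral_smul_measure, integral_dirac, ENNReal.toReal_ofReal (weight_nonneg k hk r hr)]
      simp [mul_comm]
    · intro r hr
      exact (integrable_dirac (by simp)).smul_measure ENNReal.ofReal_ne_top
end

section
/- Let u_1,…,u_k be orthonormal vectors in Euclidean ℝ^d, let s > 0, and let S_A, S_B ⊆ ℝ be nonempty sets with |a − b| ≥ s for all a ∈ S_A and b ∈ S_B. If x, y ∈ ℝ^d are such that ⟨x,u_i⟩ ∈ S_A for at least 0.9k of the indices i ∈ {1,…,k} and ⟨y,u_i⟩ ∈ S_B for at least 0.9k of the indices i ∈ {1,…,k}, then ‖x − y‖₂ ≥ s·√(0.8·k). -/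
open scoped RealInnerProductSpace

/-- If at least a `0.9` fraction of the orthonormal directions `u_i` see
`⟨x, u_i⟩ ∈ S_A` and at least a `0.9` fraction see `⟨y, u_i⟩ ∈ S_B`, where `S_A` and `S_B`
are `s`-separated, then `‖x − y‖ ≥ s·√(0.8 k)`. -/
theorem stmt9 (d k : ℕ) (u : Fin k → EuclideanSpace ℝ (Fin d)) (hu : Orthonormal ℝ u)
    (s : ℝ) (hs : 0 < s)
    (SA SB : Set ℝ) (hSA : SA.Nonempty) (hSB : SB.Nonempty)
    (hsep : ∀ a ∈ SA, ∀ b ∈ SB, s ≤ |a - b|)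
    (x y : EuclideanSpace ℝ (Fin d))
    (hx : (0.9 : ℝ) * k ≤ ({i : Fin k | ⟪x, u i⟫ ∈ SA} : Set (Fin k)).ncard)
    (hy : (0.9 : ℝ) * k ≤ ({i : Fin k | ⟪y, u i⟫ ∈ SB} : Set (Fin k)).ncard) :
    s * Real.sqrt (0.8 * k) ≤ ‖x - y‖ := by
  classical
  set P : Finset (Fin k) := Finset.univ.filter (fun i => ⟪x, u i⟫ ∈ SA) with hP
  set Q : Finset (Fin k) := Finset.univ.filter (fun i => ⟪y, u i⟫ ∈ SB) with hQ
  have eP : ({i : Fin k | ⟪x, u i⟫ ∈ SA} : Set (Fin k)) = (P : Set (Fin k)) := by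
    ext i; simp [hP]
  have eQ : ({i : Fin k | ⟪y, u i⟫ ∈ SB} : Set (Fin k)) = (Q : Set (Fin k)) := by
    ext i; simp [hQ]
  rw [eP, Set.ncard_coe_finset] at hx
  rw [eQ, Set.ncard_coe_finset] at hy
  have hcard : ((P ∪ Q).card : ℝ) + (P ∩ Q).card = P.card + Q.card := by
    exact_mod_cast Finset.card_union_add_card_inter P Q
  have hle : ((P ∪ Q).card : ℝ) ≤ k := by
    have h := Finset.card_le_univ (P ∪ Q)
    rw [Fintype.card_fin] at h
    exact_mod_cast h
  have hint : (0.8 : ℝ) * k ≤ (P ∩ Q).card := by linarith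
  have hbessel := hu.sum_inner_products_le (x := x - y) (s := P ∩ Q)
  have hsum : ((P ∩ Q).card : ℝ) * s ^ 2 ≤ ∑ i ∈ P ∩ Q, ‖⟪u i, x - y⟫‖ ^ 2 := by
    rw [← nsmul_eq_mul]
    apply Finset.card_nsmul_le_sum
    intro i hi
    rw [Finset.mem_inter] at hi
    have h1 : ⟪x, u i⟫ ∈ SA := by simpa [hP] using hi.1
    have h2 : ⟪y, u i⟫ ∈ SB := by simpa [hQ] using hi.2
    have h3 := hsep _ h1 _ h2
    rw [← inner_sub_left, real_inner_comm] at h3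
    rw [Real.norm_eq_abs]
    gcongr
  refine (sq_le_sq₀ (by positivity) (norm_nonneg _)).1 ?_
  rw [mul_pow, Real.sq_sqrt (by positivity)]
  nlinarith [mul_le_mul_of_nonneg_right hint (sq_nonneg s)]
end

section
/- Let D_A and D_B be Borel probability measures on ℝ, let s > 0 and p ∈ [0,1], and let S_A, S_B ⊆ ℝ be Borel sets with |a − b| ≥ s for all a ∈ S_A, b ∈ S_B, with D_A(S_A) ≥ 1 − p and D_B(S_B) ≥ 1 − p. Let u_1,…,u_d be an orthonormal basis of ℝ^d and 1 ≤ k ≤ d. Let D_{U,A} be the law of Σ_{i=1}^k X_i u_i + Σ_{i=k+1}^d g_i u_i where X_1,…,X_k are i.i.d. with law D_A and g_{k+1},…,g_d are i.i.d. standard Gaussians, all independent; define D_{U,B} analogously with D_B in place of D_A. Then there exist Borel sets S_{U,A}, S_{U,B} ⊆ ℝ^d such that ‖x − y‖₂ ≥ s·√(0.8·k) for all x ∈ S_{U,A}, y ∈ S_{U,B}, and D_{U,A}(S_{U,A}) ≥ 1 − 2^k·p^{0.1k} and D_{U,B}(S_{U,B}) ≥ 1 − 2^k·p^{0.1k}.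 -/
open MeasureTheory
open scoped RealInnerProductSpace

/-- Coordinate vectors for which every large set of planted coordinates hits `S`. -/
def goodSet (d k : ℕ) (S : Set ℝ) : Set (Fin d → ℝ) :=
  (⋃ T ∈ (Finset.univ.filter fun i : Fin d => (i : ℕ) < k).powerset.filter
    (fun T => (0.1 : ℝ) * k < (T.card : ℝ)), {c : Fin d → ℝ | ∀ i ∈ T, c i ∉ S})ᶜ

theorem card_planted (d k : ℕ) (hkd : k ≤ d) :
    (Finset.univ.filter fun i : Fin d => (i : ℕ) < k).card = k := by
  rw [Fin.card_filter_val_lt]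
  omega

theorem measurable_bad (d : ℕ) (S : Set ℝ) (hS : MeasurableSet S) (T : Finset (Fin d)) :
    MeasurableSet {c : Fin d → ℝ | ∀ i ∈ T, c i ∉ S} := by
  have : {c : Fin d → ℝ | ∀ i ∈ T, c i ∉ S} = ⋂ i ∈ T, (fun c : Fin d → ℝ => c i) ⁻¹' Sᶜ := by
    ext c; simp
  rw [this]
  exact Finset.measurableSet_biInter _ fun i _ => (measurable_pi_apply i) hS.compl

theorem measurable_goodSet (d k : ℕ) (S : Set ℝ) (hS : MeasurableSet S) :
    MeasurableSet (goodSet d k S) :=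
  (Finset.measurableSet_biUnion _ fun T _ => measurable_bad d S hS T).compl

theorem bad_le (d k : ℕ) (D : Measure ℝ) [IsProbabilityMeasure D] (p : ℝ)
    (hp0 : 0 ≤ p) (hp1 : p ≤ 1) (S : Set ℝ) (hS : MeasurableSet S)
    (hD : ENNReal.ofReal (1 - p) ≤ D S) (T : Finset (Fin d))
    (hT : ∀ i ∈ T, (i : ℕ) < k) :
    (Measure.pi fun i : Fin d =>
      if (i : ℕ) < k then D else ProbabilityTheory.gaussianReal 0 1)
      {c : Fin d → ℝ | ∀ i ∈ T, c i ∉ S} ≤ ENNReal.ofReal (p ^ T.card) := by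
  have hprob : ∀ i : Fin d, IsProbabilityMeasure
      (if (i : ℕ) < k then D else ProbabilityTheory.gaussianReal 0 1) := by
    intro i; split_ifs <;> infer_instance
  have hset : {c : Fin d → ℝ | ∀ i ∈ T, c i ∉ S} =
      Set.pi Set.univ (fun i => if i ∈ T then Sᶜ else Set.univ) := by
    ext c
    simp only [Set.mem_ofPred_eq, Set.mem_pi, Set.mem_univ, true_imp_iff]
    refine forall_congr' fun i => ?_
    by_cases h : i ∈ T <;> simp [h]
  have hc : D Sᶜ ≤ ENNReal.ofReal p := by
    rw [prob_compl_eq_one_sub hS]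
    calc 1 - D S ≤ 1 - ENNReal.ofReal (1 - p) := tsub_le_tsub_left hD 1
      _ = ENNReal.ofReal p := by
        rw [← ENNReal.ofReal_one, ← ENNReal.ofReal_sub _ (by linarith)]
        congr 1; ring
  rw [hset, Measure.pi_pi, ENNReal.ofReal_pow hp0, ← Finset.prod_const,
    ← Finset.prod_subset (Finset.subset_univ T)]
  · refine Finset.prod_le_prod' fun i hi => ?_
    simp only [hi, hT i hi, if_true]
    exact hc
  · intro i _ hi
    simp only [hi, if_false]
    exact measure_univ

theorem goodSet_prob (d k : ℕ) (hk : 1 ≤ k) (hkd : k ≤ d) (D : Measure ℝ)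
    [IsProbabilityMeasure D] (p : ℝ)
    (hp0 : 0 ≤ p) (hp1 : p ≤ 1) (S : Set ℝ) (hS : MeasurableSet S)
    (hD : ENNReal.ofReal (1 - p) ≤ D S) :
    ENNReal.ofReal (1 - 2 ^ k * p ^ ((0.1 : ℝ) * k)) ≤
    (Measure.pi fun i : Fin d =>
      if (i : ℕ) < k then D else ProbabilityTheory.gaussianReal 0 1) (goodSet d k S) := by
  have hprob : ∀ i : Fin d, IsProbabilityMeasure
      (if (i : ℕ) < k then D else ProbabilityTheory.gaussianReal 0 1) := by
    intro i; split_ifs <;> infer_instance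
  have hk' : (0 : ℝ) < k := by exact_mod_cast hk
  rw [goodSet, prob_compl_eq_one_sub
    (Finset.measurableSet_biUnion _ fun T _ => measurable_bad d S hS T),
    ENNReal.ofReal_sub _ (by positivity), ENNReal.ofReal_one]
  refine tsub_le_tsub_left ?_ 1
  refine (measure_biUnion_finset_le _ _).trans ?_
  refine (Finset.sum_le_card_nsmul _ _ (ENNReal.ofReal (p ^ ((0.1 : ℝ) * k))) ?_).trans ?_
  · intro T hT
    rw [Finset.mem_filter, Finset.mem_powerset] at hT
    refine (bad_le d k D p hp0 hp1 S hS hD T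
      fun i hi => (Finset.mem_filter.1 (hT.1 hi)).2).trans ?_
    refine ENNReal.ofReal_le_ofReal ?_
    rw [← Real.rpow_natCast]
    refine Real.rpow_le_rpow_of_exponent_ge_of_imp hp0 hp1 hT.2.le ?_
    intro _ h
    have h7 : (0 : ℝ) < 0.1 * k := by positivity
    linarith [hT.2]
  · rw [ENNReal.ofReal_mul (by positivity), nsmul_eq_mul]
    gcongr
    rw [ENNReal.ofReal_pow (by norm_num), ENNReal.ofReal_ofNat]
    have := Finset.card_filter_le
      (Finset.univ.filter fun i : Fin d => (i : ℕ) < k).powerset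
      (fun T => (0.1 : ℝ) * k < (T.card : ℝ))
    rw [Finset.card_powerset, card_planted d k hkd] at this
    exact_mod_cast this

open Classical in
theorem goodSet_card (d k : ℕ) (S : Set ℝ) (c : Fin d → ℝ) (hc : c ∈ goodSet d k S) :
    (((Finset.univ.filter fun i : Fin d => (i : ℕ) < k).filter fun i => c i ∉ S).card : ℝ)
      ≤ 0.1 * k := by
  by_contra! h
  apply hc
  simp only [Set.mem_iUnion]
  refine ⟨_, Finset.mem_filter.2 ⟨Finset.mem_powerset.2 (Finset.filter_subset _ _), h⟩, ?_⟩
  intro i hi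
  exact (Finset.mem_filter.1 hi).2

open Classical in
theorem good_sep (d k : ℕ) (hkd : k ≤ d) (s : ℝ) (hs : 0 < s) (SA SB : Set ℝ)
    (hsep : ∀ a ∈ SA, ∀ b ∈ SB, s ≤ |a - b|) (a b : Fin d → ℝ)
    (ha : a ∈ goodSet d k SA) (hb : b ∈ goodSet d k SB) :
    s ^ 2 * (0.8 * k) ≤ ∑ i, (a i - b i) ^ 2 := by
  have h1 := goodSet_card d k SA a ha
  have h2 := goodSet_card d k SB b hb
  have h3 := card_planted d k hkd
  set F := Finset.univ.filter fun i : Fin d => (i : ℕ) < k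
  set G := F.filter fun i => a i ∈ SA ∧ b i ∈ SB with hG
  have hsub : F ⊆ G ∪ (F.filter (fun i => a i ∉ SA) ∪ F.filter (fun i => b i ∉ SB)) := by
    intro i hi
    simp only [hG, Finset.mem_union, Finset.mem_filter, hi, true_and]
    tauto
  have h4 : k ≤ G.card + ((F.filter (fun i => a i ∉ SA)).card
      + (F.filter (fun i => b i ∉ SB)).card) := by
    rw [← h3]
    refine (Finset.card_le_card hsub).trans ((Finset.card_union_le _ _).trans ?_)
    have := Finset.card_union_le (F.filter (fun i => a i ∉ SA)) (F.filter (fun i => b i ∉ SB))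
    omega
  have h5 : (k : ℝ) ≤ G.card + ((F.filter (fun i => a i ∉ SA)).card
      + (F.filter (fun i => b i ∉ SB)).card) := by exact_mod_cast h4
  have h6 : 0.8 * (k : ℝ) ≤ G.card := by linarith
  calc s ^ 2 * (0.8 * k) ≤ s ^ 2 * G.card := by gcongr
    _ = ∑ i ∈ G, s ^ 2 := by rw [Finset.sum_const, nsmul_eq_mul, mul_comm]
    _ ≤ ∑ i ∈ G, (a i - b i) ^ 2 := by
      refine Finset.sum_le_sum fun i hi => ?_
      have h := (Finset.mem_filter.1 hi).2
      rw [← sq_abs (a i - b i)]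
      exact pow_le_pow_left₀ hs.le (hsep _ h.1 _ h.2) 2
    _ ≤ _ := Finset.sum_le_sum_of_subset_of_nonneg (Finset.subset_univ _)
      fun i _ _ => sq_nonneg _

/-- Planting `s`-separated one-dimensional distributions `D_A`, `D_B` in the
first `k` directions of an orthonormal basis (and standard Gaussians in the remaining
directions) produces distributions on `ℝ^d` essentially supported (up to mass `2^k p^{0.1k}`)
on sets that are `s·√(0.8k)`-separated. -/
theorem stmt10 (d k : ℕ) (hk : 1 ≤ k) (hkd : k ≤ d)
    (DA DB : Measure ℝ) [IsProbabilityMeasure DA] [IsProbabilityMeasure DB]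
    (s p : ℝ) (hs : 0 < s) (hp0 : 0 ≤ p) (hp1 : p ≤ 1)
    (SA SB : Set ℝ) (hSA : MeasurableSet SA) (hSB : MeasurableSet SB)
    (hsep : ∀ a ∈ SA, ∀ b ∈ SB, s ≤ |a - b|)
    (hDA : ENNReal.ofReal (1 - p) ≤ DA SA) (hDB : ENNReal.ofReal (1 - p) ≤ DB SB)
    (u : Fin d → EuclideanSpace ℝ (Fin d)) (hu : Orthonormal ℝ u) :
    ∃ SUA SUB : Set (EuclideanSpace ℝ (Fin d)),
      MeasurableSet SUA ∧ MeasurableSet SUB ∧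
      (∀ x ∈ SUA, ∀ y ∈ SUB, s * Real.sqrt (0.8 * k) ≤ ‖x - y‖) ∧
      ENNReal.ofReal (1 - 2 ^ k * p ^ ((0.1 : ℝ) * k)) ≤
        Measure.map (fun c : Fin d → ℝ => ∑ i : Fin d, c i • u i)
          (Measure.pi fun i : Fin d =>
            if (i : ℕ) < k then DA else ProbabilityTheory.gaussianReal 0 1) SUA ∧
      ENNReal.ofReal (1 - 2 ^ k * p ^ ((0.1 : ℝ) * k)) ≤
        Measure.map (fun c : Fin d → ℝ => ∑ i : Fin d, c i • u i)
          (Measure.pi fun i : Fin d =>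
            if (i : ℕ) < k then DB else ProbabilityTheory.gaussianReal 0 1) SUB := by
  have hcoord : Measurable fun x : EuclideanSpace ℝ (Fin d) => fun i => ⟪u i, x⟫ := by
    fun_prop
  have hf : Measurable fun c : Fin d → ℝ => ∑ i : Fin d, c i • u i := by
    fun_prop
  have hpre : ∀ G : Set (Fin d → ℝ),
      (fun c : Fin d → ℝ => ∑ i : Fin d, c i • u i) ⁻¹'
        ((fun x : EuclideanSpace ℝ (Fin d) => fun i => ⟪u i, x⟫) ⁻¹' G) = G := by
    intro G
    ext c
    simp only [Set.mem_preimage, hu.inner_right_fintype]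
  have hmA := hcoord (measurable_goodSet d k SA hSA)
  have hmB := hcoord (measurable_goodSet d k SB hSB)
  refine ⟨_, _, hmA, hmB, ?_, ?_, ?_⟩
  · intro x hx y hy
    have h := good_sep d k hkd s hs SA SB hsep _ _ hx hy
    have h2 : ∑ i, (⟪u i, x⟫ - ⟪u i, y⟫) ^ 2 ≤ ‖x - y‖ ^ 2 := by
      have := hu.sum_inner_products_le (x - y) (s := Finset.univ)
      simpa only [inner_sub_right, Real.norm_eq_abs, sq_abs] using this
    refine (sq_le_sq₀ (by positivity) (norm_nonneg _)).1 ?_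
    rw [mul_pow, Real.sq_sqrt (by positivity)]
    exact h.trans h2
  · rw [Measure.map_apply hf hmA, hpre]
    exact goodSet_prob d k hk hkd DA p hp0 hp1 SA hSA hDA
  · rw [Measure.map_apply hf hmB, hpre]
    exact goodSet_prob d k hk hkd DB p hp0 hp1 SB hSB hDB
end

section
/- Let m, d, k be positive integers with k ≤ d, and let u_1,…,u_k be orthonormal vectors in Euclidean ℝ^d spanning a subspace U. Let a : ℝ → ℝ be a C^∞ function such that a and its derivatives up to order m are bounded, and such that E_{t∼N(0,1)}[t^l·a(t)] = 0 for every integer 0 ≤ l ≤ m. Let S, T ⊆ {1,…,k} be nonempty with |S| ≥ |T|. For each i ∈ T, let ṽ_i ∈ ℝ^d be orthogonal to U, and let w_i ∈ U. Then for every function l : T → {0,1,…,m}, E_{x∼N(0,I_d)}[ ∏_{i∈S} a(⟨x,u_i⟩) · ∏_{i∈T} ( a^{(l(i))}(⟨x,ṽ_i⟩) · ⟨x,w_i⟩^{l(i)} / l(i)! ) ] = 0, where a^{(j)} denotes the j-th derivative of a and N(0,I_d) is the standard Gaussian measure on ℝ^d. -/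
open MeasureTheory
open scoped RealInnerProductSpace

noncomputable section

/-- The standard Gaussian measure `N(0, I_d)` on `ℝ^d`. -/
def stdGaussian (d : ℕ) : Measure (EuclideanSpace ℝ (Fin d)) :=
  Measure.map (⇑(EuclideanSpace.equiv (Fin d) ℝ).symm)
    (Measure.pi fun _ : Fin d => ProbabilityTheory.gaussianReal 0 1)

/-- One-coordinate Fubini: a function with zero mean in the coordinate `j` times a function not
depending on that coordinate integrates to zero. -/
lemma aux_coord {n : ℕ} (j : Fin n) (f : ℝ → ℝ) (g : (Fin n → ℝ) → ℝ) (hf : Measurable f)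
    (hg : Measurable g) (hgj : ∀ y, g (Function.update y j 0) = g y)
    (h0 : ∫ t, f t ∂(ProbabilityTheory.gaussianReal 0 1) = 0) :
    ∫ y, f (y j) * g y ∂(Measure.pi fun _ : Fin n => ProbabilityTheory.gaussianReal 0 1) = 0 := by
  classical
  set μ := Measure.pi fun _ : Fin n => ProbabilityTheory.gaussianReal 0 1 with hμ
  have hind : ProbabilityTheory.iIndepFun (fun (i : Fin n) (y : Fin n → ℝ) => y i) μ :=
    ProbabilityTheory.iIndepFun_pi (X := fun _ => id) (fun _ => aemeasurable_id)
  have h1 := hind.indepFun_finset {j} (Finset.univ.erase j) (by simp) (fun i => measurable_pi_apply i)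
  let φ : ((({j} : Finset (Fin n)) : Type) → ℝ) → ℝ := fun z => f (z ⟨j, by simp⟩)
  let ψ : (((Finset.univ.erase j : Finset (Fin n)) : Type) → ℝ) → ℝ :=
    fun z => g (fun i => if h : i ∈ Finset.univ.erase j then z ⟨i, h⟩ else 0)
  have hφ : Measurable φ := hf.comp (measurable_pi_apply _)
  have hψ : Measurable ψ := by
    refine hg.comp (measurable_pi_lambda _ fun i => ?_)
    by_cases h : i ∈ Finset.univ.erase j
    · simp only [h, dif_pos]; exact measurable_pi_apply _
    · simp only [h, dif_neg, not_false_iff]; exact measurable_const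
  have h2 := h1.comp hφ hψ
  have e1 : (φ ∘ fun (a : Fin n → ℝ) (i : (({j} : Finset (Fin n)) : Type)) => a i)
      = fun y => f (y j) := rfl
  have e2 : (ψ ∘ fun (a : Fin n → ℝ) (i : ((Finset.univ.erase j : Finset (Fin n)) : Type)) => a i)
      = g := by
    funext y
    rw [← hgj y]
    simp only [ψ, Function.comp]
    congr 1
    funext i
    by_cases h : i = j
    · subst h; simp
    · simp [h]
  rw [e1, e2] at h2
  rw [h2.integral_fun_mul_eq_mul_integral (hf.comp (measurable_pi_apply j)).aestronglyMeasurable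
    hg.aestronglyMeasurable]
  have h3 : ∫ y, f (y j) ∂μ = 0 := by
    rw [← h0]
    exact integral_comp_eval (μ := fun _ : Fin n => ProbabilityTheory.gaussianReal 0 1)
      hf.aestronglyMeasurable
  rw [h3, zero_mul]

/-- Monomials are integrable for the Gaussian measure. -/
lemma aux_int {n : ℕ} (e : Fin n → ℕ) :
    Integrable (fun y : Fin n → ℝ => ∏ i, y i ^ e i)
      (Measure.pi fun _ : Fin n => ProbabilityTheory.gaussianReal 0 1) := by
  refine Integrable.fintype_prod (f := fun i (t : ℝ) => t ^ e i) fun i => ?_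
  have h := ProbabilityTheory.memLp_id_gaussianReal (μ := 0) (v := 1) (e i)
  have := h.integrable_norm_pow'
  refine (integrable_norm_iff (by fun_prop)).1 ?_
  simpa using this

/-- Bounded measurable functions are closed under finite products. -/
lemma aux_bdd {α ι : Type*} (s : Finset ι) (F : ι → α → ℝ)
    (h : ∀ i ∈ s, ∃ M : ℝ, ∀ y, |F i y| ≤ M) : ∃ M : ℝ, ∀ y, |∏ i ∈ s, F i y| ≤ M := by
  classical
  choose! M hM using h
  exact ⟨∏ i ∈ s, M i, fun y => by
    rw [Finset.abs_prod]
    exact Finset.prod_le_prod (fun _ _ => abs_nonneg _) fun i hi => hM i hi y⟩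

/-- Total degree of a product of powers of linear forms. -/
lemma aux_deg {n k : ℕ} (T : Finset (Fin k)) (l : Fin k → ℕ) (c : Fin k → Fin n → ℝ) :
    (∏ i ∈ T, (∑ j, MvPolynomial.C (c i j) * MvPolynomial.X j : MvPolynomial (Fin n) ℝ) ^ l i
      ).totalDegree ≤ ∑ i ∈ T, l i := by
  refine (MvPolynomial.totalDegree_finsetProd _ _).trans (Finset.sum_le_sum fun i _ => ?_)
  refine (MvPolynomial.totalDegree_pow _ _).trans ?_
  have : (∑ j, MvPolynomial.C (c i j) * MvPolynomial.X j : MvPolynomial (Fin n) ℝ).totalDegree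
      ≤ 1 := by
    refine MvPolynomial.totalDegree_finsetSum_le fun j _ => ?_
    refine (MvPolynomial.totalDegree_mul _ _).trans ?_
    simp
  nlinarith

theorem stmt11 (m d k : ℕ) (hm : 0 < m) (hd : 0 < d) (hk : 0 < k) (hkd : k ≤ d)
    (u : Fin k → EuclideanSpace ℝ (Fin d)) (hu : Orthonormal ℝ u)
    (a : ℝ → ℝ) (ha : ContDiff ℝ (⊤ : ℕ∞) a)
    (hbdd : ∀ l : ℕ, l ≤ m → ∃ M : ℝ, ∀ t : ℝ, |iteratedDeriv l a t| ≤ M)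
    (hmom : ∀ l : ℕ, l ≤ m → (∫ t, t ^ l * a t ∂(ProbabilityTheory.gaussianReal 0 1)) = 0)
    (S T : Finset (Fin k)) (hS : S.Nonempty) (hT : T.Nonempty) (hST : T.card ≤ S.card)
    (vt : Fin k → EuclideanSpace ℝ (Fin d))
    (hvt : ∀ i ∈ T, vt i ∈ (Submodule.span ℝ (Set.range u))ᗮ)
    (w : Fin k → EuclideanSpace ℝ (Fin d))
    (hw : ∀ i ∈ T, w i ∈ Submodule.span ℝ (Set.range u))
    (l : Fin k → ℕ) (hl : ∀ i ∈ T, l i ≤ m) :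
    (∫ x, (∏ i ∈ S, a ⟪x, u i⟫) *
        ∏ i ∈ T, (iteratedDeriv (l i) a ⟪x, vt i⟫ * ⟪x, w i⟫ ^ (l i) / (Nat.factorial (l i)))
      ∂(stdGaussian d)) = 0 := by
  classical
  have hcont : ∀ q : ℕ, Continuous (iteratedDeriv q a) := fun q =>
    ha.continuous_iteratedDeriv q (by exact_mod_cast le_top)
  have hac : Continuous a := ha.continuous
  set ι : Fin k → Fin d := Fin.castLE hkd with hι
  have hιinj : Function.Injective ι := Fin.castLE_injective hkd
  -- extend `u` to an orthonormal basis
  obtain ⟨b, hb⟩ : ∃ b : OrthonormalBasis (Fin d) ℝ (EuclideanSpace ℝ (Fin d)),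
      ∀ i, b (ι i) = u i := by
    let v : Fin d → EuclideanSpace ℝ (Fin d) := Function.extend ι u 0
    have hv : ∀ i, v (ι i) = u i := fun i => hιinj.extend_apply _ _ _
    have hor : Orthonormal ℝ ((Set.range ι).domRestrict v) := by
      let e := Equiv.ofInjective ι hιinj
      have h2 : (Set.range ι).domRestrict v = u ∘ e.symm := by
        funext x
        obtain ⟨i, rfl⟩ := e.surjective x
        simp only [Function.comp, Equiv.symm_apply_apply]
        exact hv i
      rw [h2]
      exact hu.comp _ e.symm.injective
    obtain ⟨b, hb⟩ := hor.exists_orthonormalBasis_extension_of_card_eq (by simp)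
    exact ⟨b, fun i => (hb _ ⟨i, rfl⟩).trans (hv i)⟩
  set μ := Measure.pi fun _ : Fin d => ProbabilityTheory.gaussianReal 0 1 with hμ
  have hstd : stdGaussian d = μ.map (fun y => ∑ j, y j • b j) := by
    rw [← ProbabilityTheory.stdGaussian_eq_map_pi_orthonormalBasis b,
      ← ProbabilityTheory.map_pi_eq_stdGaussian]
    rfl
  have hinner : ∀ (y : Fin d → ℝ) (z : EuclideanSpace ℝ (Fin d)),
      ⟪∑ j, y j • b j, z⟫ = ∑ j, ⟪b j, z⟫ * y j := by
    intro y z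
    simp [sum_inner, real_inner_smul_left, mul_comm]
  rw [hstd, integral_map (Measurable.aemeasurable (by fun_prop))]
  swap
  · refine Continuous.aestronglyMeasurable ?_
    refine Continuous.mul (continuous_finsetProd _ fun i _ => by fun_prop)
      (continuous_finsetProd _ fun i _ => ?_)
    have := hcont (l i)
    fun_prop
  have hu' : ∀ (y : Fin d → ℝ) (i : Fin k), ⟪∑ j, y j • b j, u i⟫ = y (ι i) := by
    intro y i
    rw [hinner, ← hb i]
    simp [orthonormal_iff_ite.1 b.orthonormal]
  let G : (Fin d → ℝ) → ℝ := fun y =>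
    ∏ i ∈ T, (iteratedDeriv (l i) a (∑ j, ⟪b j, vt i⟫ * y j) / (Nat.factorial (l i)))
  let A : (Fin d → ℝ) → ℝ := fun y => ∏ i ∈ S, a (y (ι i))
  let P : MvPolynomial (Fin d) ℝ := ∏ i ∈ T,
    (∑ j, MvPolynomial.C (⟪b j, w i⟫) * MvPolynomial.X j) ^ l i
  have hGc : Continuous G := by
    refine continuous_finsetProd _ fun i _ => ?_
    have := hcont (l i)
    fun_prop
  have hAc : Continuous A := continuous_finsetProd _ fun i _ => by fun_prop
  have hPdeg : P.totalDegree ≤ m * S.card := by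
    refine (aux_deg T l fun i j => ⟪b j, w i⟫).trans ?_
    calc ∑ i ∈ T, l i ≤ ∑ _i ∈ T, m := Finset.sum_le_sum hl
      _ = T.card * m := by simp
      _ ≤ m * S.card := by rw [mul_comm]; exact Nat.mul_le_mul_left _ hST
  have hAb : ∃ M : ℝ, ∀ y, |A y| ≤ M := by
    obtain ⟨M, hM⟩ := hbdd 0 (Nat.zero_le _)
    refine aux_bdd S (fun i (y : Fin d → ℝ) => a (y (ι i))) fun i _ => ⟨M, fun y => ?_⟩
    simpa using hM (y (ι i))
  have hGb : ∃ M : ℝ, ∀ y, |G y| ≤ M := by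
    refine aux_bdd T (fun i (y : Fin d → ℝ) =>
      iteratedDeriv (l i) a (∑ j, ⟪b j, vt i⟫ * y j) / (Nat.factorial (l i))) fun i hi => ?_
    obtain ⟨M, hM⟩ := hbdd (l i) (hl i hi)
    refine ⟨M / (Nat.factorial (l i)), fun y => ?_⟩
    rw [abs_div, Nat.abs_cast]
    gcongr
    exact hM _
  have hGj : ∀ (i : Fin k) (y : Fin d → ℝ), G (Function.update y (ι i) 0) = G y := by
    intro i y
    refine Finset.prod_congr rfl fun q hq => ?_
    congr 2
    refine Finset.sum_congr rfl fun j _ => ?_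
    by_cases h : j = ι i
    · have : ⟪b j, vt q⟫ = 0 := by
        rw [h, hb]
        exact (Submodule.mem_orthogonal _ _).1 (hvt q hq) _ (Submodule.subset_span ⟨i, rfl⟩)
      simp [this]
    · simp [h]
  have hrew : ∀ y : Fin d → ℝ, (∏ i ∈ S, a ⟪∑ j, y j • b j, u i⟫) *
        ∏ i ∈ T, (iteratedDeriv (l i) a ⟪∑ j, y j • b j, vt i⟫ *
          ⟪∑ j, y j • b j, w i⟫ ^ (l i) / (Nat.factorial (l i)))
      = ∑ e ∈ P.support, P.coeff e * ((A y * G y) * ∏ i, y i ^ e i) := by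
    intro y
    have h1 : MvPolynomial.eval y P = ∏ i ∈ T, ⟪∑ j, y j • b j, w i⟫ ^ (l i) := by
      simp [P, hinner, map_prod]
    have h2 : ∑ e ∈ P.support, P.coeff e * ((A y * G y) * ∏ i, y i ^ e i)
        = (A y * G y) * MvPolynomial.eval y P := by
      rw [MvPolynomial.eval_eq', Finset.mul_sum]
      exact Finset.sum_congr rfl fun e _ => by ring
    rw [h2, h1, mul_assoc, ← Finset.prod_mul_distrib]
    congr 1
    · exact Finset.prod_congr rfl fun i _ => by rw [hu']
    · refine Finset.prod_congr rfl fun i _ => ?_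
      rw [hinner y (vt i)]
      ring
  simp_rw [hrew]
  rw [integral_finsetSum]
  swap
  · intro e _
    refine Integrable.const_mul ?_ _
    obtain ⟨M, hM⟩ := hAb
    obtain ⟨M', hM'⟩ := hGb
    refine (aux_int fun i => e i).bdd_mul (c := M * M') (hAc.mul hGc).aestronglyMeasurable
      (Filter.Eventually.of_forall fun y => ?_)
    rw [Real.norm_eq_abs, abs_mul]
    exact mul_le_mul (hM y) (hM' y) (abs_nonneg _) ((abs_nonneg _).trans (hM y))
  refine Finset.sum_eq_zero fun e he => ?_
  rw [integral_const_mul]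
  -- choose a coordinate in `S` of low degree
  obtain ⟨i, hiS, hi⟩ : ∃ i ∈ S, e (ι i) ≤ m := by
    by_contra! hcon
    have h1 : ∑ i ∈ S, e (ι i) ≤ m * S.card := by
      refine le_trans ?_ ((MvPolynomial.le_totalDegree he).trans hPdeg)
      rw [Finsupp.sum_fintype _ _ (by simp)]
      rw [← Finset.sum_image (f := fun j => e j) (g := ι) (fun x _ y _ h => hιinj h)]
      exact Finset.sum_le_sum_of_subset (Finset.subset_univ _)
    have h2 : ∑ _i ∈ S, m < ∑ i ∈ S, e (ι i) := Finset.sum_lt_sum_of_nonempty hS hcon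
    simp only [Finset.sum_const, smul_eq_mul] at h2
    rw [mul_comm] at h2
    omega
  let R : (Fin d → ℝ) → ℝ := fun y =>
    (∏ q ∈ S.erase i, a (y (ι q))) * G y * ∏ q ∈ Finset.univ.erase (ι i), y q ^ e q
  have hfac : ∀ y : Fin d → ℝ, (A y * G y) * ∏ q, y q ^ e q
      = (fun t => t ^ e (ι i) * a t) (y (ι i)) * R y := by
    intro y
    simp only [A, R]
    rw [← Finset.mul_prod_erase S (fun q => a (y (ι q))) hiS,
      ← Finset.mul_prod_erase Finset.univ (fun q => y q ^ e q) (Finset.mem_univ (ι i))]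
    ring
  simp_rw [hfac]
  rw [aux_coord (ι i) (fun t => t ^ e (ι i) * a t) R, mul_zero]
  · exact (by fun_prop : Continuous fun t => t ^ e (ι i) * a t).measurable
  · refine Continuous.measurable ?_
    refine (Continuous.mul (continuous_finsetProd _ fun i _ => by fun_prop) hGc).mul
      (continuous_finsetProd _ fun i _ => by fun_prop)
  · intro y
    simp only [R]
    rw [hGj]
    congr 1
    · congr 1
      refine Finset.prod_congr rfl fun q hq => ?_
      rw [Function.update_of_ne]
      exact fun h => (Finset.ne_of_mem_erase hq) (hιinj h)
    · refine Finset.prod_congr rfl fun q hq => ?_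
      rw [Function.update_of_ne (Finset.ne_of_mem_erase hq)]
  · exact hmom _ hi

end
end

section
/- Let m ≥ 1 be an integer and let X be a real random variable all of whose moments are finite and whose l-th moment equals the l-th moment of the standard Gaussian N(0,1) for every 1 ≤ l ≤ m. Let Y ∼ N(0,1) be independent of X and let δ ∈ (0,1). Then the random variable √(1−δ)·X + √δ·Y has its l-th moment equal to the l-th moment of N(0,1) for every 1 ≤ l ≤ m. -/
open MeasureTheory

open ProbabilityTheory in
/-- Binomial expansion of the moments of a combination of independent variables. -/
lemma moment_expand {Ω : Type*} [MeasurableSpace Ω] (μ : Measure Ω)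
    (X Y : Ω → ℝ) (hXY : IndepFun X Y μ)
    (hX : ∀ l : ℕ, Integrable (fun ω => X ω ^ l) μ)
    (hY : ∀ l : ℕ, Integrable (fun ω => Y ω ^ l) μ) (a b : ℝ) (l : ℕ) :
    (∫ ω, (a * X ω + b * Y ω) ^ l ∂μ) =
      ∑ k ∈ Finset.range (l + 1), (a ^ k * b ^ (l - k) * (l.choose k : ℝ)) *
        ((∫ ω, X ω ^ k ∂μ) * ∫ ω, Y ω ^ (l - k) ∂μ) := by
  have hind : ∀ i j : ℕ, IndepFun (fun ω => X ω ^ i) (fun ω => Y ω ^ j) μ := fun i j =>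
    hXY.comp (φ := fun x : ℝ => x ^ i) (ψ := fun x : ℝ => x ^ j)
      (by fun_prop) (by fun_prop)
  have hint : ∀ i j : ℕ, Integrable (fun ω => X ω ^ i * Y ω ^ j) μ := fun i j =>
    (hind i j).integrable_mul (hX i) (hY j)
  have e : ∀ ω, (a * X ω + b * Y ω) ^ l = ∑ k ∈ Finset.range (l + 1),
      (a ^ k * b ^ (l - k) * (l.choose k : ℝ)) * (X ω ^ k * Y ω ^ (l - k)) := by
    intro ω
    rw [add_pow]
    refine Finset.sum_congr rfl fun k _ => ?_
    rw [mul_pow, mul_pow]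
    ring
  simp_rw [e]
  rw [integral_finsetSum _ fun k _ => (hint k (l - k)).const_mul _]
  refine Finset.sum_congr rfl fun k _ => ?_
  rw [integral_const_mul]
  congr 1
  exact (hind k (l - k)).integral_fun_mul_eq_mul_integral (hX k).1 (hY (l - k)).1

open ProbabilityTheory in
lemma gaussian_pow_integrable (l : ℕ) :
    Integrable (fun t : ℝ => t ^ l) (gaussianReal 0 1) := by
  have h := (memLp_id_gaussianReal (μ := 0) (v := 1) (l : NNReal)).integrable_norm_pow'
  refine h.mono' (by fun_prop) (Filter.Eventually.of_forall fun t => ?_)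
  simp

open ProbabilityTheory in
lemma law_pow_integrable {Ω : Type*} [MeasurableSpace Ω] (μ : Measure Ω)
    (Y : Ω → ℝ) (hY : Measurable Y) (hlaw : Measure.map Y μ = gaussianReal 0 1) (l : ℕ) :
    Integrable (fun ω => Y ω ^ l) μ := by
  have h := gaussian_pow_integrable l
  rw [← hlaw] at h
  exact h.comp_measurable hY

open ProbabilityTheory in
lemma law_pow_integral {Ω : Type*} [MeasurableSpace Ω] (μ : Measure Ω)
    (Y : Ω → ℝ) (hY : Measurable Y) (hlaw : Measure.map Y μ = gaussianReal 0 1) (l : ℕ) :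
    (∫ ω, Y ω ^ l ∂μ) = ∫ t, t ^ l ∂(gaussianReal 0 1) := by
  rw [← hlaw, integral_map hY.aemeasurable (by fun_prop)]

open ProbabilityTheory in
/-- The combination of two independent standard Gaussians is standard Gaussian. -/
lemma gaussian_comb {Ω : Type*} [MeasurableSpace Ω] (μ : Measure Ω)
    (X Y : Ω → ℝ) (hX : Measurable X) (hY : Measurable Y) (hXY : IndepFun X Y μ)
    (hXl : Measure.map X μ = gaussianReal 0 1) (hYl : Measure.map Y μ = gaussianReal 0 1)
    (a b : ℝ) (hab : a ^ 2 + b ^ 2 = 1) :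
    Measure.map (fun ω => a * X ω + b * Y ω) μ = gaussianReal 0 1 := by
  have h1 : ∀ (Z : Ω → ℝ) (c : ℝ), Measurable Z → Measure.map Z μ = gaussianReal 0 1 →
      Measure.map (fun ω => c * Z ω) μ = gaussianReal (c * 0) (NNReal.mk (c ^ 2) (sq_nonneg _) * 1) := by
    intro Z c hZ hl
    rw [← gaussianReal_map_const_mul, ← hl, Measure.map_map (by fun_prop) hZ]
    rfl
  have hi : IndepFun (fun ω => a * X ω) (fun ω => b * Y ω) μ :=
    hXY.comp (φ := fun x : ℝ => a * x) (ψ := fun x : ℝ => b * x) (by fun_prop) (by fun_prop)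
  have := gaussianReal_add_gaussianReal_of_indepFun hi (h1 X a hX hXl) (h1 Y b hY hYl)
  have e : (fun ω => a * X ω + b * Y ω) = (fun ω => a * X ω) + (fun ω => b * Y ω) := rfl
  rw [e, this]
  congr 1
  · simp
  · apply NNReal.eq
    simpa using hab

/-- If `X` matches the first `m` moments of `N(0,1)`, `Y ∼ N(0,1)` is
independent of `X`, and `δ ∈ (0,1)`, then `√(1−δ)·X + √δ·Y` matches the first `m` moments
of `N(0,1)` as well. -/
theorem stmt14 {Ω : Type*} [MeasurableSpace Ω] (μ : Measure Ω) [IsProbabilityMeasure μ]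
    (m : ℕ) (hm : 1 ≤ m)
    (X Y : Ω → ℝ) (hX : Measurable X) (hY : Measurable Y)
    (hXY : ProbabilityTheory.IndepFun X Y μ)
    (hYlaw : Measure.map Y μ = ProbabilityTheory.gaussianReal 0 1)
    (hXint : ∀ l : ℕ, Integrable (fun ω => X ω ^ l) μ)
    (hXmom : ∀ l : ℕ, 1 ≤ l → l ≤ m →
      (∫ ω, X ω ^ l ∂μ) = ∫ t, t ^ l ∂(ProbabilityTheory.gaussianReal 0 1))
    (δ : ℝ) (hδ0 : 0 < δ) (hδ1 : δ < 1) :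
    ∀ l : ℕ, 1 ≤ l → l ≤ m →
      (∫ ω, (Real.sqrt (1 - δ) * X ω + Real.sqrt δ * Y ω) ^ l ∂μ) =
        ∫ t, t ^ l ∂(ProbabilityTheory.gaussianReal 0 1) := by
  intro l _ hl
  set γ := ProbabilityTheory.gaussianReal 0 1 with hγ
  have hf : Measure.map (Prod.fst : ℝ × ℝ → ℝ) (γ.prod γ) = γ := by
    simp
  have hs : Measure.map (Prod.snd : ℝ × ℝ → ℝ) (γ.prod γ) = γ := by
    simp
  have hi : ProbabilityTheory.IndepFun (Prod.fst : ℝ × ℝ → ℝ) Prod.snd (γ.prod γ) :=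
    ProbabilityTheory.indepFun_prod (X := id) (Y := id) measurable_id measurable_id
  have hab : Real.sqrt (1 - δ) ^ 2 + Real.sqrt δ ^ 2 = 1 := by
    rw [Real.sq_sqrt (by linarith), Real.sq_sqrt hδ0.le]
    ring
  have hlaw := gaussian_comb (γ.prod γ) Prod.fst Prod.snd measurable_fst measurable_snd hi hf hs
    _ _ hab
  rw [← law_pow_integral (γ.prod γ) _ (by fun_prop) hlaw l,
    moment_expand (γ.prod γ) _ _ hi (law_pow_integrable _ _ measurable_fst hf)
      (law_pow_integrable _ _ measurable_snd hs),
    moment_expand μ X Y hXY hXint (law_pow_integrable _ _ hY hYlaw)]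
  refine Finset.sum_congr rfl fun k hk => ?_
  have hk' : k ≤ l := by
    have := Finset.mem_range.mp hk
    omega
  rw [law_pow_integral μ Y hY hYlaw, law_pow_integral _ _ measurable_fst hf,
    law_pow_integral _ _ measurable_snd hs]
  congr 2
  rcases Nat.eq_zero_or_pos k with rfl | h0
  · simp [hγ]
  · exact hXmom k h0 (hk'.trans hl)
end

section
/- Let σ : ℝ → ℝ be 1-Lipschitz with σ(0) = 0, applied entrywise to vectors. Let ℓ ≥ 1 and let d_0, d_1, …, d_ℓ be positive integers with d_i ≤ d for all i. For matrices W_i ∈ ℝ^{d_i × d_{i−1}} (i = 1,…,ℓ), define g_W : ℝ^{d_0} → ℝ^{d_ℓ} by g_W(x) = σ(W_ℓ·σ(W_{ℓ−1}·⋯·σ(W_1·x))). If B ≥ 1 is such that every entry of every W_i and every W'_i lies in [−B, B], then for every x ∈ ℝ^{d_0}: ‖g_W(x) − g_{W'}(x)‖₂ ≤ (Σ_{i=1}^ℓ ‖W_i − W'_i‖_{1}) · ‖x‖₂ · (dB)^ℓ, where ‖M‖_{1} denotes the sum of the absolute values of the entries of M. -/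
noncomputable section

/-- A feedforward neural network with activation `σ` applied entrywise after each layer:
`net σ dims W n x = σ(W_{n-1} · σ(⋯ σ(W_0 · x)))`. -/
def net (σ : ℝ → ℝ) (dims : ℕ → ℕ)
    (W : (i : ℕ) → Matrix (Fin (dims (i + 1))) (Fin (dims i)) ℝ) :
    (n : ℕ) → (Fin (dims 0) → ℝ) → (Fin (dims n) → ℝ)
  | 0 => fun x => x
  | n + 1 => fun x j => σ (((W n).mulVec (net σ dims W n x)) j)

/-- Euclidean norm of a vector. -/
def e2norm {n : ℕ} (v : Fin n → ℝ) : ℝ := Real.sqrt (∑ j, v j ^ 2)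

/-- Entrywise `ℓ¹` norm of a matrix. -/
def matL1 {n m : ℕ} (M : Matrix (Fin n) (Fin m) ℝ) : ℝ := ∑ j, ∑ k, |M j k|

theorem e2norm_eq {n : ℕ} (v : Fin n → ℝ) : e2norm v = ‖WithLp.toLp 2 v‖ := by
  rw [EuclideanSpace.norm_eq]
  simp [e2norm]

theorem e2norm_nonneg {n : ℕ} (v : Fin n → ℝ) : 0 ≤ e2norm v := Real.sqrt_nonneg _

theorem e2norm_add_le {n : ℕ} (v w : Fin n → ℝ) : e2norm (v + w) ≤ e2norm v + e2norm w := by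
  rw [e2norm_eq, e2norm_eq, e2norm_eq, WithLp.toLp_add]
  exact norm_add_le _ _

theorem e2norm_mono {n : ℕ} (v w : Fin n → ℝ) (h : ∀ j, |v j| ≤ |w j|) :
    e2norm v ≤ e2norm w :=
  Real.sqrt_le_sqrt (Finset.sum_le_sum fun j _ => sq_le_sq.mpr (h j))

theorem e2norm_sq {n : ℕ} (v : Fin n → ℝ) : e2norm v ^ 2 = ∑ j, v j ^ 2 :=
  Real.sq_sqrt (Finset.sum_nonneg fun j _ => sq_nonneg _)

theorem abs_le_e2norm {n : ℕ} (v : Fin n → ℝ) (j : Fin n) : |v j| ≤ e2norm v := by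
  apply abs_le_of_sq_le_sq' _ (e2norm_nonneg v) |> abs_le.mpr
  rw [e2norm_sq]
  exact Finset.single_le_sum (f := fun j => v j ^ 2) (fun j _ => sq_nonneg _) (Finset.mem_univ j)

theorem e2norm_le_sum {n : ℕ} (v : Fin n → ℝ) : e2norm v ≤ ∑ j, |v j| := by
  have h0 : 0 ≤ ∑ j, |v j| := Finset.sum_nonneg fun j _ => abs_nonneg _
  apply Real.sqrt_le_iff.mpr ⟨h0, _⟩
  rw [sq (∑ j, |v j|), Finset.sum_mul]
  apply Finset.sum_le_sum
  intro j _
  rw [← sq_abs, sq]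
  exact mul_le_mul_of_nonneg_left
    (Finset.single_le_sum (f := fun j => |v j|) (fun j _ => abs_nonneg _) (Finset.mem_univ j))
    (abs_nonneg _)

theorem e2norm_mulVec_l1 {n m : ℕ} (M : Matrix (Fin n) (Fin m) ℝ) (v : Fin m → ℝ) :
    e2norm (M.mulVec v) ≤ matL1 M * e2norm v := by
  refine (e2norm_le_sum _).trans ?_
  unfold matL1
  rw [Finset.sum_mul]
  apply Finset.sum_le_sum
  intro j _
  rw [Finset.sum_mul]
  refine (Finset.abs_sum_le_sum_abs (fun k => M j k * v k) Finset.univ).trans (Finset.sum_le_sum fun k _ => ?_)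
  rw [abs_mul]
  exact mul_le_mul_of_nonneg_left (abs_le_e2norm v k) (abs_nonneg _)

theorem e2norm_mulVec_bd {n m d : ℕ} (hn : n ≤ d) (hm : m ≤ d) (B : ℝ) (hB : 1 ≤ B)
    (M : Matrix (Fin n) (Fin m) ℝ) (hM : ∀ j k, |M j k| ≤ B) (v : Fin m → ℝ) :
    e2norm (M.mulVec v) ≤ (d * B) * e2norm v := by
  have hd : (0:ℝ) ≤ d * B := by positivity
  refine Real.sqrt_le_iff.mpr ⟨mul_nonneg hd (e2norm_nonneg v), ?_⟩
  have hn' : (n:ℝ) ≤ d := by exact_mod_cast hn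
  have hm' : (m:ℝ) ≤ d := by exact_mod_cast hm
  have key : ∀ j, (M.mulVec v) j ^ 2 ≤ d * B ^ 2 * e2norm v ^ 2 := by
    intro j
    rw [e2norm_sq]
    refine (Finset.sum_mul_sq_le_sq_mul_sq Finset.univ (fun k => M j k) v).trans ?_
    refine mul_le_mul_of_nonneg_right ?_ (Finset.sum_nonneg fun j _ => sq_nonneg _)
    calc ∑ k, M j k ^ 2 ≤ ∑ k : Fin m, B ^ 2 :=
          Finset.sum_le_sum fun k _ => sq_le_sq.mpr ((hM j k).trans (le_abs_self B))
      _ = m * B ^ 2 := by simp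
      _ ≤ d * B ^ 2 := by gcongr
  calc ∑ j, (M.mulVec v) j ^ 2 ≤ ∑ j : Fin n, (d * B ^ 2 * e2norm v ^ 2) :=
        Finset.sum_le_sum fun j _ => key j
    _ = n * (d * B ^ 2 * e2norm v ^ 2) := by simp
    _ ≤ d * (d * B ^ 2 * e2norm v ^ 2) := by gcongr
    _ = _ := by ring

/-- An `ℓ`-layer network with 1-Lipschitz activation, widths at most `d` and
weights in `[−B, B]` is Lipschitz in its weights:
`‖g_W(x) − g_{W'}(x)‖₂ ≤ (∑_i ‖W_i − W'_i‖₁)·‖x‖₂·(dB)^ℓ`. -/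
theorem stmt15 (σ : ℝ → ℝ) (hσ : LipschitzWith 1 σ) (hσ0 : σ 0 = 0)
    (d ℓ : ℕ) (hℓ : 1 ≤ ℓ)
    (dims : ℕ → ℕ) (hdims : ∀ i : ℕ, i ≤ ℓ → 0 < dims i ∧ dims i ≤ d)
    (B : ℝ) (hB : 1 ≤ B)
    (W W' : (i : ℕ) → Matrix (Fin (dims (i + 1))) (Fin (dims i)) ℝ)
    (hW : ∀ i : ℕ, i < ℓ → ∀ j k, |W i j k| ≤ B)
    (hW' : ∀ i : ℕ, i < ℓ → ∀ j k, |W' i j k| ≤ B)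
    (x : Fin (dims 0) → ℝ) :
    e2norm (net σ dims W ℓ x - net σ dims W' ℓ x) ≤
      (∑ i ∈ Finset.range ℓ, matL1 (W i - W' i)) * e2norm x * ((d : ℝ) * B) ^ ℓ := by
  have hd1 : (1:ℝ) ≤ d := by
    have := hdims 0 (Nat.zero_le _)
    exact_mod_cast (by omega : 1 ≤ d)
  have hdB : (1:ℝ) ≤ d * B := one_le_mul_of_one_le_of_one_le hd1 hB
  have hL : ∀ a b, |σ a - σ b| ≤ |a - b| := by
    intro a b
    simpa [Real.dist_eq] using hσ.dist_le_mul a b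
  have hg : ∀ n, n ≤ ℓ → e2norm (net σ dims W' n x) ≤ ((d : ℝ) * B) ^ n * e2norm x := by
    intro n
    induction n with
    | zero => intro _; simp [net]
    | succ n ih =>
      intro hn
      have h1 : e2norm (net σ dims W' (n + 1) x) ≤
          e2norm ((W' n).mulVec (net σ dims W' n x)) := by
        apply e2norm_mono
        intro j
        simpa [net, hσ0] using hL (((W' n).mulVec (net σ dims W' n x)) j) 0
      have h2 := e2norm_mulVec_bd (hdims (n + 1) hn).2 (hdims n (by omega)).2 B hB (W' n)
        (hW' n hn) (net σ dims W' n x)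
      have h3 := mul_le_mul_of_nonneg_left (ih (by omega)) (by linarith : (0:ℝ) ≤ d * B)
      rw [pow_succ]
      linarith
  have main : ∀ n, n ≤ ℓ → e2norm (net σ dims W n x - net σ dims W' n x) ≤
      (∑ i ∈ Finset.range n, matL1 (W i - W' i)) * e2norm x * ((d : ℝ) * B) ^ n := by
    intro n
    induction n with
    | zero => intro _; simp [net, e2norm]
    | succ n ih =>
      intro hn
      have h1 : e2norm (net σ dims W (n + 1) x - net σ dims W' (n + 1) x) ≤
          e2norm ((W n).mulVec (net σ dims W n x - net σ dims W' n x) +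
            (W n - W' n).mulVec (net σ dims W' n x)) := by
        apply e2norm_mono
        intro j
        have h := hL (((W n).mulVec (net σ dims W n x)) j) (((W' n).mulVec (net σ dims W' n x)) j)
        rw [Matrix.mulVec_sub, Matrix.sub_mulVec, sub_add_sub_cancel]
        exact h
      have h2 := e2norm_mulVec_bd (hdims (n + 1) hn).2 (hdims n (by omega)).2 B hB (W n)
        (hW n hn) (net σ dims W n x - net σ dims W' n x)
      have h3 := mul_le_mul_of_nonneg_left (ih (by omega)) (by linarith : (0:ℝ) ≤ d * B)
      have h4 := e2norm_mulVec_l1 (W n - W' n) (net σ dims W' n x)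
      have hm : 0 ≤ matL1 (W n - W' n) :=
        Finset.sum_nonneg fun j _ => Finset.sum_nonneg fun k _ => abs_nonneg _
      have h5 := mul_le_mul_of_nonneg_left (hg n (by omega)) hm
      have h6 : 0 ≤ matL1 (W n - W' n) * (((d : ℝ) * B) ^ n * e2norm x) :=
        mul_nonneg hm (mul_nonneg (by positivity) (e2norm_nonneg x))
      have h7 := le_mul_of_one_le_right h6 hdB
      have h8 := e2norm_add_le ((W n).mulVec (net σ dims W n x - net σ dims W' n x))
        ((W n - W' n).mulVec (net σ dims W' n x))
      rw [Finset.sum_range_succ, pow_succ]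
      linarith
  exact main ℓ le_rfl

end
end
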